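/- For every compact set K ⊆ (−1,1) there is a constant C > 0 such that for all n ≥ 1 and all x ∈ K, | 2^n √(w(x)) (1−x²)^{1/4} π_n(x) / (√2 D_∞) − cos( (n+1/2) arccos x + ψ(x) − π/4 ) | ≤ C/n; that is, π_n(x) = (√2 D_∞ / (2^n √(w(x)) (1−x²)^{1/4})) · [ cos( (n+1/2) arccos x + ψ(x) − π/4 ) + O(1/n) ] uniformly on compact subsets of (−1,1). -/

import Mathlib

open Complex Filter Set MeasureTheory

noncomputable section

/-- The segment [-1,1] regarded as a subset of the complex plane. -/
def seg : Set ℂ := Complex.ofReal '' Set.Icc (-1) 1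

/-- Jacobi weight. -/
def jw (α β x : ℝ) : ℝ := (1 - x) ^ α * (1 + x) ^ β

/-- Jacobi measure on (-1,1). -/
def jmu (α β : ℝ) : Measure ℝ :=
  (volume.restrict (Ioo (-1:ℝ) 1)).withDensity (fun x => ENNReal.ofReal (jw α β x))

lemma jw_nonneg {α β x : ℝ} (hx : x ∈ Ioo (-1:ℝ) 1) : 0 ≤ jw α β x := by
  unfold jw
  have h1 : 0 ≤ 1 - x := by linarith [hx.2]
  have h2 : 0 ≤ 1 + x := by linarith [hx.1]
  positivity

lemma jw_pos {α β x : ℝ} (hx : x ∈ Ioo (-1:ℝ) 1) : 0 < jw α β x := by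
  unfold jw
  have h1 : 0 < 1 - x := by linarith [hx.2]
  have h2 : 0 < 1 + x := by linarith [hx.1]
  positivity

lemma jw_meas (α β : ℝ) : Measurable (jw α β) := by
  unfold jw; fun_prop

lemma jw_intervalIntegrable {α β : ℝ} (hα : -1 < α) (hβ : -1 < β) :
    IntervalIntegrable (jw α β) volume (-1) 1 := by
  have hA : IntervalIntegrable (jw α β) volume (-1) 0 := by
    have h1 : IntervalIntegrable (fun x : ℝ => (x+1) ^ β) volume (-1) 0 := by
      have := (intervalIntegral.intervalIntegrable_rpow' (a := 0) (b := 1) hβ).comp_add_right (1:ℝ)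
      simpa using this
    have h2 : ContinuousOn (fun x : ℝ => (1 - x) ^ α) (uIcc (-1) 0) := by
      apply ContinuousOn.rpow_const (by fun_prop)
      intro x hx
      rw [uIcc_of_le (by norm_num)] at hx
      left; linarith [hx.2]
    refine (h1.continuousOn_mul h2).congr ?_
    intro x _
    simp only [jw]; rw [add_comm x 1]
  have hB : IntervalIntegrable (jw α β) volume 0 1 := by
    have h1 : IntervalIntegrable (fun x : ℝ => (1-x) ^ α) volume 0 1 := by
      have := (intervalIntegral.intervalIntegrable_rpow' (a := 0) (b := 1) hα).comp_sub_left (1:ℝ)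
      simpa using this.symm
    have h2 : ContinuousOn (fun x : ℝ => (1 + x) ^ β) (uIcc 0 1) := by
      apply ContinuousOn.rpow_const (by fun_prop)
      intro x hx
      rw [uIcc_of_le (by norm_num)] at hx
      left; linarith [hx.1]
    refine (h1.mul_continuousOn h2).congr ?_
    intro x _
    simp only [jw]
  exact hA.trans hB

lemma jw_integrableOn {α β : ℝ} (hα : -1 < α) (hβ : -1 < β) :
    IntegrableOn (jw α β) (Ioo (-1) 1) := by
  have := jw_intervalIntegrable hα hβ
  rw [intervalIntegrable_iff_integrableOn_Ioo_of_le (by norm_num)] at this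
  exact this

lemma jmu_finite {α β : ℝ} (hα : -1 < α) (hβ : -1 < β) : IsFiniteMeasure (jmu α β) := by
  have h := (jw_integrableOn hα hβ)
  unfold jmu
  refine isFiniteMeasure_withDensity_ofReal h.2

lemma jmu_ae (α β : ℝ) : ∀ᵐ x ∂(jmu α β), x ∈ Ioo (-1:ℝ) 1 := by
  unfold jmu
  refine (withDensity_absolutelyContinuous _ _).ae_le ?_
  exact ae_restrict_mem measurableSet_Ioo

lemma jmu_integral (α β : ℝ) (f : ℝ → ℝ) :
    ∫ x, f x ∂(jmu α β) = ∫ x in (-1:ℝ)..1, f x * jw α β x := by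
  unfold jmu
  rw [integral_withDensity_eq_integral_toReal_smul₀]
  · rw [intervalIntegral.integral_of_le (by norm_num), integral_Ioc_eq_integral_Ioo]
    refine setIntegral_congr_fun measurableSet_Ioo ?_
    intro x hx
    simp only [smul_eq_mul]
    rw [ENNReal.toReal_ofReal (jw_nonneg hx), mul_comm]
  · exact (ENNReal.measurable_ofReal.comp (jw_meas α β)).aemeasurable
  · simp

lemma jmu_integrable {α β : ℝ} (hα : -1 < α) (hβ : -1 < β) {f : ℝ → ℝ}
    (hf : ContinuousOn f (Icc (-1) 1)) : Integrable f (jmu α β) := by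
  have := jmu_finite hα hβ
  obtain ⟨C, hC⟩ := isCompact_Icc.exists_bound_of_continuousOn hf
  have hm : AEStronglyMeasurable f (jmu α β) := by
    have : AEStronglyMeasurable f (volume.restrict (Ioo (-1:ℝ) 1)) :=
      (hf.mono Ioo_subset_Icc_self).aestronglyMeasurable measurableSet_Ioo
    exact this.mono_ac (withDensity_absolutelyContinuous _ _)
  refine Integrable.of_bound hm C ?_
  filter_upwards [jmu_ae α β] with x hx
  exact hC x (Ioo_subset_Icc_self hx)

open Polynomial in
/-- The moment functional. -/
def jI {α β : ℝ} (hα : -1 < α) (hβ : -1 < β) : ℝ[X] →ₗ[ℝ] ℝ where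
  toFun p := ∫ x, p.eval x ∂(jmu α β)
  map_add' p q := by
    simp only [eval_add]
    exact integral_add (jmu_integrable hα hβ p.continuous.continuousOn)
      (jmu_integrable hα hβ q.continuous.continuousOn)
  map_smul' c p := by
    simp only [eval_smul, smul_eq_mul, RingHom.id_apply]
    exact integral_const_mul _ _

section
open Polynomial

variable {α β : ℝ} (hα : -1 < α) (hβ : -1 < β)

lemma jI_apply (p : ℝ[X]) : jI hα hβ p = ∫ x, p.eval x ∂(jmu α β) := rfl

lemma jI_sq_nonneg (p : ℝ[X]) : 0 ≤ jI hα hβ (p * p) := by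
  rw [jI_apply]
  apply integral_nonneg
  intro x; simp only [eval_mul]; exact mul_self_nonneg _

lemma jI_sq_eq_zero (p : ℝ[X]) (h : jI hα hβ (p * p) = 0) : p = 0 := by
  rw [jI_apply, integral_eq_zero_iff_of_nonneg (fun x => by simp only [eval_mul]; exact mul_self_nonneg _)
    (jmu_integrable hα hβ (p*p).continuous.continuousOn)] at h
  by_contra hp
  have h2 : ∀ᵐ x ∂(volume.restrict (Ioo (-1:ℝ) 1)), p.eval x = 0 := by
    have h3 := h
    unfold jmu at h3
    rw [Filter.EventuallyEq, ae_withDensity_iff (f := fun x => ENNReal.ofReal (jw α β x)) (jw_meas α β).ennreal_ofReal] at h3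
    filter_upwards [h3, ae_restrict_mem measurableSet_Ioo] with x hx hx2
    have := hx (by simpa using jw_pos hx2)
    simpa using this
  rw [ae_restrict_iff' measurableSet_Ioo] at h2
  have hfin : (↑(p.roots.toFinset) : Set ℝ).Finite := Finset.finite_toSet _
  have h4 : volume (Ioo (-1:ℝ) 1) = 0 := by
    have h5 : volume (Ioo (-1:ℝ) 1 \ (↑(p.roots.toFinset) : Set ℝ)) = 0 := by
      refine measure_mono_null ?_ h2
      intro x hx
      simp only [mem_compl_iff, mem_ofPred_eq, Classical.not_imp]
      refine ⟨hx.1, fun h6 => hx.2 ?_⟩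
      simp [hp, h6]
    rwa [measure_sdiff_null (hfin.measure_zero _)] at h5
  rw [Real.volume_Ioo] at h4
  norm_num at h4

lemma jI_sq_pos {p : ℝ[X]} (hp : p ≠ 0) : 0 < jI hα hβ (p * p) :=
  lt_of_le_of_ne (jI_sq_nonneg hα hβ p) (fun h => hp (jI_sq_eq_zero hα hβ p h.symm))

lemma jI_bound {q p : ℝ[X]} {C : ℝ} (hq : ∀ x ∈ Icc (-1:ℝ) 1, |q.eval x| ≤ C) :
    jI hα hβ ((q * p) * (q * p)) ≤ C ^ 2 * jI hα hβ (p * p) := by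
  rw [jI_apply, jI_apply, ← integral_const_mul]
  apply integral_mono_ae (jmu_integrable hα hβ (Polynomial.continuous _).continuousOn)
  · exact (jmu_integrable hα hβ (Polynomial.continuous _).continuousOn).const_mul _
  filter_upwards [jmu_ae α β] with x hx
  have h1 := hq x (Ioo_subset_Icc_self hx)
  simp only [eval_mul]
  have h2 : (q.eval x)^2 ≤ C^2 := by
    rw [← sq_abs]; exact pow_le_pow_left₀ (abs_nonneg _) h1 2
  nlinarith [mul_self_nonneg (p.eval x)]

/-- L² norm -/
def jN (p : ℝ[X]) : ℝ := Real.sqrt (jI hα hβ (p * p))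

lemma jN_nonneg (p : ℝ[X]) : 0 ≤ jN hα hβ p := Real.sqrt_nonneg _

lemma jN_sq (p : ℝ[X]) : jN hα hβ p ^ 2 = jI hα hβ (p * p) := Real.sq_sqrt (jI_sq_nonneg hα hβ p)

lemma jI_cs (p q : ℝ[X]) : |jI hα hβ (p * q)| ≤ jN hα hβ p * jN hα hβ q := by
  have h : ∀ t : ℝ, 0 ≤ jI hα hβ (q*q) * (t * t) + (2 * jI hα hβ (p*q)) * t + jI hα hβ (p*p) := by
    intro t
    have := jI_sq_nonneg hα hβ (p + t • q)
    have e : (p + t • q) * (p + t • q) = p * p + (2 * t) • (p * q) + (t * t) • (q * q) := by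
      simp only [smul_eq_C_mul, map_mul, map_ofNat]; ring
    rw [e, map_add, map_add, map_smul, map_smul, smul_eq_mul, smul_eq_mul] at this
    linarith
  have := discrim_le_zero h
  rw [discrim] at this
  apply abs_le_of_sq_le_sq _ (mul_nonneg (jN_nonneg hα hβ p) (jN_nonneg hα hβ q))
  rw [mul_pow, jN_sq, jN_sq]
  nlinarith

lemma jN_add (p q : ℝ[X]) : jN hα hβ (p + q) ≤ jN hα hβ p + jN hα hβ q := by
  apply abs_le_of_sq_le_sq' _ (add_nonneg (jN_nonneg hα hβ p) (jN_nonneg hα hβ q)) |>.2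
  rw [jN_sq]
  have e : (p + q) * (p + q) = p * p + (2:ℝ) • (p * q) + q * q := by
    simp only [smul_eq_C_mul, map_ofNat]; ring
  rw [e, map_add, map_add, map_smul, smul_eq_mul, ← jN_sq, ← jN_sq]
  nlinarith [le_abs_self (jI hα hβ (p*q)), jI_cs hα hβ p q]

lemma jN_smul (c : ℝ) (p : ℝ[X]) : jN hα hβ (c • p) = |c| * jN hα hβ p := by
  unfold jN
  have : (c • p) * (c • p) = (c^2) • (p * p) := by
    simp only [smul_eq_C_mul, map_pow]; ring
  rw [this, map_smul, smul_eq_mul, Real.sqrt_mul (sq_nonneg c), Real.sqrt_sq_eq_abs]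

lemma jN_mul {q p : ℝ[X]} {C : ℝ} (hC : 0 ≤ C) (hq : ∀ x ∈ Icc (-1:ℝ) 1, |q.eval x| ≤ C) :
    jN hα hβ (q * p) ≤ C * jN hα hβ p := by
  apply abs_le_of_sq_le_sq' _ (mul_nonneg hC (jN_nonneg hα hβ p)) |>.2
  rw [jN_sq, mul_pow, jN_sq]
  exact jI_bound hα hβ hq

lemma jN_sum {ι : Type*} (s : Finset ι) (f : ι → ℝ[X]) :
    jN hα hβ (∑ i ∈ s, f i) ≤ ∑ i ∈ s, jN hα hβ (f i) := by
  classical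
  induction s using Finset.induction_on with
  | empty => simp [jN]
  | insert a s ha ih =>
    rw [Finset.sum_insert ha, Finset.sum_insert ha]
    exact (jN_add hα hβ _ _).trans (by linarith)

lemma jN_zero : jN hα hβ 0 = 0 := by simp [jN]

end

section
open Polynomial

variable {α β : ℝ} (hα : -1 < α) (hβ : -1 < β)

lemma jP_exists (n : ℕ) : ∃ p : ℝ[X], p.Monic ∧ p.natDegree = n ∧
    ∀ q : ℝ[X], q.degree < n → jI hα hβ (p * q) = 0 := by
  let V := degreeLT ℝ n
  let φ : V →ₗ[ℝ] Module.Dual ℝ V :=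
    LinearMap.mk₂ ℝ (fun q r => jI hα hβ (q.1 * r.1))
      (by intro a b c; simp [add_mul]) (by intro a b c; simp)
      (by intro a b c; simp [mul_add]) (by intro a b c; simp)
  have hφ : ∀ q r : V, φ q r = jI hα hβ (q.1 * r.1) := fun q r => rfl
  have hfd : FiniteDimensional ℝ V := (degreeLTEquiv ℝ n).symm.finiteDimensional
  have hinj : Function.Injective φ := by
    rw [injective_iff_map_eq_zero]
    intro a ha
    have : φ a a = 0 := by rw [ha]; rfl
    rw [hφ] at this
    exact Subtype.ext (jI_sq_eq_zero hα hβ _ this)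
  have hsurj : Function.Surjective φ :=
    (LinearMap.injective_iff_surjective_of_finrank_eq_finrank
      (Subspace.dual_finrank_eq (K := ℝ) (V := V)).symm).1 hinj
  let ξ : Module.Dual ℝ V :=
    { toFun := fun r => jI hα hβ (X ^ n * r.1)
      map_add' := by intro a b; simp [mul_add]
      map_smul' := by intro a b; simp }
  obtain ⟨q, hq⟩ := hsurj ξ
  have hqd : q.1.degree < n := mem_degreeLT.1 q.2
  have hmon : (X ^ n - q.1).Monic := monic_X_pow_sub (by
    rcases n with _ | n
    · simpa using hqd
    · exact hqd)
  refine ⟨X ^ n - q.1, hmon, ?_, ?_⟩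
  · have : (X ^ n - q.1).degree = (n : WithBot ℕ) := by
      rw [degree_sub_eq_left_of_degree_lt]
      · simp
      · simpa using hqd
    exact natDegree_eq_of_degree_eq_some this
  · intro r hr
    have h1 : φ q ⟨r, mem_degreeLT.2 hr⟩ = ξ ⟨r, mem_degreeLT.2 hr⟩ := by rw [hq]
    have h2 : jI hα hβ (q.1 * r) = jI hα hβ (X ^ n * r) := h1
    rw [sub_mul, map_sub, h2, sub_self]

/-- Monic Jacobi polynomials. -/
def jP (n : ℕ) : ℝ[X] := (jP_exists hα hβ n).choose

lemma jP_monic (n : ℕ) : (jP hα hβ n).Monic := (jP_exists hα hβ n).choose_spec.1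
lemma jP_natDegree (n : ℕ) : (jP hα hβ n).natDegree = n := (jP_exists hα hβ n).choose_spec.2.1
lemma jP_orth (n : ℕ) (q : ℝ[X]) (hq : q.degree < n) : jI hα hβ (jP hα hβ n * q) = 0 :=
  (jP_exists hα hβ n).choose_spec.2.2 q hq
lemma jP_ne_zero (n : ℕ) : jP hα hβ n ≠ 0 := (jP_monic hα hβ n).ne_zero
lemma jP_degree (n : ℕ) : (jP hα hβ n).degree = n := by
  rw [degree_eq_natDegree (jP_ne_zero hα hβ n), jP_natDegree]
lemma jP_coeff_self (n : ℕ) : (jP hα hβ n).coeff n = 1 := by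
  have := (jP_monic hα hβ n).coeff_natDegree
  rwa [jP_natDegree] at this
lemma jP_coeff_gt (n k : ℕ) (h : n < k) : (jP hα hβ n).coeff k = 0 :=
  coeff_eq_zero_of_natDegree_lt (by rwa [jP_natDegree])

lemma jP_orth' {n m : ℕ} (h : n ≠ m) : jI hα hβ (jP hα hβ n * jP hα hβ m) = 0 := by
  rcases lt_or_gt_of_ne h with h | h
  · rw [mul_comm]; apply jP_orth; rw [jP_degree]; exact_mod_cast h
  · apply jP_orth; rw [jP_degree]; exact_mod_cast h

lemma jP_expand (n : ℕ) : ∀ q : ℝ[X], q.degree < n →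
    q = ∑ j ∈ Finset.range n,
      (jI hα hβ (q * jP hα hβ j) / jI hα hβ (jP hα hβ j * jP hα hβ j)) • jP hα hβ j := by
  induction n with
  | zero =>
    intro q hq
    have : q = 0 := by simpa using hq
    simp [this]
  | succ n ih =>
    intro q hq
    have hd : (q - q.coeff n • jP hα hβ n).degree < n := by
      rw [degree_lt_iff_coeff_zero] at hq ⊢
      intro m hm
      rcases Nat.eq_or_lt_of_le hm with h | h
      · subst h; simp [jP_coeff_self]
      · simp [hq m h, jP_coeff_gt hα hβ n m h]
    have h1 := ih _ hd
    have h2 : jI hα hβ (q * jP hα hβ n) = q.coeff n * jI hα hβ (jP hα hβ n * jP hα hβ n) := by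
      have := jP_orth hα hβ n _ hd
      rw [mul_sub, map_sub, mul_smul_comm, map_smul, smul_eq_mul, mul_comm (jP hα hβ n) q] at this
      linarith
    have h3 : ∀ j ∈ Finset.range n, jI hα hβ ((q - q.coeff n • jP hα hβ n) * jP hα hβ j)
        = jI hα hβ (q * jP hα hβ j) := by
      intro j hj
      rw [sub_mul, map_sub, smul_mul_assoc, map_smul, jP_orth' hα hβ (Finset.mem_range.1 hj).ne']
      simp
    rw [Finset.sum_range_succ, h2, mul_div_assoc, div_self (jI_sq_pos hα hβ (jP_ne_zero hα hβ n)).ne',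
      mul_one]
    rw [Finset.sum_congr rfl (fun j hj => by rw [h3 j hj])] at h1
    rw [← h1]; simp

lemma jP_zero_of (n : ℕ) (q : ℝ[X]) (hq : q.degree < n)
    (h : ∀ j < n, jI hα hβ (q * jP hα hβ j) = 0) : q = 0 := by
  rw [jP_expand hα hβ n q hq]
  apply Finset.sum_eq_zero
  intro j hj
  rw [h j (Finset.mem_range.1 hj)]; simp

/-- Jacobi differential operator -/
def jL (α β : ℝ) (p : ℝ[X]) : ℝ[X] :=
  (1 - X ^ 2) * derivative (derivative p) + (C (β - α) - C (α + β + 2) * X) * derivative p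

lemma jL_coeff (α β : ℝ) (p : ℝ[X]) (k : ℕ) : (jL α β p).coeff k =
    - ((k:ℝ) * (k + α + β + 1)) * p.coeff k + (β - α) * (k + 1) * p.coeff (k + 1)
      + (k + 2) * (k + 1) * p.coeff (k + 2) := by
  unfold jL
  obtain ⟨c, hc⟩ : ∃ c, c = α + β + 2 := ⟨_, rfl⟩
  obtain ⟨d, hd⟩ : ∃ d, d = β - α := ⟨_, rfl⟩
  rw [← hc, ← hd]
  have e : (1 - X ^ 2) * derivative (derivative p) + (C d - C c * X) * derivative p
      = derivative (derivative p) - X ^ 2 * derivative (derivative p) + C d * derivative p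
        - C c * (X * derivative p) := by ring
  rw [e, coeff_sub, coeff_add, coeff_sub, coeff_C_mul, coeff_C_mul]
  rcases k with _ | _ | k
  · simp [coeff_derivative, coeff_X_pow_mul']
    ring
  · simp [coeff_derivative, coeff_X_pow_mul', coeff_X_mul, hc]
    ring
  · simp [coeff_derivative, coeff_X_pow_mul', coeff_X_mul, hc]
    ring

lemma jL_degree (α β : ℝ) {p : ℝ[X]} {n : ℕ} (hp : p.degree < n) : (jL α β p).degree < n := by
  rw [degree_lt_iff_coeff_zero] at hp ⊢
  intro m hm
  rw [jL_coeff, hp m hm, hp (m+1) (by omega), hp (m+2) (by omega)]; ring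

lemma jL_symm (p q : ℝ[X]) : jI hα hβ (jL α β p * q) = jI hα hβ (p * jL α β q) := by
  have key : jI hα hβ (jL α β p * q - p * jL α β q) = 0 := by
    rw [jI_apply, jmu_integral]
    set F : ℝ → ℝ := fun x => ((1 - x) ^ (α + 1) * (1 + x) ^ (β + 1)) *
      ((derivative p).eval x * q.eval x - p.eval x * (derivative q).eval x) with hF
    have hcont : ContinuousOn F (Icc (-1) 1) := by
      apply ContinuousOn.mul
      · apply ContinuousOn.mul
        · exact ContinuousOn.rpow_const (by fun_prop) (fun x _ => Or.inr (by linarith))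
        · exact ContinuousOn.rpow_const (by fun_prop) (fun x _ => Or.inr (by linarith))
      · exact Continuous.continuousOn (by fun_prop)
    have hderiv : ∀ x ∈ Ioo (-1:ℝ) 1, HasDerivAt F
        ((jL α β p * q - p * jL α β q).eval x * jw α β x) x := by
      intro x hx
      have h1 : 0 < 1 - x := by linarith [hx.2]
      have h2 : 0 < 1 + x := by linarith [hx.1]
      have d1 : HasDerivAt (fun x : ℝ => (1 - x) ^ (α + 1)) ((-1) * (α + 1) * (1 - x) ^ α) x := by
        have := ((hasDerivAt_id x).const_sub 1).rpow_const (p := α + 1) (Or.inl h1.ne')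
        simpa using this
      have d2 : HasDerivAt (fun x : ℝ => (1 + x) ^ (β + 1)) (1 * (β + 1) * (1 + x) ^ β) x := by
        have := ((hasDerivAt_id x).const_add 1).rpow_const (p := β + 1) (Or.inl h2.ne')
        simpa using this
      have d3 := (((derivative p).hasDerivAt x).mul (q.hasDerivAt x)).sub
        ((p.hasDerivAt x).mul ((derivative q).hasDerivAt x))
      have d4 := (d1.mul d2).mul d3
      refine d4.congr_deriv ?_
      have e1 : (1 - x) ^ (α + 1) = (1 - x) ^ α * (1 - x) := by rw [Real.rpow_add_one h1.ne']
      have e2 : (1 + x) ^ (β + 1) = (1 + x) ^ β * (1 + x) := by rw [Real.rpow_add_one h2.ne']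
      simp only [jw, jL, eval_sub, eval_mul, eval_add, eval_one, eval_pow, eval_X, eval_C, e1, e2,
        Pi.mul_apply, Pi.sub_apply]
      ring
    have hintg : IntervalIntegrable
        (fun x => (jL α β p * q - p * jL α β q).eval x * jw α β x) volume (-1) 1 :=
      (jw_intervalIntegrable hα hβ).continuousOn_mul (Polynomial.continuous _).continuousOn
    rw [intervalIntegral.integral_eq_sub_of_hasDerivAt_of_le (by norm_num) hcont hderiv hintg]
    have z1 : (0:ℝ) ^ (α + 1) = 0 := Real.zero_rpow (by linarith)
    have z2 : (0:ℝ) ^ (β + 1) = 0 := Real.zero_rpow (by linarith)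
    simp [hF, z1, z2]
  rw [map_sub] at key
  linarith

lemma jP_ode (n : ℕ) : jL α β (jP hα hβ n) = -((n:ℝ) * (n + α + β + 1)) • jP hα hβ n := by
  set q := jL α β (jP hα hβ n) + ((n:ℝ) * (n + α + β + 1)) • jP hα hβ n with hq
  have hd : q.degree < n := by
    rw [degree_lt_iff_coeff_zero]
    intro m hm
    rcases Nat.eq_or_lt_of_le hm with h | h
    · subst h
      simp [hq, jL_coeff, jP_coeff_self, jP_coeff_gt]
    · simp [hq, jL_coeff, jP_coeff_gt hα hβ n m h, jP_coeff_gt hα hβ n (m+1) (by omega),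
        jP_coeff_gt hα hβ n (m+2) (by omega)]
  have h0 : q = 0 := by
    apply jP_zero_of hα hβ n q hd
    intro j hj
    have hj' : (jP hα hβ j).degree < n := by rw [jP_degree]; exact_mod_cast hj
    rw [hq, add_mul, map_add, jL_symm, jP_orth hα hβ n _ (jL_degree α β hj'), smul_mul_assoc, map_smul,
      jP_orth hα hβ n _ hj']
    simp
  rw [neg_smul]
  exact eq_neg_of_add_eq_zero_left h0

/-- squared norm -/
def jnu (n : ℕ) : ℝ := jI hα hβ (jP hα hβ n * jP hα hβ n)
def jb (n : ℕ) : ℝ := jI hα hβ (X * jP hα hβ n * jP hα hβ n) / jnu hα hβ n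
def jA (n : ℕ) : ℝ := jnu hα hβ n / jnu hα hβ (n - 1)

lemma jnu_pos (n : ℕ) : 0 < jnu hα hβ n := jI_sq_pos hα hβ (jP_ne_zero hα hβ n)

lemma jP_zero : jP hα hβ 0 = 1 := by
  have := (jP_monic hα hβ 0)
  exact (this.natDegree_eq_zero).1 (jP_natDegree hα hβ 0)

lemma jP_X_sub_degree (n : ℕ) : (X * jP hα hβ n - jP hα hβ (n+1)).degree < ((n + 1 : ℕ) : WithBot ℕ) := by
  rw [degree_lt_iff_coeff_zero]
  intro m hm
  obtain ⟨k, rfl⟩ : ∃ k, m = k + 1 := ⟨m - 1, by omega⟩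
  rw [coeff_sub, coeff_X_mul]
  rcases Nat.eq_or_lt_of_le hm with h | h
  · have : k = n := by omega
    subst this; simp [jP_coeff_self]
  · rw [jP_coeff_gt hα hβ n k (by omega), jP_coeff_gt hα hβ (n+1) (k+1) (by omega), sub_zero]

lemma jP_X_mul_lt (n j : ℕ) (h : j + 1 < n) : jI hα hβ (X * jP hα hβ n * jP hα hβ j) = 0 := by
  have : X * jP hα hβ n * jP hα hβ j = jP hα hβ n * (X * jP hα hβ j) := by ring
  rw [this]
  apply jP_orth
  rw [degree_mul, degree_X, jP_degree, add_comm]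
  exact_mod_cast h

lemma jP_X_mul_pred (n : ℕ) : jI hα hβ (X * jP hα hβ (n+1) * jP hα hβ n) = jnu hα hβ (n+1) := by
  have : X * jP hα hβ (n+1) * jP hα hβ n = jP hα hβ (n+1) * jP hα hβ (n+1) +
    jP hα hβ (n+1) * (X * jP hα hβ n - jP hα hβ (n+1)) := by ring
  rw [this, map_add, jP_orth hα hβ (n+1) _ (jP_X_sub_degree hα hβ n)]
  simp [jnu]

lemma jP_rec_zero : jP hα hβ 1 = X - C (jb hα hβ 0) := by
  have h : X * jP hα hβ 0 - jP hα hβ 1 - C (jb hα hβ 0) * jP hα hβ 0 = 0 := by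
    apply jP_zero_of hα hβ 1
    · refine (degree_sub_le _ _).trans_lt (max_lt (jP_X_sub_degree hα hβ 0) ?_)
      rw [jP_zero, mul_one]; exact (degree_C_le).trans_lt (by norm_num)
    · intro j hj
      have : j = 0 := by omega
      subst this
      rw [sub_mul, sub_mul, map_sub, map_sub, jP_orth' hα hβ (by norm_num : 1 ≠ 0), mul_assoc (C _), C_mul',
        map_smul, jb, smul_eq_mul]
      have := (jnu_pos hα hβ 0).ne'
      have e : jI hα hβ (jP hα hβ 0 * jP hα hβ 0) = jnu hα hβ 0 := rfl
      rw [e]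
      field_simp
      ring
  rw [jP_zero] at h
  linear_combination -h

lemma jP_rec (n : ℕ) : X * jP hα hβ (n+1) = jP hα hβ (n+2) + C (jb hα hβ (n+1)) * jP hα hβ (n+1)
    + C (jA hα hβ (n+1)) * jP hα hβ n := by
  have h : X * jP hα hβ (n+1) - jP hα hβ (n+2) - C (jb hα hβ (n+1)) * jP hα hβ (n+1)
    - C (jA hα hβ (n+1)) * jP hα hβ n = 0 := by
    apply jP_zero_of hα hβ (n+2)
    · refine (degree_sub_le _ _).trans_lt (max_lt ((degree_sub_le _ _).trans_lt
        (max_lt (jP_X_sub_degree hα hβ (n+1)) ?_)) ?_)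
      · rw [C_mul']; refine (degree_smul_le _ _).trans_lt ?_
        rw [jP_degree]; exact_mod_cast Nat.lt_succ_self _
      · rw [C_mul']; refine (degree_smul_le _ _).trans_lt ?_
        rw [jP_degree]; exact_mod_cast (by omega : n < n + 2)
    · intro j hj
      have p1 := (jnu_pos hα hβ (n+1)).ne'
      have p2 := (jnu_pos hα hβ n).ne'
      rw [sub_mul, sub_mul, sub_mul, map_sub, map_sub, map_sub,
        jP_orth' hα hβ (by omega : n + 2 ≠ j), mul_assoc (C _), C_mul', map_smul, mul_assoc (C _), C_mul',
        map_smul, smul_eq_mul, smul_eq_mul]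
      rcases Nat.lt_or_ge j n with h1 | h1
      · rw [jP_X_mul_lt hα hβ (n+1) j (by omega), jP_orth' hα hβ (by omega : n + 1 ≠ j),
          jP_orth' hα hβ (by omega : n ≠ j)]; simp
      · rcases Nat.eq_or_lt_of_le h1 with h2 | h2
        · subst h2
          rw [jP_X_mul_pred, jP_orth' hα hβ (by omega : n + 1 ≠ n), jA]
          have e : jI hα hβ (jP hα hβ n * jP hα hβ n) = jnu hα hβ n := rfl
          rw [e]; simp only [Nat.add_sub_cancel]; field_simp; ring
        · have : j = n + 1 := by omega
          subst this
          rw [jP_orth' hα hβ (by omega : n ≠ n + 1), jb]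
          have e : jI hα hβ (jP hα hβ (n+1) * jP hα hβ (n+1)) = jnu hα hβ (n+1) := rfl
          rw [e]; field_simp; ring
  linear_combination h

lemma jP_s (n : ℕ) : (jP hα hβ (n+1)).coeff n * (2 * ((n:ℝ)+1) + (α + β)) = (α - β) * (n + 1) := by
  have h := congrArg (fun p => Polynomial.coeff p n) (jP_ode hα hβ (n+1))
  simp only [jL_coeff, coeff_smul, smul_eq_mul, jP_coeff_self,
    jP_coeff_gt hα hβ (n+1) (n+2) (by omega)] at h
  push_cast at h
  linear_combination h

lemma jP_t (n : ℕ) : (jP hα hβ (n+2)).coeff n * (2 * (2 * ((n:ℝ)+2) + (α + β) - 1)) =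
    - ((β - α) * (n + 1) * (jP hα hβ (n+2)).coeff (n+1) + (n + 2) * (n + 1)) := by
  have h := congrArg (fun p => Polynomial.coeff p n) (jP_ode hα hβ (n+2))
  simp only [jL_coeff, coeff_smul, smul_eq_mul, jP_coeff_self] at h
  push_cast at h
  linear_combination h

lemma jb_coeff (n : ℕ) : jb hα hβ (n+1) = (jP hα hβ (n+1)).coeff n - (jP hα hβ (n+2)).coeff (n+1) := by
  have h := congrArg (fun p => Polynomial.coeff p (n+1)) (jP_rec hα hβ n)
  simp only [coeff_X_mul, coeff_add, coeff_C_mul, jP_coeff_self,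
    jP_coeff_gt hα hβ n (n+1) (by omega)] at h
  linear_combination -h

lemma jA_coeff (n : ℕ) : jA hα hβ (n+2) = (jP hα hβ (n+2)).coeff n - (jP hα hβ (n+3)).coeff (n+1)
    - jb hα hβ (n+2) * (jP hα hβ (n+2)).coeff (n+1) := by
  have h := congrArg (fun p => Polynomial.coeff p (n+1)) (jP_rec hα hβ (n+1))
  simp only [coeff_X_mul, coeff_add, coeff_C_mul, jP_coeff_self] at h
  linear_combination -h

lemma jb_formula (n : ℕ) : jb hα hβ (n+2) =
    -((α - β) * (α + β)) / ((2 * ((n:ℝ)+2) + (α + β)) * (2 * ((n:ℝ)+2) + (α + β) + 2)) := by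
  have h1 := jP_s hα hβ (n+1)
  have h2 := jP_s hα hβ (n+2)
  push_cast at h1 h2
  have hn : (0:ℝ) ≤ n := Nat.cast_nonneg n
  have y1 : (2 * ((n:ℝ)+2) + (α + β)) ≠ 0 := by nlinarith
  have y2 : (2 * ((n:ℝ)+2) + (α + β) + 2) ≠ 0 := by nlinarith
  have e1 : (jP hα hβ (n+2)).coeff (n+1) = (α - β) * (n + 2) / (2 * ((n:ℝ)+2) + (α + β)) := by
    rw [eq_div_iff y1]; linear_combination h1
  have e2 : (jP hα hβ (n+3)).coeff (n+2) = (α - β) * (n + 3) / (2 * ((n:ℝ)+2) + (α + β) + 2) := by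
    rw [eq_div_iff y2]; linear_combination h2
  rw [jb_coeff, e1, e2]
  field_simp
  ring

lemma jA_formula (n : ℕ) {y : ℝ} (hy : y = 2 * ((n:ℝ)+2) + (α + β)) : 4 * jA hα hβ (n+2) =
    (y ^ 2 - (α + β) ^ 2) * (y ^ 2 - (α - β) ^ 2) / (y ^ 2 * (y ^ 2 - 1)) := by
  have h1 := jP_s hα hβ (n+1)
  have h2 := jP_s hα hβ (n+2)
  have h3 := jP_t hα hβ n
  have h4 := jP_t hα hβ (n+1)
  push_cast at h1 h2 h3 h4
  have hn : (0:ℝ) ≤ n := Nat.cast_nonneg n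
  have y0 : 2 < y := by nlinarith
  have hny : (n:ℝ) = (y - (α + β)) / 2 - 2 := by rw [hy]; ring
  have y1 : y ≠ 0 := by linarith
  have y2 : y + 2 ≠ 0 := by linarith
  have y3 : y - 1 ≠ 0 := by linarith
  have y4 : y + 1 ≠ 0 := by linarith
  have y5 : y ^ 2 - 1 ≠ 0 := by nlinarith
  have e1 : (jP hα hβ (n+2)).coeff (n+1) = (α - β) * (n + 2) / y := by
    rw [eq_div_iff y1, hy]; linear_combination h1
  have e2 : (jP hα hβ (n+3)).coeff (n+2) = (α - β) * (n + 3) / (y + 2) := by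
    rw [eq_div_iff y2, hy]; linear_combination h2
  have e3 : (jP hα hβ (n+2)).coeff n =
      -((β - α) * (n + 1) * ((α - β) * (n + 2) / y) + (n + 2) * (n + 1)) / (2 * (y - 1)) := by
    rw [eq_div_iff (by simpa using y3), ← e1, hy]; linear_combination h3
  have e4 : (jP hα hβ (n+3)).coeff (n+1) =
      -((β - α) * (n + 2) * ((α - β) * (n + 3) / (y + 2)) + (n + 3) * (n + 2)) / (2 * (y + 1)) := by
    rw [eq_div_iff (by simpa using y4), ← e2, hy]; linear_combination h4
  rw [jA_coeff, jb_coeff, e3, e4, e1, e2, hny]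
  have y6 : y ^ 2 - 1 = (y - 1) * (y + 1) := by ring
  rw [y6]
  field_simp
  ring

lemma jcoef_bound : ∃ C : ℝ, 0 < C ∧ ∀ n : ℕ, |jb hα hβ n| ≤ C / ((n:ℝ) + 1) ^ 2 ∧
    |4 * jA hα hβ n - 1| ≤ C / ((n:ℝ) + 1) ^ 2 := by
  set K := |(α - β) * (α + β)| + |1 - (α + β)^2 - (α - β)^2| + (α + β)^2 * (α - β)^2 with hK
  have hK0 : 0 ≤ K := by positivity
  have hmain : ∀ n : ℕ, |jb hα hβ (n+2)| ≤ 9 * K / (((n + 2 : ℕ):ℝ) + 1) ^ 2 ∧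
    |4 * jA hα hβ (n+2) - 1| ≤ 9 * K / (((n + 2 : ℕ):ℝ) + 1) ^ 2 := by
    intro n
    set y := 2 * ((n:ℝ)+2) + (α + β) with hy
    have hn : (0:ℝ) ≤ n := Nat.cast_nonneg n
    have y0 : 2 < y := by nlinarith
    have y1 : (2/3) * ((n:ℝ) + 3) ≤ y := by nlinarith
    have hy2 : 4/9 * ((n:ℝ) + 3)^2 ≤ y ^ 2 := by nlinarith
    have hfin : (2 * K) / y ^ 2 ≤ 9 * K / (((n + 2 : ℕ):ℝ) + 1) ^ 2 := by
      push_cast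
      rw [div_le_div_iff₀ (by positivity) (by positivity)]
      have : ((n:ℝ) + 2 + 1) = n + 3 := by ring
      rw [this]
      nlinarith [mul_le_mul_of_nonneg_left hy2 hK0]
    constructor
    · refine le_trans ?_ hfin
      rw [jb_formula, ← hy, abs_div, abs_neg, abs_of_pos (by positivity : 0 < y * (y + 2))]
      rw [div_le_div_iff₀ (by positivity) (by positivity)]
      have k1 : |(α - β) * (α + β)| ≤ K := by
        rw [hK]; have := abs_nonneg (1 - (α + β)^2 - (α - β)^2)
        have : 0 ≤ (α + β)^2 * (α - β)^2 := by positivity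
        linarith
      have : y ^ 2 ≤ y * (y + 2) := by nlinarith
      calc |(α - β) * (α + β)| * y ^ 2 ≤ K * (y * (y+2)) := by gcongr
        _ ≤ 2 * K * (y * (y+2)) := by nlinarith [mul_nonneg hK0 (by positivity : 0 ≤ y * (y+2))]
    · refine le_trans ?_ hfin
      have y3 : 0 < y ^ 2 - 1 := by nlinarith
      rw [jA_formula hα hβ n hy]
      have e : (y ^ 2 - (α + β) ^ 2) * (y ^ 2 - (α - β) ^ 2) / (y ^ 2 * (y ^ 2 - 1)) - 1
          = ((1 - (α + β)^2 - (α - β)^2) * y ^ 2 + (α + β)^2 * (α - β)^2) / (y ^ 2 * (y ^ 2 - 1)) := by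
        field_simp; ring
      rw [e, abs_div, abs_of_pos (by positivity : 0 < y ^ 2 * (y ^ 2 - 1)),
        div_le_div_iff₀ (by positivity) (by positivity)]
      have k1 : |(1 - (α + β)^2 - (α - β)^2) * y ^ 2 + (α + β)^2 * (α - β)^2| ≤ K * y ^ 2 := by
        refine (abs_add_le _ _).trans ?_
        rw [abs_mul, abs_of_nonneg (sq_nonneg y), abs_of_nonneg (by positivity : 0 ≤ (α + β)^2 * (α - β)^2), hK]
        have : 0 ≤ (α + β)^2 * (α - β)^2 := by positivity
        have h4 : 1 ≤ y ^ 2 := by nlinarith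
        have := abs_nonneg ((α - β) * (α + β))
        nlinarith [sq_nonneg y, mul_nonneg this (sq_nonneg y)]
      have h5 : y ^ 2 ≤ 2 * (y ^ 2 - 1) := by nlinarith
      calc _ ≤ (K * y ^ 2) * y ^ 2 := by gcongr
        _ ≤ (K * y ^ 2) * (2 * (y ^ 2 - 1)) := by gcongr
        _ = _ := by ring
  refine ⟨9 * K + 4 * (|jb hα hβ 0| + |jb hα hβ 1| + |4 * jA hα hβ 0 - 1| + |4 * jA hα hβ 1 - 1|) + 1,
    by positivity, ?_⟩
  have a1 := abs_nonneg (jb hα hβ 0)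
  have a2 := abs_nonneg (jb hα hβ 1)
  have a3 := abs_nonneg (4 * jA hα hβ 0 - 1)
  have a4 := abs_nonneg (4 * jA hα hβ 1 - 1)
  intro n
  rcases n with _ | _ | n
  · constructor <;> (norm_num; linarith)
  · constructor <;> (norm_num; linarith)
  · refine ⟨(hmain n).1.trans ?_, (hmain n).2.trans ?_⟩ <;>
    · gcongr; linarith

end

lemma growth_bound {u : ℕ → ℝ} {C : ℝ} (hu : ∀ n, 0 ≤ u n) (hC : 0 ≤ C)
    (h : ∀ n : ℕ, u (n+1) ≤ (1 + C / ((n:ℝ)+1)^2) * u n) (n : ℕ) : u n ≤ u 0 * Real.exp (2 * C) := by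
  have key : ∀ n : ℕ, u n ≤ u 0 * Real.exp (2 * C * (1 - 1 / ((n:ℝ)+1))) := by
    intro n
    induction n with
    | zero => simp
    | succ n ih =>
      have h1 : 1 + C / ((n:ℝ)+1)^2 ≤ Real.exp (2 * C * (1 / ((n:ℝ)+1) - 1 / ((n:ℝ)+2))) := by
        have h2 : C / ((n:ℝ)+1)^2 ≤ 2 * C * (1 / ((n:ℝ)+1) - 1 / ((n:ℝ)+2)) := by
          have : 2 * C * (1 / ((n:ℝ)+1) - 1 / ((n:ℝ)+2)) = 2 * C / (((n:ℝ)+1) * (n+2)) := by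
            field_simp; ring
          rw [this, div_le_div_iff₀ (by positivity) (by positivity)]
          have hn : (0:ℝ) ≤ n := Nat.cast_nonneg n
          nlinarith [mul_nonneg hC hn, mul_nonneg hC (mul_nonneg hn hn)]
        linarith [Real.add_one_le_exp (2 * C * (1 / ((n:ℝ)+1) - 1 / ((n:ℝ)+2)))]
      calc u (n+1) ≤ (1 + C / ((n:ℝ)+1)^2) * u n := h n
        _ ≤ Real.exp (2 * C * (1 / ((n:ℝ)+1) - 1 / ((n:ℝ)+2))) *
            (u 0 * Real.exp (2 * C * (1 - 1 / ((n:ℝ)+1)))) := by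
            apply mul_le_mul h1 ih (hu n) (Real.exp_pos _).le
        _ = u 0 * Real.exp (2 * C * (1 - 1 / (((n+1:ℕ):ℝ)+1))) := by
            rw [mul_left_comm, ← Real.exp_add]; congr 2; push_cast; ring
  refine (key n).trans ?_
  apply mul_le_mul_of_nonneg_left _ (hu 0)
  apply Real.exp_le_exp.2
  have : 0 ≤ 1 / ((n:ℝ)+1) := by positivity
  nlinarith

lemma bdd_of_eventually {f : ℕ → ℝ} {B : ℝ} (h : ∀ᶠ n in atTop, f n ≤ B) : ∃ B', ∀ n, f n ≤ B' := by
  obtain ⟨N, hN⟩ := eventually_atTop.1 h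
  refine ⟨|B| + ∑ i ∈ Finset.range N, |f i|, fun n => ?_⟩
  rcases lt_or_ge n N with h1 | h1
  · have := Finset.single_le_sum (f := fun i => |f i|) (fun i _ => abs_nonneg _) (Finset.mem_range.2 h1)
    have h3 := le_abs_self (f n)
    have h4 := abs_nonneg B
    linarith
  · have h2 : 0 ≤ ∑ i ∈ Finset.range N, |f i| := Finset.sum_nonneg (fun i _ => abs_nonneg _)
    linarith [hN n h1, le_abs_self B]

section
open Polynomial Chebyshev

lemma U_abs_le (m : ℕ) {x : ℝ} (hx : x ∈ Icc (-1:ℝ) 1) : |(U ℝ m).eval x| ≤ m + 1 := by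
  have hx' : |x| ≤ 1 := abs_le.2 hx
  induction m with
  | zero => simp
  | succ m ih =>
    have h := U_eq_X_mul_U_add_T ℝ m
    push_cast
    rw [h, eval_add, eval_mul, eval_X]
    refine (abs_add_le _ _).trans ?_
    rw [abs_mul]
    have h1 := abs_eval_T_real_le_one ((m:ℤ)+1) hx'
    have h2 : |x| * |(U ℝ m).eval x| ≤ 1 * (m + 1) := mul_le_mul hx' ih (abs_nonneg _) (by norm_num)
    linarith

lemma second_order_sol {M : ℕ} (Y d : ℕ → ℝ[X]) (h0 : Y 0 = 0) (h1 : 1 ≤ M → Y 1 = d 0)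
    (h : ∀ i, i + 2 ≤ M → Y (i+2) = 2 * X * Y (i+1) - Y i + d (i+1)) :
    ∀ m, m ≤ M → Y m = ∑ i ∈ Finset.range m, U ℝ ((m:ℤ) - 1 - i) * d i := by
  intro m
  induction m using Nat.strong_induction_on with
  | _ m ih =>
    intro hm
    rcases m with _ | _ | m
    · simp [h0]
    · simp [h1 hm]
    · rw [h m hm, ih m (by omega) (by omega), ih (m+1) (by omega) (by omega)]
      rw [Finset.sum_range_succ (n := m+1)]
      have e1 : ∑ i ∈ Finset.range m, U ℝ ((m:ℤ) - 1 - i) * d i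
          = ∑ i ∈ Finset.range (m+1), U ℝ ((m:ℤ) - 1 - i) * d i := by
        rw [Finset.sum_range_succ]
        have : (m:ℤ) - 1 - m = -1 := by ring
        rw [this]; simp
      rw [e1, Finset.mul_sum, ← Finset.sum_sub_distrib]
      congr 1
      · apply Finset.sum_congr rfl
        intro i _
        have e2 := U_add_two ℝ ((m:ℤ) - 1 - i)
        have a1 : (m:ℤ) - 1 - i + 2 = ((m + 1 + 1 : ℕ):ℤ) - 1 - i := by push_cast; ring
        have a2 : (m:ℤ) - 1 - i + 1 = ((m + 1 : ℕ):ℤ) - 1 - i := by push_cast; ring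
        rw [a1, a2] at e2
        rw [e2]; ring
      · have : ((m + 1 + 1 : ℕ):ℤ) - 1 - ((m+1:ℕ):ℤ) = 0 := by push_cast; ring
        rw [this]; simp

variable {α β : ℝ} (hα : -1 < α) (hβ : -1 < β)

/-- Normalized Jacobi polynomials -/
def jq (n : ℕ) : ℝ[X] := (2:ℝ)^n • jP hα hβ n

lemma jq_rec (n : ℕ) : X * jq hα hβ (n+1) = (1/2:ℝ) • jq hα hβ (n+2) + jb hα hβ (n+1) • jq hα hβ (n+1)
    + (2 * jA hα hβ (n+1)) • jq hα hβ n := by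
  have h := jP_rec hα hβ n
  unfold jq
  simp only [smul_smul]
  have e1 : (1/2:ℝ) * 2^(n+2) = 2^(n+1) := by ring
  have e2 : jb hα hβ (n+1) * 2^(n+1) = 2^(n+1) * jb hα hβ (n+1) := by ring
  have e3 : 2 * jA hα hβ (n+1) * 2^n = 2^(n+1) * jA hα hβ (n+1) := by ring
  rw [e1, e2, e3, mul_smul_comm, h]
  simp only [smul_add, C_mul', smul_smul]

lemma jq_degree (n : ℕ) : (jq hα hβ n).degree = n := by
  unfold jq
  rw [smul_eq_C_mul, degree_C_mul (by positivity), jP_degree]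

lemma jq_orth (n : ℕ) (q : ℝ[X]) (hq : q.degree < n) : jI hα hβ (jq hα hβ n * q) = 0 := by
  unfold jq
  rw [smul_mul_assoc, map_smul, jP_orth hα hβ n q hq, smul_zero]

lemma jq_sq_rec (n : ℕ) : jI hα hβ (jq hα hβ (n+1) * jq hα hβ (n+1)) =
    4 * jA hα hβ (n+1) * jI hα hβ (jq hα hβ n * jq hα hβ n) := by
  unfold jq
  simp only [smul_mul_smul_comm, map_smul, smul_eq_mul]
  have e : ∀ k, jI hα hβ (jP hα hβ k * jP hα hβ k) = jnu hα hβ k := fun k => rfl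
  rw [e, e, jA]
  have := (jnu_pos hα hβ n).ne'
  simp only [Nat.add_sub_cancel]
  field_simp
  ring

lemma jq_sq_pos (n : ℕ) : 0 < jI hα hβ (jq hα hβ n * jq hα hβ n) := by
  apply jI_sq_pos
  intro h
  have := jq_degree hα hβ n
  rw [h] at this; simp at this

lemma jA_pos (n : ℕ) : 0 < jA hα hβ n := div_pos (jnu_pos hα hβ _) (jnu_pos hα hβ _)

lemma jq_norm_bounds : ∃ B : ℝ, 1 ≤ B ∧ ∀ n, jN hα hβ (jq hα hβ n) ≤ B ∧
    1 / jI hα hβ (jq hα hβ n * jq hα hβ n) ≤ B := by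
  obtain ⟨C, hC, hb⟩ := jcoef_bound hα hβ
  set u : ℕ → ℝ := fun n => jI hα hβ (jq hα hβ n * jq hα hβ n) with hu
  have hupos : ∀ n, 0 < u n := jq_sq_pos hα hβ
  have h1 : ∀ n : ℕ, u (n+1) ≤ (1 + C / ((n:ℝ)+1)^2) * u n := by
    intro n
    simp only [hu]
    rw [jq_sq_rec]
    apply mul_le_mul_of_nonneg_right _ (hupos n).le
    have := (abs_le.1 (hb (n+1)).2).2
    have h2 : C / (((n+1:ℕ):ℝ)+1)^2 ≤ C / ((n:ℝ)+1)^2 := by push_cast; gcongr; linarith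
    linarith
  have B1 := growth_bound (fun n => (hupos n).le) hC.le h1
  have h2 : ∃ K, ∀ n : ℕ, (1 / (4 * jA hα hβ (n+1)) - 1) * ((n:ℝ)+1)^2 ≤ K := by
    have hev : ∀ᶠ n : ℕ in atTop, 2 * C ≤ (n:ℝ) := tendsto_natCast_atTop_atTop.eventually_ge_atTop _
    apply bdd_of_eventually (B := 2 * C)
    filter_upwards [hev] with n hn
    have hn0 : (0:ℝ) ≤ n := Nat.cast_nonneg n
    have hb1 := (hb (n+1)).2
    push_cast at hb1
    have hhalf : C / ((n:ℝ)+1+1)^2 ≤ 1/2 := by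
      rw [div_le_div_iff₀ (by positivity) (by norm_num)]; nlinarith
    have := abs_le.1 hb1
    have hA : 1/2 ≤ 4 * jA hα hβ (n+1) := by linarith
    have e : 1 / (4 * jA hα hβ (n+1)) - 1 = (1 - 4 * jA hα hβ (n+1)) / (4 * jA hα hβ (n+1)) := by
      have := (jA_pos hα hβ (n+1)).ne'
      field_simp
    have e2 : 1 / (4 * jA hα hβ (n+1)) - 1 ≤ 2 * (C / ((n:ℝ)+1+1)^2) := by
      rw [e, div_le_iff₀ (by linarith)]
      have : 0 ≤ C / ((n:ℝ)+1+1)^2 := by positivity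
      nlinarith
    have e3 : C / ((n:ℝ)+1+1)^2 ≤ C / ((n:ℝ)+1)^2 := by gcongr; linarith
    calc (1 / (4 * jA hα hβ (n+1)) - 1) * ((n:ℝ)+1)^2 ≤ (2 * (C / ((n:ℝ)+1)^2)) * ((n:ℝ)+1)^2 := by
          gcongr; linarith
      _ = 2 * C := by field_simp
  obtain ⟨K, hK⟩ := h2
  have h3 : ∀ n : ℕ, 1 / u (n+1) ≤ (1 + |K| / ((n:ℝ)+1)^2) * (1 / u n) := by
    intro n
    have : u (n+1) = 4 * jA hα hβ (n+1) * u n := jq_sq_rec hα hβ n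
    rw [this, one_div, mul_inv, ← one_div, ← one_div]
    apply mul_le_mul_of_nonneg_right _ (by have := hupos n; positivity)
    have h4 : 1 / (4 * jA hα hβ (n+1)) - 1 ≤ |K| / ((n:ℝ)+1)^2 := by
      rw [le_div_iff₀ (by positivity)]
      exact (hK n).trans (le_abs_self K)
    linarith
  have B2 := growth_bound (u := fun n => 1 / u n) (fun n => (one_div_pos.2 (hupos n)).le) (abs_nonneg K) h3
  refine ⟨1 + Real.sqrt (u 0 * Real.exp (2 * C)) + 1 / u 0 * Real.exp (2 * |K|), ?_, fun n => ⟨?_, ?_⟩⟩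
  · have := hupos 0
    have : 0 ≤ 1 / u 0 * Real.exp (2 * |K|) := by positivity
    have := Real.sqrt_nonneg (u 0 * Real.exp (2 * C))
    linarith
  · have := hupos 0
    have : 0 ≤ 1 / u 0 * Real.exp (2 * |K|) := by positivity
    have h5 : jN hα hβ (jq hα hβ n) ≤ Real.sqrt (u 0 * Real.exp (2 * C)) := Real.sqrt_le_sqrt (B1 n)
    linarith
  · have := Real.sqrt_nonneg (u 0 * Real.exp (2 * C))
    have := B2 n
    linarith

/-- local error of the free recurrence -/
def jd (i : ℕ) : ℝ[X] := X * jq hα hβ i - (1/2:ℝ) • (jq hα hβ (i+1) + jq hα hβ (i-1))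

lemma jd_bound : ∃ C : ℝ, 0 < C ∧ ∀ i : ℕ, 1 ≤ i → jN hα hβ (jd hα hβ i) ≤ C / ((i:ℝ)+1)^2 := by
  obtain ⟨C, hC, hb⟩ := jcoef_bound hα hβ
  obtain ⟨B, hB, hq⟩ := jq_norm_bounds hα hβ
  refine ⟨2 * C * B, by positivity, ?_⟩
  intro i hi
  obtain ⟨n, rfl⟩ : ∃ n, i = n + 1 := ⟨i - 1, by omega⟩
  have e : jd hα hβ (n+1) = jb hα hβ (n+1) • jq hα hβ (n+1) + (2 * jA hα hβ (n+1) - 1/2) • jq hα hβ n := by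
    unfold jd
    rw [jq_rec]
    simp only [Nat.add_sub_cancel, smul_add, sub_smul]
    abel
  rw [e]
  refine (jN_add hα hβ _ _).trans ?_
  rw [jN_smul, jN_smul]
  have h1 := (hb (n+1)).1
  have h2 := (hb (n+1)).2
  have h3 : |2 * jA hα hβ (n+1) - 1/2| ≤ C / (((n+1:ℕ):ℝ)+1)^2 := by
    have : 2 * jA hα hβ (n+1) - 1/2 = (1/2) * (4 * jA hα hβ (n+1) - 1) := by ring
    rw [this, abs_mul, abs_of_pos (by norm_num : (0:ℝ) < 1/2)]
    linarith [abs_nonneg (4 * jA hα hβ (n+1) - 1)]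
  have p1 := jN_nonneg hα hβ (jq hα hβ (n+1))
  have p2 := jN_nonneg hα hβ (jq hα hβ n)
  calc _ ≤ C / (((n+1:ℕ):ℝ)+1)^2 * B + C / (((n+1:ℕ):ℝ)+1)^2 * B := by
        gcongr
        · exact (hq (n+1)).1
        · exact (hq n).1
    _ = _ := by ring

lemma jT_bound : ∃ C : ℝ, 0 < C ∧ ∀ j m : ℕ, m ≤ j →
    jN hα hβ (T ℝ m * jq hα hβ j - (1/2:ℝ) • (jq hα hβ (j+m) + jq hα hβ (j-m)))
      ≤ C * (m:ℝ)^2 / ((j:ℝ) - m + 1)^2 := by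
  obtain ⟨C, hC, hd⟩ := jd_bound hα hβ
  refine ⟨2 * C, by positivity, ?_⟩
  intro j M hM
  set Y : ℕ → ℝ[X] := fun m => T ℝ m * jq hα hβ j - (1/2:ℝ) • (jq hα hβ (j+m) + jq hα hβ (j-m)) with hY
  set d : ℕ → ℝ[X] := fun i => if i = 0 then jd hα hβ j else jd hα hβ (j+i) + jd hα hβ (j-i) with hdd
  have hsol := second_order_sol (M := M) Y d
    (by simp only [hY]; simp only [Nat.cast_zero, T_zero, one_mul, add_zero, Nat.sub_zero]
        rw [← two_smul ℝ, smul_smul]; norm_num)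
    (by intro _; simp [hY, hdd, jd])
    (by
      intro i hi
      have e1 := T_add_two ℝ (i:ℤ)
      simp only [hY, hdd, jd]
      push_cast
      rw [e1]
      have a1 : j + (i+1) + 1 = j + (i+2) := by ring
      have a2 : j + (i+1) - 1 = j + i := by omega
      have a3 : j - (i+1) + 1 = j - i := by omega
      have a4 : j - (i+1) - 1 = j - (i+2) := by omega
      rw [a1, a2, a3, a4]
      simp only [smul_eq_C_mul]
      have h2 : (2:ℝ[X]) * Polynomial.C (1/2:ℝ) = 1 := by
        rw [← Polynomial.C_ofNat, ← Polynomial.C_mul]; norm_num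
      linear_combination ((X * jq hα hβ (j+(i+1))) + X * jq hα hβ (j - (i+1))) * h2)
  rw [show T ℝ M * jq hα hβ j - (1/2:ℝ) • (jq hα hβ (j+M) + jq hα hβ (j-M)) = Y M from rfl, hsol M le_rfl]
  refine (jN_sum hα hβ _ _).trans ?_
  have hMj : (M:ℝ) ≤ j := by exact_mod_cast hM
  have hdi : ∀ i ∈ Finset.range M, jN hα hβ (U ℝ ((M:ℤ) - 1 - i) * d i) ≤
      M * (2 * C / ((j:ℝ) - M + 1)^2) := by
    intro i hi
    have hi' := Finset.mem_range.1 hi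
    have hiM : (i:ℝ) + 1 ≤ M := by exact_mod_cast hi'
    obtain ⟨k, hk⟩ : ∃ k : ℕ, (M:ℤ) - 1 - i = k := ⟨M - 1 - i, by omega⟩
    have hkM : (k:ℝ) + 1 ≤ M := by
      have : (k:ℤ) + 1 ≤ M := by omega
      exact_mod_cast this
    rw [hk]
    have h1 : jN hα hβ (U ℝ k * d i) ≤ (k + 1) * jN hα hβ (d i) :=
      jN_mul hα hβ (by positivity) (fun x hx => U_abs_le k hx)
    have hpos : 0 < (j:ℝ) - M + 1 := by linarith
    have h2 : jN hα hβ (d i) ≤ 2 * C / ((j:ℝ) - M + 1)^2 := by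
      have hsub : ∀ r : ℕ, 1 ≤ r → (j:ℝ) - M ≤ r → jN hα hβ (jd hα hβ r) ≤ C / ((j:ℝ) - M + 1)^2 := by
        intro r hr hr2
        refine (hd r hr).trans ?_
        gcongr
      have hhalf : C / ((j:ℝ) - M + 1)^2 + C / ((j:ℝ) - M + 1)^2 = 2 * C / ((j:ℝ) - M + 1)^2 := by ring
      have hp : 0 ≤ C / ((j:ℝ) - M + 1)^2 := by positivity
      have hM0 : (0:ℝ) ≤ M := Nat.cast_nonneg _
      simp only [hdd]
      split_ifs with h0
      · have := hsub j (by omega) (by linarith)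
        linarith
      · refine (jN_add hα hβ _ _).trans ?_
        have b1 := hsub (j+i) (by omega) (by push_cast; linarith [(Nat.cast_nonneg i : (0:ℝ) ≤ i)])
        have b2 := hsub (j-i) (by omega) (by rw [Nat.cast_sub (by omega)]; linarith)
        linarith
    calc _ ≤ ((k:ℝ) + 1) * jN hα hβ (d i) := h1
      _ ≤ M * (2 * C / ((j:ℝ) - M + 1)^2) := by
        apply mul_le_mul hkM h2 (jN_nonneg hα hβ _) (by positivity)
  refine (Finset.sum_le_card_nsmul _ _ _ hdi).trans ?_
  simp only [Finset.card_range, nsmul_eq_mul]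
  apply le_of_eq
  ring

/-- extension to integer index -/
def jqz (z : ℤ) : ℝ[X] := if 0 ≤ z then jq hα hβ z.toNat else 0

lemma jqz_nat (n : ℕ) : jqz hα hβ (n:ℤ) = jq hα hβ n := by simp [jqz]

lemma jqz_neg {z : ℤ} (h : z < 0) : jqz hα hβ z = 0 := by simp [jqz, h]

lemma jqz_bound : ∃ B : ℝ, 1 ≤ B ∧ ∀ z, jN hα hβ (jqz hα hβ z) ≤ B := by
  obtain ⟨B, hB, hq⟩ := jq_norm_bounds hα hβ
  refine ⟨B, hB, fun z => ?_⟩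
  unfold jqz
  split_ifs
  · exact (hq _).1
  · rw [jN_zero]; linarith

lemma jTz_bound : ∃ C : ℝ, 0 < C ∧ ∀ (n k : ℕ) (m : ℤ), 1 ≤ n →
    jN hα hβ (T ℝ m * jqz hα hβ (n - k) -
      (1/2:ℝ) • (jqz hα hβ (n - k + m) + jqz hα hβ (n - k - m)))
      ≤ C * ((1 + (m.natAbs:ℝ)) ^ 2 * (1 + k + (m.natAbs:ℝ)) ^ 2) / (n:ℝ)^2 := by
  obtain ⟨C, hC, hT⟩ := jT_bound hα hβ
  obtain ⟨B, hB, hq⟩ := jqz_bound hα hβ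
  refine ⟨4 * C + 8 * B, by positivity, ?_⟩
  have main : ∀ (n k m : ℕ), 1 ≤ n → jN hα hβ (T ℝ m * jqz hα hβ (n - k) -
      (1/2:ℝ) • (jqz hα hβ (n - k + m) + jqz hα hβ (n - k - m)))
      ≤ (4 * C + 8 * B) * ((1 + (m:ℝ)) ^ 2 * (1 + k + (m:ℝ)) ^ 2) / (n:ℝ)^2 := by
    intro n k m hn
    have hn0 : (0:ℝ) < n := by exact_mod_cast hn
    have hk0 : (0:ℝ) ≤ k := Nat.cast_nonneg _
    have hm0 : (0:ℝ) ≤ m := Nat.cast_nonneg _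
    rcases le_or_gt (2 * (k + m)) n with h | h
    · obtain ⟨j, hj⟩ : ∃ j : ℕ, n = j + k := ⟨n - k, by omega⟩
      have hjm : m ≤ j := by omega
      have e1 : (n:ℤ) - k = j := by omega
      have e2 : (j:ℤ) + m = (j + m : ℕ) := by push_cast; ring
      have e3 : (j:ℤ) - m = (j - m : ℕ) := by omega
      rw [e1, e2, e3, jqz_nat, jqz_nat, jqz_nat]
      refine (hT j m hjm).trans ?_
      have hnr : (n:ℝ) / 2 ≤ (j:ℝ) - m + 1 := by
        have : (n:ℝ) = j + k := by exact_mod_cast hj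
        have h' : 2 * ((k:ℝ) + m) ≤ n := by exact_mod_cast h
        linarith
      calc C * (m:ℝ)^2 / ((j:ℝ) - m + 1)^2 ≤ C * (m:ℝ)^2 / ((n:ℝ)/2)^2 := by gcongr
        _ = (4 * C) * ((m:ℝ)^2 * 1) / (n:ℝ)^2 := by field_simp; ring
        _ ≤ _ := by
          gcongr
          · linarith
          · linarith
          · nlinarith
    · have h' : (n:ℝ) ≤ 2 * (1 + (k:ℝ) + m) := by
        have : (n:ℝ) ≤ 2 * ((k:ℝ) + m) := by exact_mod_cast h.le
        linarith
      have t1 : jN hα hβ (T ℝ m * jqz hα hβ (n - k)) ≤ 1 * jN hα hβ (jqz hα hβ (n-k)) :=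
        jN_mul hα hβ (by norm_num) (fun x hx => abs_eval_T_real_le_one _ (abs_le.2 hx))
      have t2 : jN hα hβ (T ℝ m * jqz hα hβ (n - k) -
          (1/2:ℝ) • (jqz hα hβ (n - k + m) + jqz hα hβ (n - k - m))) ≤ 2 * B := by
        rw [sub_eq_add_neg, ← neg_smul]
        refine (jN_add hα hβ _ _).trans ?_
        rw [jN_smul]
        have t3 := jN_add hα hβ (jqz hα hβ (n - k + m)) (jqz hα hβ (n - k - m))
        have t4 := hq (n - k + m)
        have t5 := hq (n - k - m)
        have t6 := hq (n - k)
        have t7 : |-(1/2:ℝ)| = 1/2 := by rw [abs_neg, abs_of_pos]; norm_num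
        rw [t7]
        linarith
      refine t2.trans ?_
      rw [le_div_iff₀ (by positivity)]
      have s1 : (n:ℝ)^2 ≤ 4 * (1 + (k:ℝ) + m)^2 := by nlinarith
      have s2 : 1 ≤ (1 + (m:ℝ))^2 := by nlinarith
      calc 2 * B * (n:ℝ)^2 ≤ 2 * B * (4 * (1 + (k:ℝ) + m)^2) := by gcongr
        _ = (8 * B) * (1 * (1 + (k:ℝ) + m)^2) := by ring
        _ ≤ _ := by gcongr; linarith
  intro n k m hn
  rcases Int.natAbs_eq m with h | h
  · have := main n k m.natAbs hn
    rwa [← h] at this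
  · have := main n k m.natAbs hn
    have e : ((m.natAbs : ℕ):ℤ) = -m := by omega
    rw [e, T_neg, ← sub_eq_add_neg, sub_neg_eq_add, add_comm (jqz hα hβ (n - k - m))] at this
    exact this

end

section
open Polynomial
variable {α β : ℝ} (hα : -1 < α) (hβ : -1 < β)

/-- Jost type functions -/
def jF : ℕ → ℂ → ℂ
  | 0 => fun _ => 1
  | 1 => fun z => 1 + z^2 - 2 * z * (jb hα hβ 0 : ℂ)
  | (n+2) => fun z => (1 + z^2 - 2 * z * (jb hα hβ (n+1) : ℂ)) * jF (n+1) z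
      - 4 * (jA hα hβ (n+1) : ℂ) * z^2 * jF n z

lemma jF_diff (n : ℕ) : Differentiable ℂ (jF hα hβ n) := by
  induction n using Nat.strong_induction_on with
  | _ n ih =>
    match n with
    | 0 => unfold jF; fun_prop
    | 1 => unfold jF; fun_prop
    | (n+2) =>
      have h1 := ih (n+1) (by omega)
      have h2 := ih n (by omega)
      unfold jF; fun_prop

lemma jF_zero_arg (n : ℕ) : jF hα hβ n 0 = 1 := by
  induction n using Nat.strong_induction_on with
  | _ n ih =>
    match n with
    | 0 => simp [jF]
    | 1 => simp [jF]
    | (n+2) =>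
      have h1 := ih (n+1) (by omega)
      simp [jF, h1]

/-- complexified normalized Jacobi -/
def jqc (n : ℕ) : ℂ[X] := (jq hα hβ n).map Complex.ofRealHom

lemma jqc_eval_real (n : ℕ) (x : ℝ) : (jqc hα hβ n).eval (x:ℂ) = (((jq hα hβ n).eval x : ℝ) : ℂ) := by
  unfold jqc
  rw [← Complex.ofRealHom_eq_coe, Polynomial.eval_map, Polynomial.eval₂_at_apply]
  rfl

lemma jF_eq (n : ℕ) {z : ℂ} (hz : z ≠ 0) :
    jF hα hβ n z = z ^ n * (jqc hα hβ n).eval ((z + z⁻¹)/2) := by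
  induction n using Nat.strong_induction_on with
  | _ n ih =>
    match n with
    | 0 => simp [jF, jqc, jq, jP_zero]
    | 1 =>
      simp only [jF, jqc, jq, jP_rec_zero, smul_eq_C_mul]
      simp
      field_simp
      ring
    | (n+2) =>
      have h1 := ih (n+1) (by omega)
      have h2 := ih n (by omega)
      have h3 := congrArg (fun p : ℝ[X] => (p.map Complex.ofRealHom).eval ((z + z⁻¹)/2)) (jq_rec hα hβ n)
      simp only [smul_eq_C_mul, Polynomial.map_add, Polynomial.map_mul, Polynomial.map_X,
        Polynomial.map_C, eval_add, eval_mul, eval_X, eval_C] at h3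
      simp only [jF, h1, h2]
      unfold jqc
      set a := (Polynomial.map ofRealHom (jq hα hβ (n+2))).eval ((z + z⁻¹)/2)
      set b := (Polynomial.map ofRealHom (jq hα hβ (n+1))).eval ((z + z⁻¹)/2)
      set c := (Polynomial.map ofRealHom (jq hα hβ n)).eval ((z + z⁻¹)/2)
      push_cast [Complex.ofRealHom_eq_coe] at h3
      have e : a = (z + z⁻¹) * b - 2 * (jb hα hβ (n+1):ℂ) * b - 4 * (jA hα hβ (n+1):ℂ) * c := by
        linear_combination (-2) * h3
      rw [e]
      field_simp
      ring

/-- The Jost differential equation -/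
lemma jF_ode (n : ℕ) {z : ℂ} (hz : z ≠ 0) :
    (z - z⁻¹)/2 * (z * (deriv (jF hα hβ n) z + z * deriv (deriv (jF hα hβ n)) z))
      = n * (((α:ℂ)+β+1) * z + (α - β)) * jF hα hβ n z
        + (2 * n * ((z - z⁻¹)/2) + (β - α) - (α+β+1) * ((z + z⁻¹)/2)) * (z * deriv (jF hα hβ n) z) := by
  set Q := jqc hα hβ n with hQ
  have hzz : ∀ w : ℂ, w ≠ 0 → HasDerivAt (fun w : ℂ => (w + w⁻¹)/2) ((1 - (w^2)⁻¹)/2) w := by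
    intro w hw
    have := ((hasDerivAt_id w).add (hasDerivAt_inv hw)).div_const 2
    exact this.congr_deriv (by ring)
  have hP : ∀ (R : ℂ[X]) (w : ℂ), w ≠ 0 → HasDerivAt (fun w : ℂ => w^n * R.eval ((w + w⁻¹)/2))
      (w⁻¹ * (n * (w^n * R.eval ((w + w⁻¹)/2)) + (w - w⁻¹)/2 * (w^n * (derivative R).eval ((w + w⁻¹)/2)))) w := by
    intro R w hw
    have h1 := (hasDerivAt_pow n w).mul ((R.hasDerivAt ((w + w⁻¹)/2)).comp w (hzz w hw))
    refine h1.congr_deriv ?_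
    simp only [Function.comp]
    generalize R.eval ((w + w⁻¹)/2) = a
    generalize (derivative R).eval ((w + w⁻¹)/2) = b
    rcases Nat.eq_zero_or_pos n with h0 | h0
    · subst h0; simp; field_simp
    · obtain ⟨m, rfl⟩ : ∃ m, n = m + 1 := ⟨n - 1, by omega⟩
      simp only [Nat.add_sub_cancel]
      field_simp
      ring
  have hF0 : ∀ w : ℂ, w ≠ 0 → deriv (jF hα hβ n) w =
      w⁻¹ * (n * (w^n * Q.eval ((w + w⁻¹)/2)) + (w - w⁻¹)/2 * (w^n * (derivative Q).eval ((w + w⁻¹)/2))) := by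
    intro w hw
    refine ((hP Q w hw).congr_of_eventuallyEq ?_).deriv
    filter_upwards [isOpen_ne.mem_nhds hw] with u hu
    exact jF_eq hα hβ n hu
  have hF1 : deriv (deriv (jF hα hβ n)) z =
      -(z^2)⁻¹ * (n * (z^n * Q.eval ((z + z⁻¹)/2)) + (z - z⁻¹)/2 * (z^n * (derivative Q).eval ((z + z⁻¹)/2)))
      + z⁻¹ * (n * (z⁻¹ * (n * (z^n * Q.eval ((z + z⁻¹)/2)) + (z - z⁻¹)/2 * (z^n * (derivative Q).eval ((z + z⁻¹)/2))))
        + ((1 + (z^2)⁻¹)/2 * (z^n * (derivative Q).eval ((z + z⁻¹)/2))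
          + (z - z⁻¹)/2 * (z⁻¹ * (n * (z^n * (derivative Q).eval ((z + z⁻¹)/2)) + (z - z⁻¹)/2 * (z^n * (derivative (derivative Q)).eval ((z + z⁻¹)/2)))))) := by
    have h1 := (hasDerivAt_inv hz).mul (((hP Q z hz).const_mul (n:ℂ)).add
        ((((hasDerivAt_id z).sub (hasDerivAt_inv hz)).div_const 2).mul (hP (derivative Q) z hz)))
    have h2 : deriv (jF hα hβ n) =ᶠ[nhds z] (fun w => 
        w⁻¹ * (n * (w^n * Q.eval ((w + w⁻¹)/2)) + (w - w⁻¹)/2 * (w^n * (derivative Q).eval ((w + w⁻¹)/2)))) := by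
      filter_upwards [isOpen_ne.mem_nhds hz] with u hu
      exact hF0 u hu
    rw [(HasDerivAt.congr_of_eventuallyEq h1 h2).deriv]
    simp only [Pi.add_apply, Pi.mul_apply, Pi.sub_apply, id]
    ring
  have hode := congrArg (fun p : ℝ[X] => ((C ((2:ℝ)^n) * p).map Complex.ofRealHom).eval ((z + z⁻¹)/2)) (jP_ode hα hβ n)
  have hode2 : (1 - ((z + z⁻¹)/2)^2) * (derivative (derivative Q)).eval ((z + z⁻¹)/2)
      + ((β - α : ℂ) - (α + β + 2) * ((z + z⁻¹)/2)) * (derivative Q).eval ((z + z⁻¹)/2)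
      = -(n * (n + α + β + 1)) * Q.eval ((z + z⁻¹)/2) := by
    rw [hQ]
    unfold jqc jq
    simp only [jL, smul_eq_C_mul, Polynomial.map_add, Polynomial.map_mul, Polynomial.map_X, Polynomial.map_sub,
        Polynomial.map_C, eval_add, eval_mul, eval_X, eval_C, eval_sub, ← Polynomial.derivative_map,
        Polynomial.map_pow, Polynomial.map_one, eval_pow, eval_one, derivative_mul, derivative_C, zero_mul, zero_add] at hode ⊢
    push_cast [Complex.ofRealHom_eq_coe] at hode ⊢
    linear_combination hode
  rw [hF1, hF0 z hz, jF_eq hα hβ n hz, ← hQ]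
  clear hF1 hF0 hP hode
  generalize Q.eval ((z + z⁻¹)/2) = a at *
  generalize (derivative Q).eval ((z + z⁻¹)/2) = b at *
  generalize (derivative (derivative Q)).eval ((z + z⁻¹)/2) = c at *
  have h5 : z^n * ((1 - ((z + z⁻¹)/2)^2) * c
      + ((β - α : ℂ) - (α + β + 2) * ((z + z⁻¹)/2)) * b +(n * (n + α + β + 1)) * a) = 0 := by
    rw [hode2]; ring
  generalize z^n = p at *
  have e0 : z * (z⁻¹ * (n * (p * a) + (z - z⁻¹)/2 * (p * b))) = n * (p * a) + (z - z⁻¹)/2 * (p * b) := by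
    field_simp
  have e1 : z * (z⁻¹ * (n * (p * a) + (z - z⁻¹)/2 * (p * b)) + z * (
      -(z^2)⁻¹ * (n * (p * a) + (z - z⁻¹)/2 * (p * b))
      + z⁻¹ * (n * (z⁻¹ * (n * (p * a) + (z - z⁻¹)/2 * (p * b)))
        + ((1 + (z^2)⁻¹)/2 * (p * b)
          + (z - z⁻¹)/2 * (z⁻¹ * (n * (p * b) + (z - z⁻¹)/2 * (p * c)))))))
      = n * (n * (p * a) + (z - z⁻¹)/2 * (p * b)) + (z + z⁻¹)/2 * (p * b) + (z - z⁻¹)/2 *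
        (n * (p * b) + (z - z⁻¹)/2 * (p * c)) := by
    field_simp
    ring
  rw [e0, e1]
  have hzy : z * z⁻¹ = 1 := mul_inv_cancel₀ hz
  linear_combination (-((z - z⁻¹)/2)) * h5 - ((z - z⁻¹)/2) * p * c * hzy

/-- G -/
def jG (n : ℕ) (z : ℂ) : ℂ := jF hα hβ (n+1) z - z^2 * jF hα hβ n z
/-- H -/
def jH (n : ℕ) (z : ℂ) : ℂ := jF hα hβ (n+1) z - jF hα hβ n z

/-- eta -/
def jeta (n : ℕ) (z : ℂ) : ℂ :=
  -2 * z * (jb hα hβ (n+1) : ℂ) * jF hα hβ (n+1) z + (1 - 4 * (jA hα hβ (n+1) : ℂ)) * z^2 * jF hα hβ n z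

lemma jG_succ (n : ℕ) (z : ℂ) : jG hα hβ (n+1) z = jG hα hβ n z + jeta hα hβ n z := by
  unfold jG jeta
  rw [show n + 1 + 1 = n + 2 from rfl]
  conv_lhs => rw [jF]
  ring

lemma jH_succ (n : ℕ) (z : ℂ) : jH hα hβ (n+1) z = z^2 * jH hα hβ n z + jeta hα hβ n z := by
  unfold jH jeta
  rw [show n + 1 + 1 = n + 2 from rfl]
  conv_lhs => rw [jF]
  ring

/-- uniform bounds on the slit closed disc -/
lemma jGH_bound {δ : ℝ} (hδ : 0 < δ) : ∃ B : ℝ, 0 < B ∧ ∀ z : ℂ, ‖z‖ ≤ 1 → δ ≤ ‖1 - z^2‖ → ∀ n : ℕ,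
    ‖jG hα hβ n z‖ ≤ B ∧ ‖jH hα hβ n z‖ ≤ B ∧ ‖jF hα hβ n z‖ ≤ B ∧ ‖jeta hα hβ n z‖ ≤ B / ((n:ℝ)+1)^2 := by
  obtain ⟨C, hC, hb⟩ := jcoef_bound hα hβ
  set K := 6 * C / δ with hK
  have hKp : 0 < K := by positivity
  set B0 := (1 + 2 * C) * Real.exp (2 * K) with hB0
  have hB0p : 0 < B0 := by positivity
  refine ⟨B0 + 2 * B0 / δ + K * B0, by positivity, ?_⟩
  intro z hz hzd
  have hz2 : ‖z^2‖ ≤ 1 := by rw [norm_pow]; exact pow_le_one₀ (norm_nonneg _) hz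
  set M : ℕ → ℝ := fun n => max ‖jG hα hβ n z‖ ‖jH hα hβ n z‖ with hM
  have hM0 : ∀ n, 0 ≤ M n := fun n => (norm_nonneg _).trans (le_max_left _ _)
  have hG : ∀ n, ‖jG hα hβ n z‖ ≤ M n := fun n => le_max_left _ _
  have hH : ∀ n, ‖jH hα hβ n z‖ ≤ M n := fun n => le_max_right _ _
  have hdiv : ∀ (a : ℂ) (n : ℕ), ‖(1 - z^2) * a‖ ≤ 2 * M n → ‖a‖ ≤ 2 * M n / δ := by
    intro a n h
    rw [le_div_iff₀ hδ]
    rw [norm_mul] at h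
    nlinarith [norm_nonneg a]
  have hF : ∀ n, ‖jF hα hβ n z‖ ≤ 2 * M n / δ := by
    intro n
    apply hdiv
    have : (1 - z^2) * jF hα hβ n z = jG hα hβ n z - jH hα hβ n z := by unfold jG jH; ring
    rw [this]
    linarith [norm_sub_le (jG hα hβ n z) (jH hα hβ n z), hG n, hH n]
  have hF1 : ∀ n, ‖jF hα hβ (n+1) z‖ ≤ 2 * M n / δ := by
    intro n
    apply hdiv
    have : (1 - z^2) * jF hα hβ (n+1) z = jG hα hβ n z - z^2 * jH hα hβ n z := by unfold jG jH; ring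
    rw [this]
    have h2 : ‖z^2 * jH hα hβ n z‖ ≤ ‖jH hα hβ n z‖ := by
      rw [norm_mul]; exact mul_le_of_le_one_left (norm_nonneg _) hz2
    linarith [norm_sub_le (jG hα hβ n z) (z^2 * jH hα hβ n z), hG n, hH n]
  have heta : ∀ n : ℕ, ‖jeta hα hβ n z‖ ≤ K / ((n:ℝ)+1)^2 * M n := by
    intro n
    obtain ⟨h1, h2⟩ := hb (n+1)
    have h3 : C / (((n+1:ℕ):ℝ)+1)^2 ≤ C / ((n:ℝ)+1)^2 := by
      push_cast
      gcongr
      linarith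
    have n1 : ‖(jb hα hβ (n+1) : ℂ)‖ ≤ C / ((n:ℝ)+1)^2 := by
      rw [Complex.norm_real, Real.norm_eq_abs]; linarith
    have n2 : ‖(1 - 4 * (jA hα hβ (n+1) : ℂ))‖ ≤ C / ((n:ℝ)+1)^2 := by
      have : (1 - 4 * (jA hα hβ (n+1) : ℂ)) = ((1 - 4 * jA hα hβ (n+1) : ℝ) : ℂ) := by push_cast; ring
      rw [this, Complex.norm_real, Real.norm_eq_abs, abs_sub_comm]; linarith
    have hc : 0 ≤ C / ((n:ℝ)+1)^2 := by positivity
    unfold jeta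
    calc _ ≤ ‖-2 * z * (jb hα hβ (n+1) : ℂ) * jF hα hβ (n+1) z‖ +
        ‖(1 - 4 * (jA hα hβ (n+1) : ℂ)) * z^2 * jF hα hβ n z‖ := norm_add_le _ _
      _ = 2 * ‖z‖ * ‖(jb hα hβ (n+1) : ℂ)‖ * ‖jF hα hβ (n+1) z‖ +
        ‖(1 - 4 * (jA hα hβ (n+1) : ℂ))‖ * ‖z^2‖ * ‖jF hα hβ n z‖ := by simp only [norm_mul]; norm_num
      _ ≤ 2 * 1 * (C / ((n:ℝ)+1)^2) * (2 * M n / δ) + (C / ((n:ℝ)+1)^2) * 1 * (2 * M n / δ) := by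
        have := hM0 n
        gcongr
        · exact hF1 n
        · exact hF n
      _ = K / ((n:ℝ)+1)^2 * M n := by rw [hK]; field_simp; ring
  have hMrec : ∀ n : ℕ, M (n+1) ≤ (1 + K / ((n:ℝ)+1)^2) * M n := by
    intro n
    have := heta n
    refine max_le ?_ ?_
    · rw [jG_succ]
      refine (norm_add_le _ _).trans ?_
      linarith [hG n]
    · rw [jH_succ]
      refine (norm_add_le _ _).trans ?_
      have h2 : ‖z^2 * jH hα hβ n z‖ ≤ ‖jH hα hβ n z‖ := by
        rw [norm_mul]; exact mul_le_of_le_one_left (norm_nonneg _) hz2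
      linarith [hH n]
  have hMB : ∀ n, M n ≤ B0 := by
    intro n
    refine (growth_bound hM0 hKp.le hMrec n).trans ?_
    rw [hB0]
    gcongr
    have hb0 : ‖2 * z * (jb hα hβ 0 : ℂ)‖ ≤ 2 * C := by
      have := (hb 0).1
      simp only [norm_mul, Complex.norm_real, Real.norm_eq_abs]
      norm_num at this ⊢
      nlinarith [norm_nonneg z, abs_nonneg (jb hα hβ 0)]
    refine max_le ?_ ?_
    · have : jG hα hβ 0 z = 1 - 2 * z * (jb hα hβ 0 : ℂ) := by simp [jG, jF]; ring
      rw [this]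
      refine (norm_sub_le _ _).trans ?_
      rw [norm_one]; linarith
    · have : jH hα hβ 0 z = z^2 - 2 * z * (jb hα hβ 0 : ℂ) := by simp [jH, jF]; ring
      rw [this]
      refine (norm_sub_le _ _).trans ?_
      linarith
  intro n
  have p1 : 0 < 2 * B0 / δ := by positivity
  have p2 : 0 < K * B0 := by positivity
  refine ⟨?_, ?_, ?_, ?_⟩
  · linarith [hG n, hMB n]
  · linarith [hH n, hMB n]
  · have : 2 * M n / δ ≤ 2 * B0 / δ := by gcongr; exact hMB n
    linarith [hF n]
  · refine (heta n).trans ?_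
    rw [div_mul_eq_mul_div]
    gcongr
    have : K * M n ≤ K * B0 := by gcongr; exact hMB n
    linarith

end

lemma cauchy_bound {u : ℕ → ℂ} {B : ℝ} (hB : 0 ≤ B) (h : ∀ n : ℕ, ‖u (n+1) - u n‖ ≤ B / ((n:ℝ)+1)^2) (n k : ℕ) :
    ‖u (n+k) - u n‖ ≤ 2 * B * (1 / ((n:ℝ)+1) - 1 / ((n:ℝ)+k+1)) := by
  induction k with
  | zero => simp
  | succ k ih =>
    have h1 := h (n+k)
    have h2 : B / (((n+k:ℕ):ℝ)+1)^2 ≤ 2 * B * (1 / ((n:ℝ)+k+1) - 1 / ((n:ℝ)+k+1+1)) := by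
      push_cast
      have hx : (0:ℝ) ≤ (n:ℝ)+k := by positivity
      generalize (n:ℝ)+k = x at *
      have : 2 * B * (1 / (x+1) - 1 / (x+1+1)) = 2 * B / ((x+1) * (x+1+1)) := by field_simp; ring
      rw [this, div_le_div_iff₀ (by positivity) (by positivity)]
      nlinarith [mul_nonneg hB hx, mul_nonneg hB (mul_nonneg hx hx)]
    have h3 : u (n + (k+1)) - u n = (u (n+k+1) - u (n+k)) + (u (n+k) - u n) := by
      rw [← add_assoc]; ring
    rw [h3]
    refine (norm_add_le _ _).trans ?_
    push_cast
    have e : (n:ℝ) + (k+1) + 1 = (n:ℝ)+k+1+1 := by ring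
    rw [e]
    linarith

lemma cauchy_limit {u : ℕ → ℂ} {B : ℝ} (hB : 0 ≤ B) (h : ∀ n : ℕ, ‖u (n+1) - u n‖ ≤ B / ((n:ℝ)+1)^2) :
    ∃ L : ℂ, ∀ n : ℕ, ‖u n - L‖ ≤ 2 * B / ((n:ℝ)+1) := by
  have hb : ∀ n k : ℕ, ‖u (n+k) - u n‖ ≤ 2 * B / ((n:ℝ)+1) := by
    intro n k
    refine (cauchy_bound hB h n k).trans ?_
    have : 0 ≤ 2 * B * (1 / ((n:ℝ)+k+1)) := by positivity
    have e : 2 * B / ((n:ℝ)+1) = 2 * B * (1 / ((n:ℝ)+1)) := by ring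
    rw [e]; linarith
  have hc : CauchySeq u := by
    refine cauchySeq_of_le_tendsto_0' (fun n : ℕ => 2 * B / ((n:ℝ)+1)) ?_ ?_
    · intro n m hnm
      obtain ⟨k, rfl⟩ := Nat.exists_eq_add_of_le hnm
      rw [dist_comm, dist_eq_norm]
      exact hb n k
    · exact (tendsto_const_nhds.div_atTop (tendsto_atTop_add_const_right _ _ tendsto_natCast_atTop_atTop))
  obtain ⟨L, hL⟩ := cauchySeq_tendsto_of_complete hc
  refine ⟨L, fun n => ?_⟩
  rw [norm_sub_rev]
  have h1 : Tendsto (fun k => ‖u (n+k) - u n‖) atTop (nhds ‖L - u n‖) := by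
    have h2 : Tendsto (fun k => u (n+k)) atTop (nhds L) := by
      have := hL.comp (tendsto_add_atTop_nat n)
      refine this.congr (fun k => ?_)
      simp [add_comm]
    exact (h2.sub_const _).norm
  exact le_of_tendsto' h1 (hb n)

lemma geom_decay {v ε : ℕ → ℝ} {ρ : ℝ} (hv : ∀ n, 0 ≤ v n) (h0 : 0 ≤ ρ) (h1 : ρ < 1) (hε : Summable ε)
    (hε0 : ∀ n, 0 ≤ ε n)
    (h : ∀ n, v (n+1) ≤ ρ * v n + ε n) : Tendsto v atTop (nhds 0) := by
  have hs : Summable v := by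
    refine summable_of_sum_range_le (c := (v 0 + ∑' n, ε n) / (1 - ρ)) hv ?_
    intro n
    rw [le_div_iff₀ (by linarith)]
    have h2 : ∀ n, ∑ i ∈ Finset.range n, v i ≤ v 0 + ρ * ∑ i ∈ Finset.range n, v i + ∑ i ∈ Finset.range n, ε i := by
      intro n
      cases n with
      | zero => simp [hv 0]
      | succ n =>
        have h3 : ∑ i ∈ Finset.range n, v (i+1) ≤ ∑ i ∈ Finset.range n, (ρ * v i + ε i) :=
          Finset.sum_le_sum (fun i _ => h i)
        rw [Finset.sum_add_distrib, ← Finset.mul_sum] at h3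
        have e1 := Finset.sum_range_succ' v n
        have e2 := Finset.sum_range_succ v n
        have e3 := Finset.sum_range_succ ε n
        have : 0 ≤ ρ * v n := mul_nonneg h0 (hv n)
        have := hε0 n
        rw [e3]
        have e4 : ρ * ∑ i ∈ Finset.range (n+1), v i = ρ * ∑ i ∈ Finset.range n, v i + ρ * v n := by
          rw [e2]; ring
        linarith
    have h4 := h2 n
    have h5 := hε.sum_le_tsum (Finset.range n) (fun i _ => hε0 i)
    linarith
  exact hs.tendsto_atTop_zero

lemma summable_inv_sq (B : ℝ) : Summable (fun n : ℕ => B / ((n:ℝ)+1)^2) := by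
  have h : Summable (fun n : ℕ => 1 / ((n:ℝ))^2) := Real.summable_one_div_nat_pow.2 (by norm_num)
  have h2 := ((summable_nat_add_iff 1).2 h).mul_left B
  refine h2.congr (fun n => ?_)
  push_cast; ring

section
variable {α β : ℝ} (hα : -1 < α) (hβ : -1 < β)

/-- limit Jost function -/
def jGinf (α β : ℝ) (z : ℂ) : ℂ :=
  cexp ((1/2 - α) * Complex.log (1 - z) + (1/2 - β) * Complex.log (1 + z))

lemma disc_mem_slit {z : ℂ} (hz : ‖z‖ ≤ 1) (h : z^2 ≠ 1) : 1 - z ∈ slitPlane ∧ 1 + z ∈ slitPlane := by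
  have h1 : z ≠ 1 := by rintro rfl; simp at h
  have h2 : z ≠ -1 := by rintro rfl; simp at h
  have hre := (Complex.abs_re_le_norm z).trans hz
  have key : |z.re| < 1 := by
    rcases lt_or_eq_of_le hre with h | h
    · exact h
    · exfalso
      have h4 : z.re^2 + z.im^2 ≤ 1 := by
        have := Complex.sq_norm z
        rw [Complex.normSq_apply] at this
        nlinarith [norm_nonneg z]
      have h5 : z.re^2 = 1 := by rw [← sq_abs, h]; norm_num
      have h6 : z.im = 0 := by nlinarith [sq_nonneg z.im]
      rcases abs_eq (by norm_num : (0:ℝ) ≤ 1) |>.1 h with h7 | h7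
      · exact h1 (Complex.ext (by simp [h7]) (by simp [h6]))
      · exact h2 (Complex.ext (by simp [h7]) (by simp [h6]))
  rw [abs_lt] at key
  constructor
  · left; simp; linarith
  · left; simp; linarith

lemma jGinf_disc : ∃ L : ℂ → ℂ, (∀ δ : ℝ, 0 < δ → ∃ C : ℝ, 0 < C ∧ ∀ z : ℂ, ‖z‖ ≤ 1 → δ ≤ ‖1 - z^2‖ → ∀ n : ℕ,
    ‖jG hα hβ n z - L z‖ ≤ C / ((n:ℝ)+1)) ∧
    TendstoLocallyUniformlyOn (fun n => jF hα hβ n) (fun z => L z / (1 - z^2)) atTop (Metric.ball 0 1) := by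
  have hex : ∀ z : ℂ, ∃ L : ℂ, ∀ δ : ℝ, 0 < δ → ∀ B : ℝ, 0 ≤ B → (∀ n : ℕ, ‖jeta hα hβ n z‖ ≤ B / ((n:ℝ)+1)^2) →
      ∀ n : ℕ, ‖jG hα hβ n z - L‖ ≤ 2 * B / ((n:ℝ)+1) := by
    intro z
    by_cases h : ∃ B : ℝ, 0 ≤ B ∧ (∀ n : ℕ, ‖jeta hα hβ n z‖ ≤ B / ((n:ℝ)+1)^2)
    · have hlim : ∀ B : ℝ, 0 ≤ B → (∀ n : ℕ, ‖jeta hα hβ n z‖ ≤ B / ((n:ℝ)+1)^2) → 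
          ∃ L : ℂ, ∀ n : ℕ, ‖jG hα hβ n z - L‖ ≤ 2 * B / ((n:ℝ)+1) := by
        intro B hB hB2
        apply cauchy_limit hB
        intro n
        rw [jG_succ]
        simpa using hB2 n
      have hten : ∀ (B : ℝ) (L : ℂ), (∀ n : ℕ, ‖jG hα hβ n z - L‖ ≤ 2 * B / ((n:ℝ)+1)) → 
          Tendsto (fun n => jG hα hβ n z) atTop (nhds L) := by
        intro B L hL
        rw [tendsto_iff_norm_sub_tendsto_zero]
        refine squeeze_zero (fun _ => norm_nonneg _) hL ?_
        exact (tendsto_const_nhds.div_atTop (tendsto_atTop_add_const_right _ _ tendsto_natCast_atTop_atTop))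
      obtain ⟨B, hB, hB2⟩ := h
      obtain ⟨L, hL⟩ := hlim B hB hB2
      refine ⟨L, fun δ _ B' hB' hB2' n => ?_⟩
      obtain ⟨L', hL'⟩ := hlim B' hB' hB2'
      have : L = L' := tendsto_nhds_unique (hten B L hL) (hten B' L' hL')
      rw [this]
      exact hL' n
    · refine ⟨0, fun δ _ B hB hB2 => ?_⟩
      exact absurd ⟨B, hB, hB2⟩ h
  choose L hL using hex
  have part1 : (∀ δ : ℝ, 0 < δ → ∃ C : ℝ, 0 < C ∧ ∀ z : ℂ, ‖z‖ ≤ 1 → δ ≤ ‖1 - z^2‖ → ∀ n : ℕ,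
    ‖jG hα hβ n z - L z‖ ≤ C / ((n:ℝ)+1)) := by
    intro δ hδ
    obtain ⟨B, hB, hb⟩ := jGH_bound hα hβ hδ
    refine ⟨2 * B, by positivity, fun z hz hz2 n => ?_⟩
    exact hL z δ hδ B hB.le (fun m => (hb z hz hz2 m).2.2.2) n
  refine ⟨L, part1, ?_⟩
  rw [tendstoLocallyUniformlyOn_iff_forall_isCompact Metric.isOpen_ball]
  intro K hK hKc
  obtain ⟨r, hr0, hr1, hKr⟩ : ∃ r : ℝ, 0 ≤ r ∧ r < 1 ∧ ∀ z ∈ K, ‖z‖ ≤ r := by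
    rcases K.eq_empty_or_nonempty with h | h
    · exact ⟨0, le_rfl, by norm_num, by simp [h]⟩
    · obtain ⟨z, hz, hm⟩ := hKc.exists_isMaxOn h continuous_norm.continuousOn
      refine ⟨‖z‖, norm_nonneg _, by simpa using hK hz, fun w hw => hm hw⟩
  set δ := 1 - r^2 with hδd
  have hδ : 0 < δ := by nlinarith
  obtain ⟨C, hC, hG⟩ := part1 δ hδ
  obtain ⟨B, hB, hb⟩ := jGH_bound hα hβ hδ
  -- majorant
  set v : ℕ → ℝ := fun n => Nat.rec B (fun n x => r^2 * x + B / ((n:ℝ)+1)^2) n with hv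
  have hvs : ∀ n, v (n+1) = r^2 * v n + B / ((n:ℝ)+1)^2 := fun n => rfl
  have hvn : ∀ n, 0 ≤ v n := by
    intro n
    induction n with
    | zero => exact hB.le
    | succ n ih => rw [hvs]; positivity
  have hvt : Tendsto v atTop (nhds 0) := by
    refine geom_decay hvn (sq_nonneg r) (by nlinarith) (summable_inv_sq B) (fun n => by positivity) (fun n => (hvs n).le)
  have hz1 : ∀ z ∈ K, ‖z‖ ≤ 1 ∧ δ ≤ ‖1 - z^2‖ := by
    intro z hz
    have h1 := hKr z hz
    refine ⟨by linarith, ?_⟩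
    have h2 := norm_sub_norm_le (1:ℂ) (z^2)
    rw [norm_one, norm_pow] at h2
    have : ‖z‖^2 ≤ r^2 := by gcongr
    linarith
  have hHv : ∀ z ∈ K, ∀ n, ‖jH hα hβ n z‖ ≤ v n := by
    intro z hz n
    induction n with
    | zero => exact (hb z (hz1 z hz).1 (hz1 z hz).2 0).2.1
    | succ n ih =>
      rw [jH_succ, hvs]
      refine (norm_add_le _ _).trans ?_
      have h1 := (hb z (hz1 z hz).1 (hz1 z hz).2 n).2.2.2
      have h2 : ‖z^2 * jH hα hβ n z‖ ≤ r^2 * v n := by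
        rw [norm_mul, norm_pow]
        have := hKr z hz
        gcongr
      linarith
  rw [Metric.tendstoUniformlyOn_iff]
  intro ε hε
  have hlim : Tendsto (fun n : ℕ => (C / ((n:ℝ)+1) + v n) / δ) atTop (nhds 0) := by
    have : Tendsto (fun n : ℕ => C / ((n:ℝ)+1)) atTop (nhds 0) :=
      (tendsto_const_nhds.div_atTop (tendsto_atTop_add_const_right _ _ tendsto_natCast_atTop_atTop))
    simpa using (this.add hvt).div_const δ
  filter_upwards [hlim.eventually (gt_mem_nhds hε)] with n hn z hz
  refine lt_of_le_of_lt ?_ hn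
  obtain ⟨h1, h2⟩ := hz1 z hz
  have h3 : 1 - z^2 ≠ 0 := by
    intro h; rw [h, norm_zero] at h2; linarith
  have e : L z / (1 - z^2) - jF hα hβ n z = ((L z - jG hα hβ n z) + jH hα hβ n z) / (1 - z^2) := by
    field_simp
    unfold jG jH
    ring
  rw [dist_eq_norm, e, norm_div]
  have h5 := hvn n
  gcongr
  refine (norm_add_le _ _).trans ?_
  rw [norm_sub_rev]
  exact add_le_add (hG z h1 h2 n) (hHv z hz n)

end

section
variable {α β : ℝ} (hα : -1 < α) (hβ : -1 < β)

lemma jL_ident (L : ℂ → ℂ) (hL : TendstoLocallyUniformlyOn (fun n => jF hα hβ n) (fun z => L z / (1 - z^2))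
    atTop (Metric.ball 0 1)) : ∀ z : ℂ, ‖z‖ < 1 → L z = jGinf α β z := by
  set f : ℂ → ℂ := fun z => L z / (1 - z^2) with hf
  have ho : IsOpen (Metric.ball (0:ℂ) 1) := Metric.isOpen_ball
  have hd0 : ∀ᶠ n : ℕ in atTop, DifferentiableOn ℂ (jF hα hβ n) (Metric.ball 0 1) :=
    Eventually.of_forall (fun n => (jF_diff hα hβ n).differentiableOn)
  have hfd : DifferentiableOn ℂ f (Metric.ball 0 1) := hL.differentiableOn hd0 ho
  have hL1 := hL.deriv hd0 ho
  have hd1 : ∀ᶠ n : ℕ in atTop, DifferentiableOn ℂ (deriv ∘ (fun n => jF hα hβ n) <| n) (Metric.ball 0 1) :=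
    Eventually.of_forall (fun n => ((jF_diff hα hβ n).differentiableOn.deriv ho))
  have hL2 := hL1.deriv hd1 ho
  have ode : ∀ z ∈ Metric.ball (0:ℂ) 1, z ≠ 0 →
      (1 - z^2) * deriv f z = (((α:ℂ)+β+1) * z + (α - β)) * f z := by
    intro z hz hz0
    have t0 := hL.tendsto_at hz
    have t1 := hL1.tendsto_at hz
    have t2 := hL2.tendsto_at hz
    simp only [Function.comp] at t1 t2
    have tinv : Tendsto (fun n : ℕ => ((n:ℂ))⁻¹) atTop (nhds 0) := tendsto_inv_atTop_nhds_zero_nat (𝕜 := ℂ)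
    have lhs : Tendsto (fun n : ℕ => ((n:ℂ))⁻¹ * ((z - z⁻¹)/2 * (z * (deriv (jF hα hβ n) z + z * deriv (deriv (jF hα hβ n)) z))
        - ((β - α) - (α+β+1) * ((z + z⁻¹)/2)) * (z * deriv (jF hα hβ n) z)))
        atTop (nhds (0 * ((z - z⁻¹)/2 * (z * (deriv f z + z * deriv (deriv f) z))
          - ((β - α) - (α+β+1) * ((z + z⁻¹)/2)) * (z * deriv f z)))) :=
      tinv.mul ((((t1.add (t2.const_mul z)).const_mul z).const_mul _).sub ((t1.const_mul z).const_mul _))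
    have rhs : Tendsto (fun n : ℕ => (((α:ℂ)+β+1) * z + (α - β)) * jF hα hβ n z
        + (2 * ((z - z⁻¹)/2)) * (z * deriv (jF hα hβ n) z)) atTop
        (nhds ((((α:ℂ)+β+1) * z + (α - β)) * f z + (2 * ((z - z⁻¹)/2)) * (z * deriv f z))) :=
      (t0.const_mul _).add ((t1.const_mul z).const_mul _)
    have heq : ∀ᶠ n : ℕ in atTop, ((n:ℂ))⁻¹ * ((z - z⁻¹)/2 * (z * (deriv (jF hα hβ n) z + z * deriv (deriv (jF hα hβ n)) z))
        - ((β - α) - (α+β+1) * ((z + z⁻¹)/2)) * (z * deriv (jF hα hβ n) z))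
        = (((α:ℂ)+β+1) * z + (α - β)) * jF hα hβ n z
        + (2 * ((z - z⁻¹)/2)) * (z * deriv (jF hα hβ n) z) := by
      filter_upwards [eventually_ge_atTop 1] with n hn
      have hn0 : (n:ℂ) ≠ 0 := by exact_mod_cast (by omega : n ≠ 0)
      rw [jF_ode hα hβ n hz0, inv_mul_eq_iff_eq_mul₀ hn0]
      ring
    have := tendsto_nhds_unique (lhs.congr' heq) rhs
    rw [zero_mul] at this
    have e : (2 * ((z - z⁻¹)/2)) * (z * deriv f z) = (z^2 - 1) * deriv f z := by field_simp
    rw [e] at this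
    linear_combination this
  have slit : ∀ z ∈ Metric.ball (0:ℂ) 1, 1 - z ∈ slitPlane ∧ 1 + z ∈ slitPlane := by
    intro z hz
    have hz' : ‖z‖ < 1 := by simpa using hz
    refine disc_mem_slit hz'.le ?_
    intro h
    have := congrArg norm h
    rw [norm_pow, norm_one] at this
    nlinarith [norm_nonneg z]
  set E : ℂ → ℂ := fun z => cexp ((α + 1/2) * Complex.log (1 - z) + (β + 1/2) * Complex.log (1 + z)) with hE
  have hEd : ∀ z ∈ Metric.ball (0:ℂ) 1, HasDerivAt E (E z * ((α + 1/2) * (-1 / (1 - z)) + (β + 1/2) * (1 / (1 + z)))) z := by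
    intro z hz
    obtain ⟨s1, s2⟩ := slit z hz
    have h1 : HasDerivAt (fun z : ℂ => Complex.log (1 - z)) (-1 / (1 - z)) z :=
      ((hasDerivAt_id z).const_sub 1).clog s1
    have h2 : HasDerivAt (fun z : ℂ => Complex.log (1 + z)) (1 / (1 + z)) z :=
      ((hasDerivAt_id z).const_add 1).clog s2
    exact ((h1.const_mul _).add (h2.const_mul _)).cexp
  have hfE : ∀ z ∈ Metric.ball (0:ℂ) 1, HasDerivAt (fun z => f z * E z)
      (deriv f z * E z + f z * (E z * ((α + 1/2) * (-1 / (1 - z)) + (β + 1/2) * (1 / (1 + z))))) z := by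
    intro z hz
    exact ((hfd.differentiableAt (ho.mem_nhds hz)).hasDerivAt).mul (hEd z hz)
  have hzero : ∀ z ∈ Metric.ball (0:ℂ) 1, z ≠ 0 → deriv (fun z => f z * E z) z = 0 := by
    intro z hz hz0
    rw [(hfE z hz).deriv]
    obtain ⟨s1, s2⟩ := slit z hz
    have n1 := slitPlane_ne_zero s1
    have n2 := slitPlane_ne_zero s2
    have h := ode z hz hz0
    have e : deriv f z = (((α:ℂ)+β+1) * z + (α - β)) * f z / ((1 - z) * (1 + z)) := by
      rw [eq_div_iff (mul_ne_zero n1 n2)]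
      linear_combination h
    rw [e]
    field_simp
    ring
  have hdd : DifferentiableOn ℂ (fun z => f z * E z) (Metric.ball 0 1) :=
    fun z hz => (hfE z hz).differentiableAt.differentiableWithinAt
  have hzero' : ∀ z ∈ Metric.ball (0:ℂ) 1, deriv (fun z => f z * E z) z = 0 := by
    intro z hz
    by_cases hz0 : z = 0
    · have hc : ContinuousAt (deriv (fun z => f z * E z)) z :=
        ((hdd.deriv ho).differentiableAt (ho.mem_nhds hz)).continuousAt
      have h1 : Tendsto (deriv (fun z => f z * E z)) (nhdsWithin z {z}ᶜ) (nhds (deriv (fun z => f z * E z) z)) :=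
        hc.tendsto.mono_left nhdsWithin_le_nhds
      have h2 : Tendsto (deriv (fun z => f z * E z)) (nhdsWithin z {z}ᶜ) (nhds 0) := by
        refine Tendsto.congr' ?_ tendsto_const_nhds
        filter_upwards [self_mem_nhdsWithin, mem_nhdsWithin_of_mem_nhds (ho.mem_nhds hz)] with w hw1 hw2
        refine (hzero w hw2 ?_).symm
        rw [hz0] at hw1
        exact hw1
      exact tendsto_nhds_unique h1 h2
    · exact hzero z hz hz0
  intro z hz
  have hzb : z ∈ Metric.ball (0:ℂ) 1 := by simpa using hz
  have h0b : (0:ℂ) ∈ Metric.ball (0:ℂ) 1 := by simp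
  have hconst := ho.is_const_of_deriv_eq_zero (convex_ball (0:ℂ) 1).isPreconnected hdd hzero' hzb h0b
  have hf0 : f 0 = 1 := by
    have t0 := hL.tendsto_at h0b
    have : Tendsto (fun n : ℕ => jF hα hβ n 0) atTop (nhds 1) := by
      simp [jF_zero_arg]
    exact tendsto_nhds_unique t0 this
  have hE0 : E 0 = 1 := by simp [hE]
  simp only [hf0, hE0, mul_one] at hconst
  obtain ⟨s1, s2⟩ := slit z hzb
  have n1 := slitPlane_ne_zero s1
  have n2 := slitPlane_ne_zero s2
  have e1 : 1 - z^2 = (1 - z) * (1 + z) := by ring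
  have e2 : L z * E z = (1 - z) * (1 + z) := by
    have : f z * (1 - z^2) = L z := by
      have h3 : 1 - z^2 ≠ 0 := by rw [e1]; exact mul_ne_zero n1 n2
      exact div_mul_cancel₀ _ h3
    rw [← this, e1]
    linear_combination (1-z) * (1+z) * hconst
  have hEn : E z ≠ 0 := Complex.exp_ne_zero _
  apply mul_right_cancel₀ hEn
  rw [e2, hE]
  unfold jGinf
  rw [← Complex.exp_add]
  have e3 : (1/2 - (α:ℂ)) * Complex.log (1 - z) + (1/2 - β) * Complex.log (1 + z)
      + ((α + 1/2) * Complex.log (1 - z) + (β + 1/2) * Complex.log (1 + z))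
      = Complex.log (1 - z) + Complex.log (1 + z) := by ring
  rw [e3, Complex.exp_add, Complex.exp_log n1, Complex.exp_log n2]

lemma jG_lim {δ : ℝ} (hδ : 0 < δ) : ∃ C : ℝ, 0 < C ∧ ∀ z : ℂ, ‖z‖ = 1 → δ ≤ ‖1 - z^2‖ → ∀ n : ℕ,
    ‖jG hα hβ n z - jGinf α β z‖ ≤ C / ((n:ℝ)+1) := by
  obtain ⟨L, h1, h2⟩ := jGinf_disc hα hβ
  have hid := jL_ident hα hβ L h2
  obtain ⟨C, hC, hb⟩ := h1 (δ/2) (by positivity)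
  refine ⟨C, hC, fun z hz hzd n => ?_⟩
  have hz2 : z^2 ≠ 1 := by
    intro h; rw [h] at hzd; simp at hzd; linarith
  obtain ⟨s1, s2⟩ := disc_mem_slit hz.le hz2
  have hcont : ContinuousAt (fun w => jGinf α β w) z := by
    unfold jGinf
    have a1 : ContinuousAt (fun w : ℂ => Complex.log (1 - w)) z :=
      ContinuousAt.clog (by fun_prop) s1
    have a2 : ContinuousAt (fun w : ℂ => Complex.log (1 + w)) z :=
      ContinuousAt.clog (by fun_prop) s2
    exact ((a1.const_mul _).add (a2.const_mul _)).cexp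
  have hGc : Continuous (fun w => jG hα hβ n w) := by
    unfold jG
    have := (jF_diff hα hβ (n+1)).continuous
    have := (jF_diff hα hβ n).continuous
    fun_prop
  have ht : Tendsto (fun t : ℝ => (t:ℂ) * z) (nhdsWithin 1 (Set.Iio 1)) (nhds z) := by
    have : Tendsto (fun t : ℝ => (t:ℂ) * z) (nhds 1) (nhds (((1:ℝ):ℂ) * z)) :=
      (by fun_prop : Continuous (fun t : ℝ => (t:ℂ) * z)).tendsto 1
    simp only [Complex.ofReal_one, one_mul] at this
    exact this.mono_left nhdsWithin_le_nhds
  have hlim : Tendsto (fun t : ℝ => ‖jG hα hβ n (t * z) - jGinf α β (t * z)‖) (nhdsWithin 1 (Set.Iio 1))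
      (nhds ‖jG hα hβ n z - jGinf α β z‖) :=
    ((hGc.tendsto z |>.comp ht).sub (hcont.tendsto.comp ht)).norm
  have hδt : Tendsto (fun t : ℝ => ‖1 - ((t:ℂ) * z)^2‖) (nhdsWithin 1 (Set.Iio 1)) (nhds ‖1 - z^2‖) :=
    ((ht.pow 2).const_sub 1).norm
  refine le_of_tendsto hlim ?_
  filter_upwards [hδt.eventually (lt_mem_nhds (by linarith : δ/2 < ‖1 - z^2‖)), self_mem_nhdsWithin,
    mem_nhdsWithin_of_mem_nhds (lt_mem_nhds (by norm_num : (0:ℝ) < 1))] with t ht1 ht2 ht3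
  have hn : ‖(t:ℂ) * z‖ < 1 := by
    rw [norm_mul, hz, Complex.norm_real, Real.norm_eq_abs, abs_of_pos ht3]
    simpa using ht2
  rw [← hid _ hn]
  exact hb _ hn.le ht1.le n

/-- value of q_n through the Jost function on the circle -/
lemma jq_circle (n : ℕ) (θ : ℝ) (hs : Real.sin θ ≠ 0) :
    (jq hα hβ n).eval (Real.cos θ) = - (cexp (-((n+1:ℕ) * θ * I)) * jG hα hβ n (cexp (θ * I))).im / Real.sin θ := by
  set z := cexp (θ * I) with hz
  have hz0 : z ≠ 0 := Complex.exp_ne_zero _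
  have hinv : z⁻¹ = cexp (-(θ * I)) := by rw [hz, Complex.exp_neg]
  have hc : (z + z⁻¹)/2 = ((Real.cos θ : ℝ) : ℂ) := by
    rw [hinv, hz, Complex.ofReal_cos, Complex.cos]; ring_nf
  have hp : cexp (-((n+1:ℕ) * θ * I)) = (z^(n+1))⁻¹ := by
    rw [Complex.exp_neg, hz, ← Complex.exp_nat_mul]; ring_nf
  have e : cexp (-((n+1:ℕ) * θ * I)) * jG hα hβ n z = (((jq hα hβ (n+1)).eval (Real.cos θ) : ℝ) : ℂ)
      - z * (((jq hα hβ n).eval (Real.cos θ) : ℝ) : ℂ) := by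
    unfold jG
    rw [jF_eq hα hβ _ hz0, jF_eq hα hβ _ hz0, hc, jqc_eval_real, jqc_eval_real, hp]
    field_simp
    ring
  rw [e]
  have hzim : z.im = Real.sin θ := by rw [hz, Complex.exp_ofReal_mul_I_im]
  simp only [Complex.sub_im, Complex.ofReal_im, Complex.mul_im, hzim, Complex.ofReal_re]
  field_simp
  ring

end

instance fact_two_pi_pos : Fact (0 < 2 * Real.pi) := Fact.mk Real.two_pi_pos

/-- Fourier coefficient of f(cos θ) -/
def fcoef (f : ℂ → ℂ) (m : ℤ) : ℂ := (1 / (2 * Real.pi) : ℝ) • ∫ θ in (0:ℝ)..(2 * Real.pi), cexp (-(m * θ * I)) * f (Real.cos θ)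

lemma fcoef_hasSum (f : ℂ → ℂ) (hf : Continuous (fun θ : ℝ => f (Real.cos θ))) (hs : Summable (fcoef f)) (θ : ℝ) :
    HasSum (fun m : ℤ => fcoef f m * cexp (m * θ * I)) (f (Real.cos θ)) := by
  set g : ℝ → ℂ := fun θ : ℝ => f (Real.cos θ) with hg
  have hper : Function.Periodic g (2 * Real.pi) := by
    intro x; simp only [hg, Real.cos_add_two_pi]
  set F : C(AddCircle (2 * Real.pi), ℂ) := ⟨hper.lift, by
    refine continuous_coinduced_dom.2 ?_
    exact hf⟩ with hF
  have hco : ∀ x : ℝ, F (x : AddCircle (2 * Real.pi)) = g x := fun x => rfl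
  have hpi : (Real.pi : ℂ) ≠ 0 := by exact_mod_cast Real.pi_ne_zero
  have hcoef : fourierCoeff F = fcoef f := by
    funext m
    rw [fourierCoeff_eq_intervalIntegral F m 0, fcoef, zero_add]
    congr 1
    apply intervalIntegral.integral_congr
    intro x _
    simp only [hco, fourier_coe_apply, smul_eq_mul, hg]
    congr 2
    push_cast
    field_simp
  have h1 := has_pointwise_sum_fourier_series_of_summable (f := F) (by rw [hcoef]; exact hs) (θ : AddCircle (2 * Real.pi))
  rw [hcoef, hco] at h1
  convert h1 using 1
  funext m
  rw [fourier_coe_apply, smul_eq_mul]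
  congr 2
  push_cast
  field_simp

lemma fcoef_neg (f : ℂ → ℂ) (m : ℤ) : fcoef f (-m) = fcoef f m := by
  unfold fcoef
  congr 1
  have h := intervalIntegral.integral_comp_sub_left (a := 0) (b := 2 * Real.pi)
    (fun θ : ℝ => cexp (-(((-m : ℤ):ℂ) * θ * I)) * f (Real.cos θ)) (2 * Real.pi)
  simp only [sub_zero, sub_self] at h
  rw [← h]
  apply intervalIntegral.integral_congr
  intro x _
  simp only [Real.cos_two_pi_sub]
  congr 1
  have : -(((-m : ℤ):ℂ) * ((2 * Real.pi - x : ℝ) : ℂ) * I) = -(m * x * I) + m * (2 * Real.pi * I) := by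
    push_cast; ring
  rw [this, Complex.exp_add, Complex.exp_int_mul_two_pi_mul_I, mul_one]

lemma fcoef_conj (f : ℂ → ℂ) (hr : ∀ x ∈ Icc (-1:ℝ) 1, (f (x:ℂ)).im = 0) (m : ℤ) :
    (starRingEnd ℂ) (fcoef f m) = fcoef f (-m) := by
  unfold fcoef
  rw [Complex.real_smul, Complex.real_smul, map_mul, Complex.conj_ofReal]
  congr 1
  rw [intervalIntegral.integral_of_le Real.two_pi_pos.le, intervalIntegral.integral_of_le Real.two_pi_pos.le,
    ← integral_conj]
  congr 1
  funext x
  rw [map_mul, ← Complex.exp_conj]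
  congr 1
  · congr 1; simp
  · exact Complex.conj_eq_iff_im.2 (hr _ ⟨Real.neg_one_le_cos x, Real.cos_le_one x⟩)

lemma fcoef_im (f : ℂ → ℂ) (hr : ∀ x ∈ Icc (-1:ℝ) 1, (f (x:ℂ)).im = 0) (m : ℤ) :
    fcoef f m = ((fcoef f m).re : ℂ) := by
  have := (fcoef_conj f hr m).trans (fcoef_neg f m)
  exact (Complex.conj_eq_iff_re.1 this).symm

lemma cos_mem_seg (θ : ℝ) : ((Real.cos θ : ℝ) : ℂ) ∈ Complex.ofReal '' Set.Icc (-1) 1 :=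
  ⟨_, ⟨Real.neg_one_le_cos θ, Real.cos_le_one θ⟩, rfl⟩

lemma fcoef_decay {U : Set ℂ} (hU : IsOpen U) (hseg : Complex.ofReal '' Set.Icc (-1) 1 ⊆ U) (f : ℂ → ℂ)
    (hf : DifferentiableOn ℂ f U) : ∃ ρ C : ℝ, 0 < ρ ∧ ρ < 1 ∧ 0 < C ∧ ∀ m : ℕ, ‖fcoef f m‖ ≤ C * ρ ^ m := by
  -- annulus
  set Z : ℂ → ℂ := fun z => (z + z⁻¹)/2 with hZ
  have hcirc : ∀ (r θ : ℝ), 0 < r → Z (r * cexp (θ * I)) = (r * cexp (θ * I) + r⁻¹ * cexp (-(θ * I)))/2 := by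
    intro r θ hr
    simp only [hZ, mul_inv, Complex.exp_neg, Complex.ofReal_inv]
  have hev : ∀ᶠ r : ℝ in nhds 1, ∀ θ ∈ Icc (-Real.pi) Real.pi,
      ((r:ℂ) * cexp (θ * I) + (r:ℂ)⁻¹ * cexp (-(θ * I)))/2 ∈ U := by
    refine isCompact_Icc.eventually_forall_of_forall_eventually ?_
    intro θ _
    have hc : ContinuousAt (fun p : ℝ × ℝ => ((p.1:ℂ) * cexp (p.2 * I) + (p.1:ℂ)⁻¹ * cexp (-(p.2 * I)))/2) ((1:ℝ), θ) := by
      have : ContinuousAt (fun p : ℝ × ℝ => (p.1:ℂ)⁻¹) ((1:ℝ), θ) :=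
        ContinuousAt.inv₀ (by fun_prop) (by simp)
      fun_prop
    apply hc.eventually_mem
    apply hU.mem_nhds
    apply hseg
    convert cos_mem_seg θ using 1
    simp only [Complex.ofReal_one, one_mul, inv_one, Complex.ofReal_cos, Complex.cos]
    ring_nf
  obtain ⟨ε, hε, hball⟩ := Metric.eventually_nhds_iff.1 hev
  set R := 1 + ε/2 with hR
  have hR1 : 1 < R := by linarith
  have hR0 : 0 < R := by linarith
  have hann : ∀ z : ℂ, 1 ≤ ‖z‖ → ‖z‖ ≤ R → Z z ∈ U := by
    intro z h1 h2
    have h3 := hball (y := ‖z‖) (by rw [Real.dist_eq, abs_lt]; constructor <;> linarith) (arg z)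
      ⟨(Complex.neg_pi_lt_arg z).le, Complex.arg_le_pi z⟩
    have h4 := hcirc ‖z‖ (arg z) (by linarith)
    rw [Complex.norm_mul_exp_arg_mul_I] at h4
    rw [Complex.norm_mul_exp_arg_mul_I] at h3
    rw [h4]
    push_cast
    exact h3
  have hZd : ∀ z : ℂ, z ≠ 0 → DifferentiableAt ℂ Z z := by
    intro z hz
    exact (differentiableAt_id.add (differentiableAt_inv hz)).div_const 2
  have hn0 : ∀ z : ℂ, 1 ≤ ‖z‖ → z ≠ 0 := by
    rintro z h rfl; simp at h; linarith
  have hfd : ∀ z : ℂ, 1 ≤ ‖z‖ → ‖z‖ ≤ R → DifferentiableAt ℂ (fun z => f (Z z)) z := by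
    intro z h1 h2
    exact ((hf.differentiableAt (hU.mem_nhds (hann z h1 h2))).comp z (hZd z (hn0 z h1)))
  obtain ⟨M, hM⟩ : ∃ M, ∀ z ∈ Metric.sphere (0:ℂ) R, ‖f (Z z)‖ ≤ M := by
    apply (isCompact_sphere (0:ℂ) R).exists_bound_of_continuousOn
    intro z hz
    have hz : ‖z‖ = R := by simpa using hz
    exact (hfd z (by linarith) (by linarith)).continuousAt.continuousWithinAt
  refine ⟨R⁻¹, |M| + 1, by positivity, inv_lt_one_of_one_lt₀ hR1, by positivity, fun m => ?_⟩
  have key := Complex.circleIntegral_sub_center_inv_smul_eq_of_differentiable_on_annulus_off_countable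
    (c := 0) (r := 1) (R := R) one_pos hR1.le (f := fun z => f (Z z) * (z^m)⁻¹) (s := ∅) countable_empty (by
      intro z hz
      have h1 : ‖z‖ ≤ R := by simpa using hz.1
      have h2 : 1 ≤ ‖z‖ := by simpa using hz.2
      exact ((hfd z h2 h1).mul ((differentiableAt_pow m).inv (pow_ne_zero m (hn0 z h2)))).continuousAt.continuousWithinAt) (by
      intro z hz
      have h1 : ‖z‖ < R := by simpa using hz.1.1
      have h2 : 1 < ‖z‖ := by simpa using hz.1.2
      exact ((hfd z h2.le h1.le).mul ((differentiableAt_pow m).inv (pow_ne_zero m (hn0 z h2.le)))))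
  have hone : (∮ z in C((0:ℂ), 1), (z - 0)⁻¹ • (f (Z z) * (z^m)⁻¹)) = I * ((2 * Real.pi : ℝ) * fcoef f m) := by
    unfold fcoef
    rw [Complex.real_smul, ← mul_assoc ((2 * Real.pi : ℝ):ℂ), ← Complex.ofReal_mul, mul_one_div_cancel Real.two_pi_pos.ne',
      Complex.ofReal_one, one_mul, ← intervalIntegral.integral_const_mul]
    unfold circleIntegral
    apply intervalIntegral.integral_congr
    intro x _
    simp only [deriv_circleMap, circleMap, Complex.ofReal_one, one_mul, zero_add, sub_zero, smul_eq_mul]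
    have h1 := hcirc 1 x one_pos
    have e2 : Z (cexp (x * I)) = ((Real.cos x : ℝ):ℂ) := by
      simp only [hZ, ← Complex.exp_neg, Complex.ofReal_cos, Complex.cos]; ring_nf
    have e3 : cexp (-((m:ℤ) * x * I)) = (cexp (x * I)^m)⁻¹ := by
      rw [Complex.exp_neg, ← Complex.exp_nat_mul]; congr 2; push_cast; ring
    rw [e2, e3]
    have := Complex.exp_ne_zero (x * I)
    field_simp
  have hbd : ‖∮ z in C((0:ℂ), R), (z - 0)⁻¹ • (f (Z z) * (z^m)⁻¹)‖ ≤ 2 * Real.pi * R * (R⁻¹ * (|M| * (R^m)⁻¹)) := by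
    apply circleIntegral.norm_integral_le_of_norm_le_const hR0.le
    intro z hz
    have h2 := hM z hz
    have hz : ‖z‖ = R := by simpa using hz
    rw [sub_zero, norm_smul, norm_inv, norm_mul, norm_inv, norm_pow, hz]
    gcongr
    exact h2.trans (le_abs_self M)
  rw [key, hone] at hbd
  rw [norm_mul, norm_mul, Complex.norm_I, one_mul, Complex.norm_real, Real.norm_eq_abs, abs_of_pos Real.two_pi_pos] at hbd
  have e : 2 * Real.pi * R * (R⁻¹ * (|M| * (R^m)⁻¹)) = 2 * Real.pi * (|M| * (R⁻¹)^m) := by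
    rw [inv_pow]; field_simp
  rw [e] at hbd
  have := le_of_mul_le_mul_left hbd Real.two_pi_pos
  refine this.trans ?_
  gcongr
  linarith

lemma summable_nat_geom {ρ : ℝ} (h0 : 0 < ρ) (h1 : ρ < 1) (p : ℕ) :
    Summable (fun m : ℕ => (1 + (m:ℝ))^p * ρ ^ m) := by
  have h := summable_pow_mul_geometric_of_norm_lt_one (R := ℝ) (r := ρ) p (by rw [Real.norm_eq_abs, abs_of_pos h0]; exact h1)
  have h2 := ((summable_nat_add_iff 1).2 h).mul_left ρ⁻¹
  refine h2.congr (fun m => ?_)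
  push_cast
  field_simp
  ring

lemma summable_int_geom {ρ : ℝ} (h0 : 0 < ρ) (h1 : ρ < 1) (p : ℕ) :
    Summable (fun m : ℤ => (1 + (m.natAbs:ℝ))^p * ρ ^ m.natAbs) := by
  refine Summable.of_nat_of_neg ?_ ?_
  · simpa using summable_nat_geom h0 h1 p
  · simpa using summable_nat_geom h0 h1 p

lemma cheb_expand {U : Set ℂ} (hU : IsOpen U) (hseg : Complex.ofReal '' Set.Icc (-1) 1 ⊆ U) (f : ℂ → ℂ)
    (hf : DifferentiableOn ℂ f U) (hr : ∀ x ∈ Icc (-1:ℝ) 1, (f (x:ℂ)).im = 0) :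
    ∃ (a : ℤ → ℝ) (ρ C : ℝ), 0 < ρ ∧ ρ < 1 ∧ 0 < C ∧ (∀ m, a (-m) = a m) ∧ (∀ m, |a m| ≤ C * ρ ^ m.natAbs) ∧
      (∀ m, ((a m : ℝ) : ℂ) = fcoef f m) ∧
      ∀ θ : ℝ, HasSum (fun m : ℤ => (a m : ℂ) * cexp (m * θ * I)) (f (Real.cos θ)) := by
  obtain ⟨ρ, C, h0, h1, hC, hd⟩ := fcoef_decay hU hseg f hf
  have ha : ∀ m, |(fcoef f m).re| ≤ C * ρ ^ m.natAbs := by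
    intro m
    refine (Complex.abs_re_le_norm _).trans ?_
    rcases Int.natAbs_eq m with h | h
    · conv_lhs => rw [h]
      exact hd _
    · conv_lhs => rw [h, fcoef_neg]
      exact hd _
  have hreal : ∀ m, (((fcoef f m).re : ℝ) : ℂ) = fcoef f m := fun m => (fcoef_im f hr m).symm
  refine ⟨fun m => (fcoef f m).re, ρ, C, h0, h1, hC, fun m => by simp only [fcoef_neg], ha, hreal, fun θ => ?_⟩
  simp only [hreal]
  apply fcoef_hasSum
  · refine continuous_iff_continuousAt.2 (fun x => ?_)
    have h2 : ContinuousAt f ((Real.cos x : ℝ):ℂ) :=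
      (hf.differentiableAt (hU.mem_nhds (hseg (cos_mem_seg x)))).continuousAt
    exact ContinuousAt.comp (f := fun θ : ℝ => ((Real.cos θ : ℝ) : ℂ)) h2 (by fun_prop)
  · refine Summable.of_norm_bounded (g := fun m : ℤ => C * ((1 + (m.natAbs:ℝ))^0 * ρ ^ m.natAbs)) ((summable_int_geom h0 h1 0).mul_left C) ?_
    intro m
    rw [← hreal m, Complex.norm_real, Real.norm_eq_abs]
    simpa using ha m

lemma hs_eq {ι : Type*} {f g : ι → ℂ} {a b : ℂ} (h : HasSum f a) (e : ∀ k, g k = f k) (e2 : b = a) :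
    HasSum g b := by
  rw [e2, show g = f from funext e]; exact h

lemma real_pow_series {l : ℕ → ℝ} {ρ C : ℝ} (h0 : 0 < ρ) (hl : ∀ m, |l m| ≤ C * ρ^m) {r : ℝ}
    (hr : 0 < r) (hr1 : ρ * r < 1) :
    DifferentiableOn ℂ (fun z : ℂ => ∑' m : ℕ, (l m : ℂ) * z^m) (Metric.ball 0 r) ∧
    (∀ z ∈ Metric.ball (0:ℂ) r, Summable (fun m : ℕ => (l m : ℂ) * z^m)) ∧
    (∀ z, (∑' m : ℕ, (l m : ℂ) * ((starRingEnd ℂ) z)^m) = (starRingEnd ℂ) (∑' m : ℕ, (l m : ℂ) * z^m)) := by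
  have hC : 0 ≤ C := by
    have := hl 0
    simp at this
    exact (abs_nonneg _).trans this
  have hs : Summable (fun m : ℕ => C * (ρ * r)^m) :=
    (summable_geometric_of_lt_one (by positivity) hr1).mul_left C
  have hb : ∀ (m : ℕ) (z : ℂ), z ∈ Metric.ball (0:ℂ) r → ‖(l m : ℂ) * z^m‖ ≤ C * (ρ * r)^m := by
    intro m z hz
    have hz : ‖z‖ < r := by simpa using hz
    rw [norm_mul, norm_pow, Complex.norm_real, Real.norm_eq_abs, mul_pow, ← mul_assoc]
    gcongr
    exact hl m
  refine ⟨differentiableOn_tsum_of_summable_norm hs (fun m => by fun_prop) Metric.isOpen_ball hb, ?_, ?_⟩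
  · intro z hz
    exact Summable.of_norm_bounded hs (fun m => hb m z hz)
  · intro z
    rw [Complex.conj_tsum]
    simp

lemma taylor_real {g : ℂ → ℂ} {r : ℝ} (hr : 1 < r) (hg : DifferentiableOn ℂ g (Metric.ball 0 r))
    (hconj : ∀ z, g ((starRingEnd ℂ) z) = (starRingEnd ℂ) (g z)) :
    ∃ (c : ℕ → ℝ) (ρ C : ℝ), 0 < ρ ∧ ρ < 1 ∧ 0 < C ∧ (∀ k, |c k| ≤ C * ρ^k) ∧ c 0 = (g 0).re ∧
      ∀ z : ℂ, ‖z‖ ≤ 1 → HasSum (fun k : ℕ => (c k : ℂ) * z^k) (g z) := by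
  obtain ⟨s, hs1, hsr⟩ := exists_between hr
  have hs0 : 0 < s := by linarith
  have hsub : Metric.closedBall (0:ℂ) s ⊆ Metric.ball 0 r := Metric.closedBall_subset_ball hsr
  have hdc : DiffContOnCl ℂ g (Metric.ball 0 s) := by
    apply DifferentiableOn.diffContOnCl
    apply hg.mono
    exact (Metric.closure_ball_subset_closedBall).trans hsub
  obtain ⟨M, hM⟩ : ∃ M, ∀ z ∈ Metric.sphere (0:ℂ) s, ‖g z‖ ≤ M := by
    apply (isCompact_sphere (0:ℂ) s).exists_bound_of_continuousOn
    exact hg.continuousOn.mono (Metric.sphere_subset_closedBall.trans hsub)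
  set cc : ℕ → ℂ := fun k => (k.factorial : ℂ)⁻¹ * iteratedDeriv k g 0 with hcc
  have hsum : ∀ z : ℂ, ‖z‖ ≤ 1 → HasSum (fun k : ℕ => cc k * z^k) (g z) := by
    intro z hz
    have h := Complex.hasSum_taylorSeries_on_ball (c := 0) (r := r) (f := g) hg
      (z := z) (by
        simp only [Metric.mem_ball, dist_zero_right]
        exact lt_of_le_of_lt hz hr)
    refine hs_eq h (fun k => ?_) rfl
    simp only [hcc, sub_zero, smul_eq_mul]
    ring
  refine ⟨fun k => (cc k).re, s⁻¹, |M| + 1, by positivity, inv_lt_one_of_one_lt₀ hs1, by positivity, ?_, ?_, ?_⟩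
  · intro k
    refine (Complex.abs_re_le_norm _).trans ?_
    have h1 := Complex.norm_iteratedDeriv_le_of_forall_mem_sphere_norm_le k hs0 hdc hM
    simp only [hcc, norm_mul, norm_inv, Complex.norm_natCast]
    have hk : (0:ℝ) < k.factorial := by exact_mod_cast Nat.factorial_pos k
    rw [inv_mul_le_iff₀ hk]
    refine h1.trans ?_
    rw [inv_pow, mul_div_assoc, div_eq_mul_inv]
    gcongr
    linarith [le_abs_self M]
  · simp [hcc]
  · intro z hz
    have h1 := hsum z hz
    have h2 := hsum ((starRingEnd ℂ) z) (by simpa using hz)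
    rw [hconj] at h2
    have h3 : HasSum (fun k : ℕ => (starRingEnd ℂ) (cc k) * z^k) (g z) := by
      have := Complex.hasSum_conj'.2 h2 
      simpa using this
    have h4 := (h1.add h3).mul_left (1/2)
    refine hs_eq h4 (fun k => ?_) ?_
    · 
      have : ((cc k).re : ℂ) = 1/2 * (cc k + (starRingEnd ℂ) (cc k)) := by
        rw [Complex.add_conj]; push_cast; ring
      rw [this]; ring
    · ring

lemma conv_zero {h d g : ℂ → ℂ} {c : ℕ → ℝ} {ρ C r : ℝ} (h0 : 0 < ρ) (h1 : ρ < 1) (hr : 1 < r)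
    (hc : ∀ k, |c k| ≤ C * ρ^k)
    (hcont : Continuous (fun θ : ℝ => h (Real.cos θ)))
    (hd : DifferentiableOn ℂ d (Metric.ball 0 r))
    (hg : ∀ z : ℂ, ‖z‖ ≤ 1 → HasSum (fun k : ℕ => (c k : ℂ) * z^k) (g z))
    (hgd : ∀ θ : ℝ, h (Real.cos θ) * g (cexp (-(θ * I))) = d (cexp (θ * I)))
    (l : ℕ) (hl : 1 ≤ l) : HasSum (fun k : ℕ => fcoef h ((k:ℤ) - l) * c k) 0 := by
  have hcirc : (∮ z in C((0:ℂ), 1), d z * z^(l-1)) = 0 := by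
    apply DiffContOnCl.circleIntegral_eq_zero zero_le_one
    apply DifferentiableOn.diffContOnCl
    have hsub : closure (Metric.ball (0:ℂ) 1) ⊆ Metric.ball 0 r :=
      Metric.closure_ball_subset_closedBall.trans (Metric.closedBall_subset_ball hr)
    exact (hd.mono hsub).mul (by fun_prop)
  have hintg : (∫ θ in (0:ℝ)..(2*Real.pi), h (Real.cos θ) * g (cexp (-(θ * I))) * cexp (l * θ * I)) = 0 := by
    have e : (∮ z in C((0:ℂ), 1), d z * z^(l-1)) =
        I * ∫ θ in (0:ℝ)..(2*Real.pi), h (Real.cos θ) * g (cexp (-(θ * I))) * cexp (l * θ * I) := by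
      rw [← intervalIntegral.integral_const_mul]
      unfold circleIntegral
      apply intervalIntegral.integral_congr
      intro x _
      simp only [deriv_circleMap, circleMap, Complex.ofReal_one, one_mul, zero_add, smul_eq_mul]
      rw [hgd x]
      obtain ⟨m, rfl⟩ : ∃ m, l = m + 1 := ⟨l - 1, by omega⟩
      have : cexp (((m+1:ℕ):ℂ) * x * I) = cexp (x * I) ^ (m+1) := by
        rw [← Complex.exp_nat_mul]; congr 1; ring
      rw [this, Nat.add_sub_cancel]
      ring
    rw [e] at hcirc
    exact (mul_eq_zero.1 hcirc).resolve_left Complex.I_ne_zero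
  obtain ⟨B, hB⟩ : ∃ B, ∀ θ : ℝ, ‖h (Real.cos θ)‖ ≤ B := by
    obtain ⟨B, hB⟩ := (isCompact_Icc (a := (0:ℝ)) (b := 2*Real.pi)).exists_bound_of_continuousOn hcont.continuousOn
    refine ⟨B, fun θ => ?_⟩
    have hper : Function.Periodic (fun θ : ℝ => h (Real.cos θ)) (2 * Real.pi) := by
      intro x; simp only [Real.cos_add_two_pi]
    obtain ⟨y, hy, hxy⟩ := hper.exists_mem_Ico₀ Real.two_pi_pos θ
    rw [show h (Real.cos θ) = h (Real.cos y) from hxy]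
    exact hB y (Ico_subset_Icc_self hy)
  have hC : 0 ≤ C := by
    have := hc 0
    simp at this
    exact (abs_nonneg _).trans this
  have hB0 : 0 ≤ B := (norm_nonneg _).trans (hB 0)
  have hsum := intervalIntegral.hasSum_integral_of_dominated_convergence (μ := volume) (a := 0) (b := 2 * Real.pi)
    (F := fun (k:ℕ) (θ:ℝ) => h (Real.cos θ) * ((c k : ℂ) * (cexp (-(θ * I)))^k) * cexp (l * θ * I))
    (f := fun θ : ℝ => h (Real.cos θ) * g (cexp (-(θ * I))) * cexp (l * θ * I))
    (fun k _ => B * (C * ρ^k))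
    (fun k => by
      apply Continuous.aestronglyMeasurable
      exact (hcont.mul (by fun_prop)).mul (by fun_prop))
    (fun k => by
      refine Eventually.of_forall (fun θ _ => ?_)
      have e1 : ‖cexp (-(θ * I))‖ = 1 := by
        rw [← neg_mul, ← Complex.ofReal_neg, Complex.norm_exp_ofReal_mul_I]
      have e2 : ‖cexp (l * θ * I)‖ = 1 := by
        rw [← Complex.ofReal_natCast, ← Complex.ofReal_mul, Complex.norm_exp_ofReal_mul_I]
      rw [norm_mul, norm_mul, norm_mul, norm_pow, e1, e2, one_pow, mul_one, mul_one, Complex.norm_real, Real.norm_eq_abs]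
      gcongr
      · exact hB θ
      · exact hc k)
    (by
      refine Eventually.of_forall (fun θ _ => ?_)
      exact ((summable_geometric_of_lt_one h0.le h1).mul_left C).mul_left B)
    (by simp)
    (by
      refine Eventually.of_forall (fun θ _ => ?_)
      have e1 : ‖cexp (-(θ * I))‖ = 1 := by
        rw [← neg_mul, ← Complex.ofReal_neg, Complex.norm_exp_ofReal_mul_I]
      exact ((hg _ e1.le).mul_left _).mul_right _)
  rw [hintg] at hsum
  have h2 := hsum.mul_left (((1 / (2 * Real.pi) : ℝ)) : ℂ)
  rw [mul_zero] at h2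
  refine hs_eq h2 (fun k => ?_) rfl
  unfold fcoef
  rw [Complex.real_smul, mul_assoc, ← intervalIntegral.integral_mul_const]
  congr 1
  apply intervalIntegral.integral_congr
  intro θ _
  simp only
  have : cexp (-((((k:ℤ) - l : ℤ) : ℂ) * θ * I)) = cexp (-(θ * I))^k * cexp (l * θ * I) := by
    rw [← Complex.exp_nat_mul, ← Complex.exp_add]; congr 1; push_cast; ring
  rw [this]; ring


lemma szego_pkg {U : Set ℂ} (hU : IsOpen U) (hseg : Complex.ofReal '' Set.Icc (-1) 1 ⊆ U)
    (h : ℂ → ℂ) (hh : DifferentiableOn ℂ h U) (hhre : ∀ z ∈ U, 0 < (h z).re)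
    (hhreal : ∀ x ∈ Set.Icc (-1:ℝ) 1, (h (x:ℂ)).im = 0) :
    ∃ (a : ℤ → ℝ) (c : ℕ → ℝ) (l : ℤ → ℝ) (S : ℝ → ℝ) (ρ C : ℝ), 0 < ρ ∧ ρ < 1 ∧ 0 < C ∧
      (∀ m, a (-m) = a m) ∧ (∀ m, |a m| ≤ C * ρ^m.natAbs) ∧ (∀ k, |c k| ≤ C * ρ^k) ∧
      (∀ m, l (-m) = l m) ∧ (∀ m, |l m| ≤ C * ρ^m.natAbs) ∧ c 0 = Real.exp (-(l 0 / 2)) ∧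
      (∀ θ : ℝ, HasSum (fun m : ℤ => (a m : ℂ) * cexp (m * θ * I)) (h (Real.cos θ))) ∧
      (∀ θ : ℝ, HasSum (fun m : ℤ => (l m : ℂ) * cexp (m * θ * I)) (Real.log (h (Real.cos θ)).re : ℝ)) ∧
      (∀ θ : ℝ, HasSum (fun m : ℕ => l m * Real.sin (m * θ)) (S θ)) ∧
      (∀ θ : ℝ, HasSum (fun k : ℕ => (c k : ℂ) * cexp (θ * I)^k)
        (cexp (-((1/2 * Real.log (h (Real.cos θ)).re : ℝ) + (S θ : ℝ) * I)))) ∧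
      (∀ j : ℕ, 1 ≤ j → HasSum (fun k : ℕ => a ((k:ℤ) - j) * c k) 0) := by
  obtain ⟨a, ρa, Ca, ha0, ha1, hCa, has, hab, haf, hasum⟩ := cheb_expand hU hseg h hh hhreal
  have hlog : DifferentiableOn ℂ (fun z => Complex.log (h z)) U := by
    intro z hz
    exact (hh z hz).clog (Or.inl (hhre z hz))
  have hhR : ∀ x ∈ Set.Icc (-1:ℝ) 1, h (x:ℂ) = (((h (x:ℂ)).re : ℝ) : ℂ) := by
    intro x hx
    apply Complex.ext <;> simp [hhreal x hx]
  have hpos : ∀ x ∈ Set.Icc (-1:ℝ) 1, 0 < (h (x:ℂ)).re := fun x hx => hhre _ (hseg ⟨x, hx, rfl⟩)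
  have hlogR : ∀ x ∈ Set.Icc (-1:ℝ) 1, Complex.log (h (x:ℂ)) = (Real.log (h (x:ℂ)).re : ℝ) := by
    intro x hx
    conv_lhs => rw [hhR x hx]
    rw [Complex.ofReal_log (hpos x hx).le]
  obtain ⟨l, ρl, Cl, hl0, hl1, hCl, hls, hlb, hlf, hlsum⟩ := cheb_expand hU hseg _ hlog (by
    intro x hx
    rw [hlogR x hx]; exact Complex.ofReal_im _)
  have hcosI : ∀ θ : ℝ, Real.cos θ ∈ Set.Icc (-1:ℝ) 1 := fun θ => ⟨Real.neg_one_le_cos θ, Real.cos_le_one θ⟩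
  set b : ℕ → ℝ := fun m => if m = 0 then l 0 / 2 else l m with hb
  have hbb : ∀ m, |b m| ≤ Cl * ρl^m := by
    intro m
    by_cases hm : m = 0
    · subst hm
      simp only [hb, if_true, pow_zero, mul_one, abs_div]
      have := hlb 0
      simp at this
      rw [abs_of_pos (by norm_num : (0:ℝ) < 2)]
      linarith [abs_nonneg (l 0)]
    · simp only [hb, hm, if_false]
      simpa using hlb m
  obtain ⟨r, hr1, hr2⟩ := exists_between (one_lt_inv_iff₀.2 ⟨hl0, hl1⟩)
  have hr0 : 0 < r := by linarith
  have hρr : ρl * r < 1 := by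
    rw [lt_inv_comm₀ hr0 hl0] at hr2
    calc ρl * r < r⁻¹ * r := by gcongr
      _ = 1 := inv_mul_cancel₀ hr0.ne'
  obtain ⟨hLd, hLs, hLc⟩ := real_pow_series hl0 hbb hr0 hρr
  set L : ℂ → ℂ := fun z => ∑' m : ℕ, (b m : ℂ) * z^m with hL
  have hLh : ∀ z ∈ Metric.ball (0:ℂ) r, HasSum (fun m : ℕ => (b m : ℂ) * z^m) (L z) :=
    fun z hz => (hLs z hz).hasSum
  have hball : ∀ z : ℂ, ‖z‖ ≤ 1 → z ∈ Metric.ball (0:ℂ) r := fun z hz => by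
    simpa using lt_of_le_of_lt hz hr1
  have hgconj : ∀ z, cexp (-L ((starRingEnd ℂ) z)) = (starRingEnd ℂ) (cexp (-L z)) := by
    intro z
    rw [← Complex.exp_conj, map_neg]
    congr 2
    exact hLc z
  obtain ⟨c, ρc, Cc, hc0, hc1, hCc, hcb, hcz, hcsum⟩ := taylor_real (g := fun z => cexp (-L z)) hr1
    hLd.neg.cexp hgconj
  have hL0 : L 0 = (l 0 / 2 : ℝ) := by
    have h1 := hLh 0 (hball 0 (by simp))
    have h2 : HasSum (fun m : ℕ => (b m : ℂ) * 0^m) ((b 0 : ℂ) * 0^0) :=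
      hasSum_single 0 (fun m hm => by simp [hm])
    rw [h1.unique h2]
    simp [hb]
  have hn1 : ∀ θ : ℝ, ‖cexp (θ * I)‖ = 1 := fun θ => Complex.norm_exp_ofReal_mul_I θ
  have hcj : ∀ θ : ℝ, (starRingEnd ℂ) (cexp (θ * I)) = cexp (-(θ * I)) := by
    intro θ
    rw [← Complex.exp_conj]; simp
  have hLL : ∀ θ : ℝ, L (cexp (θ * I)) + L (cexp (-(θ * I))) = (Real.log (h (Real.cos θ)).re : ℝ) := by
    intro θ
    have h1 := hLh _ (hball _ (hn1 θ).le)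
    have h2 := hLh (cexp (-(θ * I))) (hball _ (by rw [← hcj, Complex.norm_conj, hn1]))
    have h3 := (h1.add h2)
    have h4 := (hlsum θ).nat_add_neg
    have h5 : HasSum (fun m : ℕ => if m = 0 then (l 0 : ℂ) else 0) (l 0 : ℂ) := by
      have := hasSum_single (f := fun m : ℕ => if m = 0 then (l 0 : ℂ) else 0) 0 (fun m hm => by simp [hm])
      simpa using this
    have h6 := h4.sub h5
    have h7 := hs_eq h6 (g := fun m : ℕ => (b m : ℂ) * cexp (θ * I)^m + (b m : ℂ) * cexp (-(θ * I))^m)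
      (b := Complex.log (h (Real.cos θ))) (fun m => by
        have e1 : cexp (((m:ℤ):ℂ) * θ * I) = cexp (θ * I)^m := by
          rw [← Complex.exp_nat_mul]; congr 1; push_cast; ring
        have e2 : cexp (((-(m:ℤ) : ℤ):ℂ) * θ * I) = cexp (-(θ * I))^m := by
          rw [← Complex.exp_nat_mul]; congr 1; push_cast; ring
        rw [e1, e2, hls]
        by_cases hm : m = 0
        · subst hm; simp [hb]
        · simp [hb, hm]) (by simp)
    rw [h3.unique h7]
    exact hlogR _ (hcosI θ)
  have hLre : ∀ θ : ℝ, (L (cexp (θ * I))).re = 1/2 * Real.log (h (Real.cos θ)).re := by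
    intro θ
    have h1 := hLL θ
    rw [← hcj, show L ((starRingEnd ℂ) (cexp (θ * I))) = (starRingEnd ℂ) (L (cexp (θ * I))) from hLc _,
      Complex.add_conj] at h1
    have := congrArg Complex.re h1
    simp only [Complex.ofReal_re] at this
    linarith
  have hdec : ∀ {x ρ' C' : ℝ} {k : ℕ}, 0 < ρ' → 0 < C' → |x| ≤ C' * ρ'^k → ρ' ≤ max ρa (max ρl ρc) →
      C' ≤ max Ca (max Cl Cc) → |x| ≤ max Ca (max Cl Cc) * (max ρa (max ρl ρc))^k := by
    intro x ρ' C' k h1 h2 h3 h4 h5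
    refine h3.trans ?_
    gcongr
  refine ⟨a, c, l, fun θ => (L (cexp (θ * I))).im, max ρa (max ρl ρc), max Ca (max Cl Cc),
    lt_max_of_lt_left ha0, max_lt ha1 (max_lt hl1 hc1), lt_max_of_lt_left hCa, has, ?_, ?_, hls, ?_, ?_, hasum,
    ?_, ?_, ?_, ?_⟩
  · intro m
    exact hdec ha0 hCa (hab m) (le_max_left _ _) (le_max_left _ _)
  · intro m
    exact hdec hc0 hCc (hcb m) ((le_max_right _ _).trans (le_max_right _ _)) ((le_max_right _ _).trans (le_max_right _ _))
  · intro m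
    exact hdec hl0 hCl (hlb m) ((le_max_left _ _).trans (le_max_right _ _)) ((le_max_left _ _).trans (le_max_right _ _))
  · rw [hcz]
    simp only [hL0]
    rw [← Complex.ofReal_neg, ← Complex.ofReal_exp, Complex.ofReal_re]
  · intro θ
    rw [← hlogR _ (hcosI θ)]
    exact hlsum θ
  · intro θ
    have h1 := Complex.hasSum_im (hLh _ (hball _ (hn1 θ).le))
    have e : (fun m : ℕ => l m * Real.sin (m * θ)) = fun m : ℕ => ((b m : ℂ) * cexp (θ * I)^m).im := by
      funext m
      rw [← Complex.exp_nat_mul, Complex.im_ofReal_mul,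
        show ((m:ℕ):ℂ) * (θ * I) = ((m * θ : ℝ) : ℂ) * I by push_cast; ring, Complex.exp_ofReal_mul_I_im]
      by_cases hm : m = 0
      · subst hm; simp
      · simp [hb, hm]
    rw [e]; exact h1
  · intro θ
    have h1 := hcsum _ (hn1 θ).le
    rw [← hLre θ, Complex.re_add_im]
    exact h1
  · intro j hj
    have h1 := conv_zero (h := h) (d := fun z => cexp (L z)) (g := fun z => cexp (-L z)) hc0 hc1 hr1 hcb
      (by
        refine hh.continuousOn.comp_continuous (by fun_prop) (fun θ => hseg ⟨_, hcosI θ, rfl⟩))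
      hLd.cexp hcsum (by
        intro θ
        have e1 : h (Real.cos θ) = cexp (L (cexp (θ * I)) + L (cexp (-(θ * I)))) := by
          rw [hLL θ, ← hlogR _ (hcosI θ), Complex.exp_log]
          intro h0
          have := hpos _ (hcosI θ)
          rw [h0] at this
          simp at this
        rw [e1, ← Complex.exp_add]
        congr 1; ring) j hj
    have h2 := Complex.hasSum_re h1
    have e : (fun k : ℕ => a ((k:ℤ) - j) * c k) = fun k : ℕ => (fcoef h ((k:ℤ) - j) * (c k : ℂ)).re := by
      funext k
      rw [← haf, ← Complex.ofReal_mul, Complex.ofReal_re]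
    rw [e]; simpa using h2

section
open Polynomial

lemma cheb_real_sum {a : ℤ → ℝ} {h : ℂ → ℂ}
    (hsum : ∀ θ : ℝ, HasSum (fun m : ℤ => (a m : ℂ) * cexp (m * θ * I)) (h (Real.cos θ)))
    {x : ℝ} (hx : x ∈ Icc (-1:ℝ) 1) :
    HasSum (fun m : ℤ => a m * (Polynomial.Chebyshev.T ℝ m).eval x) (h (x:ℂ)).re := by
  have h1 := Complex.hasSum_re (hsum (Real.arccos x))
  rw [Real.cos_arccos hx.1 hx.2] at h1
  have e : (fun m : ℤ => a m * (Polynomial.Chebyshev.T ℝ m).eval x) =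
      fun m : ℤ => ((a m : ℂ) * cexp (m * (Real.arccos x) * I)).re := by
    funext m
    rw [Complex.re_ofReal_mul, show ((m:ℤ):ℂ) * (Real.arccos x : ℂ) * I = ((m * Real.arccos x : ℝ) : ℂ) * I by
      push_cast; ring, Complex.exp_ofReal_mul_I_re]
    conv_lhs => rw [← Real.cos_arccos hx.1 hx.2, Polynomial.Chebyshev.T_real_cos]
  rw [e]; exact h1

variable {α β : ℝ} (hα : -1 < α) (hβ : -1 < β)

lemma cheb_int_sum {a : ℤ → ℝ} {h : ℂ → ℂ} {ρ C : ℝ} (h0 : 0 < ρ) (h1 : ρ < 1)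
    (ha : ∀ m, |a m| ≤ C * ρ^m.natAbs)
    (hsum : ∀ θ : ℝ, HasSum (fun m : ℤ => (a m : ℂ) * cexp (m * θ * I)) (h (Real.cos θ)))
    (p : ℝ[X]) :
    HasSum (fun m : ℤ => a m * jI hα hβ (Polynomial.Chebyshev.T ℝ m * p))
      (∫ x, (h (x:ℂ)).re * p.eval x ∂(jmu α β)) := by
  have hs : Summable (fun m : ℤ => C * ρ^m.natAbs) := by
    simpa using (summable_int_geom h0 h1 0).mul_left C
  have := hasSum_integral_of_dominated_convergence (μ := jmu α β)
    (F := fun (m:ℤ) (x:ℝ) => a m * (Polynomial.Chebyshev.T ℝ m * p).eval x)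
    (f := fun x : ℝ => (h (x:ℂ)).re * p.eval x)
    (fun m x => C * ρ^m.natAbs * |p.eval x|)
    (fun m => by
      apply Continuous.aestronglyMeasurable
      fun_prop)
    (fun m => by
      filter_upwards [jmu_ae α β] with x hx
      rw [Real.norm_eq_abs, abs_mul, eval_mul, abs_mul, ← mul_assoc]
      have e1 : |(Polynomial.Chebyshev.T ℝ m).eval x| ≤ 1 :=
        Polynomial.Chebyshev.abs_eval_T_real_le_one m (abs_le.2 ⟨hx.1.le, hx.2.le⟩)
      have e2 := ha m
      refine mul_le_mul_of_nonneg_right ?_ (abs_nonneg _)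
      calc |a m| * |(Polynomial.Chebyshev.T ℝ m).eval x| ≤ |a m| * 1 := by gcongr
        _ ≤ _ := by rw [mul_one]; exact e2)
    (Eventually.of_forall (fun x => hs.mul_right _))
    (by
      have : (fun x : ℝ => ∑' m : ℤ, C * ρ^m.natAbs * |p.eval x|) = fun x : ℝ => (∑' m : ℤ, C * ρ^m.natAbs) * |p.eval x| := by
        funext x; rw [tsum_mul_right]
      rw [this]
      apply jmu_integrable hα hβ
      fun_prop)
    (by
      filter_upwards [jmu_ae α β] with x hx
      have := (cheb_real_sum hsum (Ioo_subset_Icc_self hx)).mul_right (p.eval x)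
      simpa only [eval_mul, mul_assoc] using this)
  have e : (fun m : ℤ => a m * jI hα hβ (Polynomial.Chebyshev.T ℝ m * p)) =
      fun m : ℤ => ∫ x, a m * (Polynomial.Chebyshev.T ℝ m * p).eval x ∂(jmu α β) := by
    funext m
    rw [integral_const_mul, jI_apply]
  rw [e]; exact this

lemma jqz_orth {n : ℕ} {R : ℝ[X]} (hR : R.degree < n) {z : ℤ} (hz : (n:ℤ) ≤ z) :
    jI hα hβ (jqz hα hβ z * R) = 0 := by
  obtain ⟨k, rfl⟩ : ∃ k : ℕ, z = k := ⟨z.toNat, by omega⟩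
  rw [jqz_nat]
  apply jq_orth
  refine hR.trans_le ?_
  exact_mod_cast hz

/-- The key L2 estimate. -/
lemma pert_est {a : ℤ → ℝ} {c : ℕ → ℝ} {h : ℂ → ℂ} {ρ C : ℝ} (h0 : 0 < ρ) (h1 : ρ < 1)
    (has : ∀ m, a (-m) = a m) (ha : ∀ m, |a m| ≤ C * ρ^m.natAbs) (hc : ∀ k, |c k| ≤ C * ρ^k)
    (hsum : ∀ θ : ℝ, HasSum (fun m : ℤ => (a m : ℂ) * cexp (m * θ * I)) (h (Real.cos θ)))
    (hconv : ∀ j : ℕ, 1 ≤ j → HasSum (fun k : ℕ => a ((k:ℤ) - j) * c k) 0) :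
    ∃ C' : ℝ, 0 < C' ∧ ∀ (n : ℕ) (R : ℝ[X]), 1 ≤ n → R.degree < n →
      |∫ x, (h (x:ℂ)).re * ((∑ k ∈ Finset.range (n+1), c k • jq hα hβ (n - k)) * R).eval x ∂(jmu α β)|
        ≤ C' * jN hα hβ R / n^2 := by
  obtain ⟨CT, hCT, hT⟩ := jTz_bound hα hβ
  have hC : 0 ≤ C := by
    have := hc 0
    simp at this
    exact (abs_nonneg _).trans this
  set Sa : ℝ := ∑' m : ℤ, C * ((1 + (m.natAbs:ℝ))^4 * ρ^m.natAbs) with hSa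
  have hs1 : Summable (fun m : ℤ => C * ((1 + (m.natAbs:ℝ))^4 * ρ^m.natAbs)) :=
    (summable_int_geom h0 h1 4).mul_left C
  have hSan : 0 ≤ Sa := tsum_nonneg (fun m => by positivity)
  set Sc : ℝ := ∑' k : ℕ, C * ((1 + (k:ℝ))^2 * ρ^k) with hSc
  have hs2 : Summable (fun k : ℕ => C * ((1 + (k:ℝ))^2 * ρ^k)) :=
    (summable_nat_geom h0 h1 2).mul_left C
  have hScn : 0 ≤ Sc := tsum_nonneg (fun m => by positivity)
  refine ⟨CT * Sa * Sc + 1, by positivity, ?_⟩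
  intro n R hn hR
  have hn0 : (0:ℝ) < n := by exact_mod_cast hn
  set y : ℤ → ℝ := fun l => jI hα hβ (jqz hα hβ (n - l) * R) with hy
  have hy0 : ∀ l : ℤ, l ∉ Finset.Icc (1:ℤ) n → y l = 0 := by
    intro l hl
    rw [Finset.mem_Icc, not_and_or, not_le, not_le] at hl
    rcases hl with hl | hl
    · exact jqz_orth hα hβ hR (by omega)
    · simp only [hy]
      rw [jqz_neg hα hβ (by omega)]; simp
  set W : ℕ → ℝ := fun k => ∫ x, (h (x:ℂ)).re * (jqz hα hβ ((n:ℤ) - k) * R).eval x ∂(jmu α β) with hW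
  set Y : ℕ → ℝ := fun k => ∑ l ∈ Finset.Icc (1:ℤ) n, a (k - l) * y l with hY
  have hE : ∀ k : ℕ, |W k - Y k| ≤ CT * Sa * (1 + (k:ℝ))^2 * jN hα hβ R / n^2 := by
    intro k
    have hw := cheb_int_sum hα hβ h0 h1 ha hsum (jqz hα hβ ((n:ℤ) - k) * R)
    have hy1 : HasSum (fun l : ℤ => a (k - l) * y l) (Y k) :=
      hasSum_sum_of_ne_finset_zero (fun l hl => by rw [hy0 l hl, mul_zero])
    have hy2 : HasSum (fun m : ℤ => a m * y (k - m)) (Y k) := by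
      have := ((Equiv.subLeft (k:ℤ)).hasSum_iff (f := fun l : ℤ => a (k - l) * y l)).2 hy1
      have e : (fun m : ℤ => a m * y (k - m)) = (fun l : ℤ => a (k - l) * y l) ∘ (Equiv.subLeft (k:ℤ)) := by
        funext m; simp
      rw [e]; exact this
    have hy3 : HasSum (fun m : ℤ => a m * y (k + m)) (Y k) := by
      have := ((Equiv.neg ℤ).hasSum_iff (f := fun m : ℤ => a m * y (k - m))).2 hy2
      have e : (fun m : ℤ => a m * y (k + m)) = (fun m : ℤ => a m * y (k - m)) ∘ (Equiv.neg ℤ) := by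
        funext m; simp [has]
      rw [e]; exact this
    have hd := hw.sub ((hy2.add hy3).mul_left (1/2))
    rw [show (1/2:ℝ) * (Y k + Y k) = Y k by ring] at hd
    have hbd : ∀ m : ℤ, ‖a m * jI hα hβ (Polynomial.Chebyshev.T ℝ m * (jqz hα hβ ((n:ℤ) - k) * R)) -
        1/2 * (a m * y (k - m) + a m * y (k + m))‖ ≤
        C * ((1 + (m.natAbs:ℝ))^4 * ρ^m.natAbs) * (CT * (1 + (k:ℝ))^2 * jN hα hβ R / n^2) := by
      intro m
      have e : a m * jI hα hβ (Polynomial.Chebyshev.T ℝ m * (jqz hα hβ ((n:ℤ) - k) * R)) -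
        1/2 * (a m * y (k - m) + a m * y (k + m)) = a m * jI hα hβ ((Polynomial.Chebyshev.T ℝ m * jqz hα hβ (↑n - ↑k) -
                (1 / 2 : ℝ) • (jqz hα hβ (↑n - ↑k + m) + jqz hα hβ (↑n - ↑k - m))) * R) := by
        have e1 : (n:ℤ) - (k - m) = n - k + m := by ring
        have e2 : (n:ℤ) - (k + m) = n - k - m := by ring
        simp only [hy, e1, e2]
        rw [sub_mul, map_sub, smul_mul_assoc, map_smul, add_mul, map_add, smul_eq_mul, mul_assoc]
        ring
      rw [e, Real.norm_eq_abs, abs_mul]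
      have b1 := jI_cs hα hβ (Polynomial.Chebyshev.T ℝ m * jqz hα hβ (↑n - ↑k) -
                (1 / 2 : ℝ) • (jqz hα hβ (↑n - ↑k + m) + jqz hα hβ (↑n - ↑k - m))) R
      have b2 := hT n k m hn
      have hRn := jN_nonneg hα hβ R
      have b3 : (1 + (k:ℝ) + (m.natAbs:ℝ))^2 ≤ (1 + (k:ℝ))^2 * (1 + (m.natAbs:ℝ))^2 := by
        rw [← mul_pow]
        gcongr
        have : (0:ℝ) ≤ k * (m.natAbs:ℝ) := by positivity
        nlinarith
      calc _ ≤ (C * ρ^m.natAbs) * ((CT * ((1 + (m.natAbs:ℝ))^2 * ((1 + (k:ℝ))^2 * (1 + (m.natAbs:ℝ))^2)) / n^2) * jN hα hβ R) := by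
            gcongr
            · exact ha m
            · refine b1.trans ?_
              gcongr
              refine b2.trans ?_
              gcongr
        _ = _ := by ring
    have hss := hs1.mul_right (CT * (1 + (k:ℝ))^2 * jN hα hβ R / n^2)
    have := tsum_of_norm_bounded hss.hasSum hbd
    rw [hd.tsum_eq, Real.norm_eq_abs, tsum_mul_right] at this
    refine this.trans (le_of_eq ?_)
    rw [← hSa]; ring
  have hWsum : HasSum (fun k : ℕ => c k * W k) (∑ k ∈ Finset.range (n+1), c k * W k) := by
    apply hasSum_sum_of_ne_finset_zero
    intro k hk
    rw [Finset.mem_range] at hk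
    simp only [hW]
    rw [jqz_neg hα hβ (by omega)]
    simp
  have hYsum : HasSum (fun k : ℕ => c k * Y k) 0 := by
    have h2 : HasSum (fun k : ℕ => ∑ l ∈ Finset.Icc (1:ℤ) n, a ((k:ℤ) - l) * c k * y l) (∑ l ∈ Finset.Icc (1:ℤ) n, 0 * y l) := by
      apply hasSum_sum
      intro l hl
      rw [Finset.mem_Icc] at hl
      obtain ⟨j, rfl⟩ : ∃ j : ℕ, l = j := ⟨l.toNat, by omega⟩
      exact (hconv j (by omega)).mul_right _
    simp only [zero_mul, Finset.sum_const_zero] at h2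
    have e : (fun k : ℕ => c k * Y k) = fun k : ℕ => ∑ l ∈ Finset.Icc (1:ℤ) n, a ((k:ℤ) - l) * c k * y l := by
      funext k
      simp only [hY, Finset.mul_sum]
      refine Finset.sum_congr rfl (fun l _ => by ring)
    rw [e]; exact h2
  have hdiff := hWsum.sub hYsum
  rw [sub_zero] at hdiff
  have hbd : ∀ k : ℕ, ‖c k * W k - c k * Y k‖ ≤ C * ((1 + (k:ℝ))^2 * ρ^k) * (CT * Sa * jN hα hβ R / n^2) := by
    intro k
    rw [← mul_sub, Real.norm_eq_abs, abs_mul]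
    calc _ ≤ (C * ρ^k) * (CT * Sa * (1 + (k:ℝ))^2 * jN hα hβ R / n^2) := by
          gcongr
          · exact hc k
          · exact hE k
      _ = _ := by ring
  have hfin := tsum_of_norm_bounded (hs2.mul_right (CT * Sa * jN hα hβ R / n^2)).hasSum hbd
  rw [hdiff.tsum_eq, Real.norm_eq_abs, tsum_mul_right, ← hSc] at hfin
  have hRn := jN_nonneg hα hβ R
  have eW : ∫ x, (h (x:ℂ)).re * ((∑ k ∈ Finset.range (n+1), c k • jq hα hβ (n - k)) * R).eval x ∂(jmu α β)
      = ∑ k ∈ Finset.range (n+1), c k * W k := by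
    have hw := cheb_int_sum hα hβ h0 h1 ha hsum ((∑ k ∈ Finset.range (n+1), c k • jq hα hβ (n - k)) * R)
    have hw2 : HasSum (fun m : ℤ => ∑ k ∈ Finset.range (n+1), c k * (a m * jI hα hβ (Polynomial.Chebyshev.T ℝ m * (jqz hα hβ ((n:ℤ) - k) * R))))
        (∑ k ∈ Finset.range (n+1), c k * W k) :=
      hasSum_sum (fun k _ => (cheb_int_sum hα hβ h0 h1 ha hsum (jqz hα hβ ((n:ℤ) - k) * R)).mul_left (c k))
    refine hw.unique ?_
    have e : (fun m : ℤ => a m * jI hα hβ (Polynomial.Chebyshev.T ℝ m * ((∑ k ∈ Finset.range (n+1), c k • jq hα hβ (n - k)) * R)))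
       = (fun m : ℤ => ∑ k ∈ Finset.range (n+1), c k * (a m * jI hα hβ (Polynomial.Chebyshev.T ℝ m * (jqz hα hβ ((n:ℤ) - k) * R)))) := by
      funext m
      rw [Finset.sum_mul, Finset.mul_sum, map_sum, Finset.mul_sum]
      refine Finset.sum_congr rfl (fun k hk => ?_)
      rw [Finset.mem_range] at hk
      rw [show (n:ℤ) - k = ((n - k : ℕ) : ℤ) by omega, jqz_nat, smul_mul_assoc, mul_smul_comm, map_smul, smul_eq_mul]
      ring
    rw [e]; exact hw2
  rw [eW]
  calc _ ≤ Sc * (CT * Sa * jN hα hβ R / n^2) := hfin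
    _ = (CT * Sa * Sc) * jN hα hβ R / n^2 := by ring
    _ ≤ _ := by gcongr; linarith

end

section
open Polynomial

variable {α β : ℝ} (hα : -1 < α) (hβ : -1 < β)

lemma jq_circle_bound {δ : ℝ} (hδ : 0 < δ) : ∃ B > 0, ∀ θ : ℝ, δ ≤ ‖1 - cexp (θ * I)^2‖ → ∀ n,
    |(jq hα hβ n).eval (Real.cos θ)| ≤ B := by
  obtain ⟨B, hB, h⟩ := jGH_bound hα hβ hδ
  refine ⟨B, hB, fun θ hθ n => ?_⟩
  have h1 := (h _ (Complex.norm_exp_ofReal_mul_I θ).le hθ n).2.2.1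
  rw [jF_eq hα hβ n (Complex.exp_ne_zero _), norm_mul, norm_pow, Complex.norm_exp_ofReal_mul_I, one_pow, one_mul] at h1
  rw [← Complex.exp_neg, show (cexp (θ * I) + cexp (-(θ * I))) / 2 = ((Real.cos θ : ℝ) : ℂ) by
    rw [Complex.ofReal_cos, Complex.cos, neg_mul], jqc_eval_real, Complex.norm_real] at h1
  exact h1

lemma jexpand_bound {δ : ℝ} (hδ : 0 < δ) : ∃ B > 0, ∀ θ : ℝ, δ ≤ ‖1 - cexp (θ * I)^2‖ → ∀ (n : ℕ) (R : ℝ[X]),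
    R.degree < n → |R.eval (Real.cos θ)| ≤ B * n * jN hα hβ R := by
  obtain ⟨B1, hB1, h1⟩ := jq_circle_bound hα hβ hδ
  obtain ⟨B2, hB2, h2⟩ := jq_norm_bounds hα hβ
  refine ⟨B2 * B2 * B1, by positivity, fun θ hθ n R hR => ?_⟩

  conv_lhs => rw [jP_expand hα hβ n R hR]
  rw [eval_finsetSum]
  refine (Finset.abs_sum_le_sum_abs _ _).trans ?_
  have hRn := jN_nonneg hα hβ R
  have : ∀ j ∈ Finset.range n, |eval (Real.cos θ) (((jI hα hβ) (R * jP hα hβ j) / (jI hα hβ) (jP hα hβ j * jP hα hβ j)) • jP hα hβ j)|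
      ≤ B2 * B2 * B1 * jN hα hβ R := by
    intro j _
    have e : eval (Real.cos θ) (((jI hα hβ) (R * jP hα hβ j) / (jI hα hβ) (jP hα hβ j * jP hα hβ j)) • jP hα hβ j)
      = (jI hα hβ) (R * jq hα hβ j) * (1 / (jI hα hβ) (jq hα hβ j * jq hα hβ j)) * (jq hα hβ j).eval (Real.cos θ) := by
      unfold jq
      have h2j : (2:ℝ)^j ≠ 0 := by positivity
      have hne := (jI_sq_pos hα hβ (jP_ne_zero hα hβ j)).ne'
      simp only [mul_smul_comm, smul_mul_assoc, map_smul, smul_eq_mul, eval_smul]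
      field_simp
    rw [e, abs_mul, abs_mul]
    have b1 := jI_cs hα hβ R (jq hα hβ j)
    have b2 := (h2 j).1
    have b3 := (h2 j).2
    have b4 := h1 θ hθ j
    have b5 : |1 / (jI hα hβ) (jq hα hβ j * jq hα hβ j)| ≤ B2 := by
      rw [abs_of_nonneg (div_nonneg zero_le_one (jI_sq_nonneg hα hβ _))]; exact b3
    have hq := jN_nonneg hα hβ (jq hα hβ j)
    calc _ ≤ (jN hα hβ R * B2) * B2 * B1 := by
          gcongr
          exact b1.trans (by gcongr)
      _ = _ := by ring
  refine (Finset.sum_le_sum this).trans ?_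
  rw [Finset.sum_const, Finset.card_range, nsmul_eq_mul]
  exact le_of_eq (by ring)

lemma pert_main {a : ℤ → ℝ} {c : ℕ → ℝ} {h : ℂ → ℂ} {ρ C : ℝ} (h0 : 0 < ρ) (h1 : ρ < 1)
    (has : ∀ m, a (-m) = a m) (ha : ∀ m, |a m| ≤ C * ρ^m.natAbs) (hc : ∀ k, |c k| ≤ C * ρ^k)
    (hc0 : 0 < c 0)
    (hsum : ∀ θ : ℝ, HasSum (fun m : ℤ => (a m : ℂ) * cexp (m * θ * I)) (h (Real.cos θ)))
    (hconv : ∀ j : ℕ, 1 ≤ j → HasSum (fun k : ℕ => a ((k:ℤ) - j) * c k) 0)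
    (hcont : ContinuousOn (fun x : ℝ => (h (x:ℂ)).re) (Icc (-1) 1))
    (hpos : ∀ x ∈ Icc (-1:ℝ) 1, 0 < (h (x:ℂ)).re)
    (P : ℕ → ℝ[X]) (hPm : ∀ n, (P n).Monic) (hPd : ∀ n, (P n).natDegree = n)
    (hPo : ∀ n : ℕ, ∀ q : ℝ[X], q.degree < n → ∫ x, (h (x:ℂ)).re * (P n * q).eval x ∂(jmu α β) = 0)
    {δ : ℝ} (hδ : 0 < δ) :
    ∃ C' > 0, ∀ θ : ℝ, δ ≤ ‖1 - cexp (θ * I)^2‖ → ∀ n : ℕ, 1 ≤ n →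
      |2^n * (P n).eval (Real.cos θ) - (∑ k ∈ Finset.range (n+1), c k * (jq hα hβ (n - k)).eval (Real.cos θ)) / c 0| ≤ C' / n := by
  obtain ⟨C1, hC1, hest⟩ := pert_est hα hβ h0 h1 has ha hc hsum hconv
  obtain ⟨B, hB, hexp⟩ := jexpand_bound hα hβ hδ
  obtain ⟨x0, hx0, hmin⟩ := isCompact_Icc.exists_isMinOn (nonempty_Icc.2 (by norm_num : (-1:ℝ) ≤ 1)) hcont
  set m0 := (h (x0:ℂ)).re with hm0
  have hm0p : 0 < m0 := hpos x0 hx0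
  refine ⟨B * (C1 / c 0 / m0), by positivity, fun θ hθ n hn => ?_⟩
  have hn0 : (0:ℝ) < n := by exact_mod_cast hn
  set Q : ℝ[X] := ∑ k ∈ Finset.range (n+1), c k • jq hα hβ (n - k) with hQ
  set R : ℝ[X] := (2:ℝ)^n • P n - (1 / c 0) • Q with hR
  have hRdeg : R.degree < n := by
    rw [← Polynomial.mem_degreeLT]
    have e : R = (2:ℝ)^n • (P n - jP hα hβ n) - (1 / c 0) • ∑ k ∈ Finset.range n, c (k+1) • jq hα hβ (n - (k+1)) := by
      rw [hR, hQ, Finset.sum_range_succ', smul_add, smul_smul, one_div_mul_cancel hc0.ne', one_smul, Nat.sub_zero,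
        smul_sub, jq]
      abel
    rw [e]
    apply Submodule.sub_mem
    · apply Submodule.smul_mem
      rw [Polynomial.mem_degreeLT]
      have hd : (P n).degree = n := by
        rw [Polynomial.degree_eq_natDegree (hPm n).ne_zero, hPd]
      have := Polynomial.degree_sub_lt_left (p := P n) (q := jP hα hβ n) (by rw [hd, jP_degree]) (hPm n).ne_zero
        (by rw [(hPm n).leadingCoeff, (jP_monic hα hβ n).leadingCoeff])
      rwa [hd] at this
    · apply Submodule.smul_mem
      apply Submodule.sum_mem
      intro k hk
      apply Submodule.smul_mem
      rw [Finset.mem_range] at hk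
      rw [Polynomial.mem_degreeLT, jq_degree]
      exact_mod_cast (by omega : n - (k+1) < n)
  have hintg : ∀ p : ℝ[X], Integrable (fun x : ℝ => (h (x:ℂ)).re * p.eval x) (jmu α β) := fun p =>
    jmu_integrable hα hβ (hcont.mul p.continuous.continuousOn)
  have e1 : ∫ x, (h (x:ℂ)).re * (R * R).eval x ∂(jmu α β) =
      -(1 / c 0) * ∫ x, (h (x:ℂ)).re * (Q * R).eval x ∂(jmu α β) := by
    have e2 : ∀ x : ℝ, (h (x:ℂ)).re * (R * R).eval x = 2^n * ((h (x:ℂ)).re * (P n * R).eval x) +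
        (-(1 / c 0)) * ((h (x:ℂ)).re * (Q * R).eval x) := by
      intro x
      have : R.eval x = 2^n * (P n).eval x - (1 / c 0) * Q.eval x := by
        rw [hR]; simp
      simp only [eval_mul]
      nth_rewrite 1 [this]
      ring
    simp only [e2]
    rw [integral_add ((hintg _).const_mul _) ((hintg _).const_mul _), integral_const_mul, integral_const_mul,
      hPo n R hRdeg]
    ring
  have e3 : m0 * jN hα hβ R ^ 2 ≤ ∫ x, (h (x:ℂ)).re * (R * R).eval x ∂(jmu α β) := by
    rw [jN_sq, jI_apply, ← integral_const_mul]
    apply integral_mono_ae ((jmu_integrable hα hβ (R*R).continuous.continuousOn).const_mul _) (hintg _)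
    filter_upwards [jmu_ae α β] with x hx
    have : m0 ≤ (h (x:ℂ)).re := hmin (Ioo_subset_Icc_self hx)
    have h2 : 0 ≤ (R * R).eval x := by rw [eval_mul]; exact mul_self_nonneg _
    exact mul_le_mul_of_nonneg_right this h2
  have e4 := hest n R hn hRdeg
  have hRn := jN_nonneg hα hβ R
  have e5 : m0 * jN hα hβ R ^ 2 ≤ (1 / c 0) * (C1 * jN hα hβ R / n^2) := by
    refine e3.trans ?_
    rw [e1]
    refine (le_abs_self _).trans ?_
    rw [abs_mul, abs_neg, abs_of_pos (by positivity : 0 < 1 / c 0)]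
    gcongr
  have e6 : jN hα hβ R ≤ C1 / c 0 / m0 / n^2 := by
    rcases eq_or_lt_of_le hRn with h | h
    · rw [← h]; positivity
    · have : (m0 * jN hα hβ R) * jN hα hβ R ≤ (C1 / c 0 / n^2) * jN hα hβ R := by
        calc _ = m0 * jN hα hβ R ^ 2 := by ring
          _ ≤ _ := e5
          _ = _ := by ring
      have h3 := le_of_mul_le_mul_right this h
      rw [div_right_comm, le_div_iff₀ hm0p]
      linarith
  have e7 := hexp θ hθ n R hRdeg
  have e8 : R.eval (Real.cos θ) = 2^n * (P n).eval (Real.cos θ) - (∑ k ∈ Finset.range (n+1), c k * (jq hα hβ (n - k)).eval (Real.cos θ)) / c 0 := by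
    rw [hR, hQ]
    simp [eval_finsetSum]
    ring
  rw [← e8]
  refine e7.trans ?_
  calc B * n * jN hα hβ R ≤ B * n * (C1 / c 0 / m0 / n^2) := by gcongr
    _ = _ := by field_simp

end

lemma norm_one_sub_sq (θ : ℝ) : ‖1 - cexp (θ * I)^2‖ = 2 * |Real.sin θ| := by
  have e : 1 - cexp (θ * I)^2 = cexp (θ * I) * ((-2 * Real.sin θ : ℝ) * I) := by
    have h1 : (Real.sin θ : ℂ) = (cexp (-θ * I) - cexp (θ * I)) * I / 2 := by
      rw [Complex.ofReal_sin, Complex.sin]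
    have h2 : cexp (θ * I) * cexp (-θ * I) = 1 := by
      rw [← Complex.exp_add]; simp
    rw [Complex.ofReal_mul, h1]
    push_cast
    linear_combination (-1 : ℂ) * h2 + (cexp (θ * I) * (cexp (-θ * I) - cexp (θ * I))) * I_sq
  rw [e, norm_mul, norm_mul, Complex.norm_exp_ofReal_mul_I, Complex.norm_I, Complex.norm_real, Real.norm_eq_abs, abs_mul]
  simp

section
open Polynomial

variable {α β : ℝ} (hα : -1 < α) (hβ : -1 < β)

lemma asym_sum {c : ℕ → ℝ} {ρ C : ℝ} (h0 : 0 < ρ) (h1 : ρ < 1) (hc : ∀ k, |c k| ≤ C * ρ^k)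
    {g : ℝ → ℂ} (hg : ∀ θ : ℝ, HasSum (fun k : ℕ => (c k : ℂ) * cexp (θ * I)^k) (g θ))
    {δ : ℝ} (hδ : 0 < δ) :
    ∃ C' > 0, ∀ θ : ℝ, δ ≤ ‖1 - cexp (θ * I)^2‖ → ∀ n : ℕ, 1 ≤ n →
      |(∑ k ∈ Finset.range (n+1), c k * (jq hα hβ (n - k)).eval (Real.cos θ)) -
        (-(cexp (-((n+1:ℕ) * θ * I)) * (jGinf α β (cexp (θ * I)) * g θ)).im / Real.sin θ)| ≤ C' / n := by
  obtain ⟨C1, hC1, hG⟩ := jG_lim hα hβ hδ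
  obtain ⟨B, hB, hGB⟩ := jGH_bound hα hβ hδ
  have hC : 0 ≤ C := by
    have := hc 0
    simp at this
    exact (abs_nonneg _).trans this
  have hs := (summable_nat_geom h0 h1 1).mul_left C
  set Sc : ℝ := ∑' k : ℕ, C * ((1 + (k:ℝ))^1 * ρ^k) with hSc
  have hScn : 0 ≤ Sc := tsum_nonneg (fun m => by positivity)
  refine ⟨(Sc * (B + C1) + 1) * (2 / δ), by positivity, fun θ hθ n hn => ?_⟩
  have hn0 : (0:ℝ) < n := by exact_mod_cast hn
  set ζ := cexp (θ * I) with hζ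
  have hζ1 : ‖ζ‖ = 1 := Complex.norm_exp_ofReal_mul_I θ
  have hsinb : δ / 2 ≤ |Real.sin θ| := by
    rw [norm_one_sub_sq] at hθ; linarith
  have hsin : Real.sin θ ≠ 0 := by
    intro h; rw [h] at hsinb; simp at hsinb; linarith
  have hGi : ‖jGinf α β ζ‖ ≤ B + C1 := by
    have a1 := hG ζ hζ1 hθ 0
    have a2 := (hGB ζ hζ1.le hθ 0).1
    have : jGinf α β ζ = jG hα hβ 0 ζ - (jG hα hβ 0 ζ - jGinf α β ζ) := by ring
    rw [this]
    refine (norm_sub_le _ _).trans ?_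
    simp at a1
    linarith
  set D : ℕ → ℂ := fun k => (c k : ℂ) * ζ^k * (if k ≤ n then jG hα hβ (n - k) ζ else 0) with hD
  have hDsum : HasSum D (∑ k ∈ Finset.range (n+1), D k) := by
    apply hasSum_sum_of_ne_finset_zero
    intro k hk
    rw [Finset.mem_range] at hk
    simp only [hD]
    rw [if_neg (by omega), mul_zero]
  have hdiff := hDsum.sub ((hg θ).mul_right (jGinf α β ζ))
  have hbd : ∀ k : ℕ, ‖D k - (c k : ℂ) * ζ^k * jGinf α β ζ‖ ≤ C * ((1 + (k:ℝ))^1 * ρ^k) * ((B + C1) / n) := by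
    intro k
    simp only [hD]
    rw [← mul_sub, norm_mul, norm_mul, norm_pow, hζ1, one_pow, mul_one, Complex.norm_real, Real.norm_eq_abs]
    have key : ‖(if k ≤ n then jG hα hβ (n - k) ζ else 0) - jGinf α β ζ‖ ≤ (1 + (k:ℝ)) * ((B + C1) / n) := by
      split_ifs with hk
      · refine (hG ζ hζ1 hθ (n - k)).trans ?_
        rw [mul_div_assoc']
        have hk' : (k:ℝ) ≤ n := by exact_mod_cast hk
        rw [Nat.cast_sub hk]
        rw [div_le_div_iff₀ (by linarith) hn0]
        have : (n:ℝ) ≤ (1 + k) * (n - k + 1) := by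
          nlinarith [mul_nonneg (Nat.cast_nonneg (α := ℝ) k) (sub_nonneg.2 hk')]
        calc C1 * n ≤ (B + C1) * n := by gcongr; linarith
          _ ≤ (B + C1) * ((1 + k) * (n - k + 1)) := by gcongr
          _ = _ := by ring
      · rw [zero_sub, norm_neg]
        refine hGi.trans ?_
        rw [mul_div_assoc', le_div_iff₀ hn0]
        have : (n:ℝ) ≤ k := by exact_mod_cast (by omega : n ≤ k)
        rw [mul_comm]
        gcongr
        linarith
    calc _ ≤ (C * ρ^k) * ((1 + (k:ℝ)) * ((B + C1) / n)) := by
          gcongr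
          exact hc k
      _ = _ := by ring
  have hfin := tsum_of_norm_bounded (hs.mul_right ((B + C1) / n)).hasSum hbd
  rw [hdiff.tsum_eq, tsum_mul_right, ← hSc] at hfin
  have e1 : (∑ k ∈ Finset.range (n+1), c k * (jq hα hβ (n - k)).eval (Real.cos θ)) =
      -(cexp (-((n+1:ℕ) * θ * I)) * ∑ k ∈ Finset.range (n+1), D k).im / Real.sin θ := by
    rw [Finset.mul_sum, Complex.im_sum, ← Finset.sum_neg_distrib, Finset.sum_div]
    refine Finset.sum_congr rfl (fun k hk => ?_)
    rw [Finset.mem_range] at hk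
    rw [jq_circle hα hβ (n - k) θ hsin]
    simp only [hD]
    rw [if_pos (by omega)]
    have e2 : cexp (-((n+1:ℕ) * θ * I)) * ((c k : ℂ) * ζ^k * jG hα hβ (n - k) ζ) =
        (c k : ℂ) * (cexp (-(((n - k + 1 : ℕ):ℂ) * θ * I)) * jG hα hβ (n - k) ζ) := by
      have : cexp (-(((n - k + 1 : ℕ):ℂ) * θ * I)) = cexp (-((n+1:ℕ) * θ * I)) * ζ^k := by
        rw [hζ, ← Complex.exp_nat_mul, ← Complex.exp_add]
        congr 1
        rw [show n - k + 1 = n + 1 - k by omega, Nat.cast_sub (by omega)]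
        ring
      rw [this]; ring
    rw [e2, Complex.im_ofReal_mul]
    ring
  rw [e1, ← sub_div, neg_sub_neg, ← Complex.sub_im, ← mul_sub, abs_div]
  have e3 : |(cexp (-((n+1:ℕ) * θ * I)) * (jGinf α β ζ * g θ - ∑ k ∈ Finset.range (n+1), D k)).im| ≤ Sc * ((B + C1) / n) := by
    refine (Complex.abs_im_le_norm _).trans ?_
    rw [norm_mul]
    have : ‖cexp (-((n+1:ℕ) * θ * I))‖ = 1 := by
      rw [show -(((n+1:ℕ):ℂ) * θ * I) = ((-((n+1:ℕ) * θ) : ℝ) : ℂ) * I by push_cast; ring, Complex.norm_exp_ofReal_mul_I]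
    rw [this, one_mul, norm_sub_rev, mul_comm (jGinf α β ζ)]
    exact hfin
  calc _ ≤ (Sc * ((B + C1) / n)) / (δ / 2) := by gcongr
    _ = (Sc * (B + C1)) * (2 / δ) / n := by field_simp
    _ ≤ _ := by gcongr; linarith

end

lemma abs_sin_nat_mul (m : ℕ) (x : ℝ) : |Real.sin (m * x)| ≤ m * |Real.sin x| := by
  induction m with
  | zero => simp
  | succ k ih =>
    rw [show ((k+1:ℕ):ℝ) * x = k * x + x by push_cast; ring, Real.sin_add]
    refine (abs_add_le _ _).trans ?_
    rw [abs_mul, abs_mul]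
    have h1 := Real.abs_cos_le_one x
    have h2 := Real.abs_cos_le_one (k * x)
    have h3 : |Real.sin (k*x)| * |Real.cos x| ≤ |Real.sin (k*x)| * 1 := by gcongr
    have h4 : |Real.cos (k*x)| * |Real.sin x| ≤ 1 * |Real.sin x| := by gcongr
    push_cast
    linarith

/-- Divided difference of cosines. -/
def dcos (θ : ℝ) (m : ℕ) (φ : ℝ) : ℝ := (Real.cos (m * φ) - Real.cos (m * θ)) / (Real.cos φ - Real.cos θ)

lemma dcos_bound (θ : ℝ) (m : ℕ) (φ : ℝ) : |dcos θ m φ| ≤ (m:ℝ)^2 := by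
  unfold dcos
  by_cases h : Real.cos φ - Real.cos θ = 0
  · rw [h]; simp
  rw [abs_div, div_le_iff₀ (abs_pos.2 h), Real.cos_sub_cos, Real.cos_sub_cos]
  rw [show (m * φ + m * θ) / 2 = m * ((φ + θ)/2) by ring, show (m * φ - m * θ) / 2 = m * ((φ - θ)/2) by ring]
  rw [abs_mul, abs_mul, abs_mul, abs_mul]
  have h1 := abs_sin_nat_mul m ((φ + θ)/2)
  have h2 := abs_sin_nat_mul m ((φ - θ)/2)
  calc _ ≤ |(-2:ℝ)| * (m * |Real.sin ((φ + θ)/2)|) * (m * |Real.sin ((φ - θ)/2)|) := by gcongr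
    _ = _ := by ring

lemma dcos_meas (θ : ℝ) (m : ℕ) : Measurable (dcos θ m) := by
  unfold dcos; fun_prop

lemma dcos_int (θ : ℝ) (m : ℕ) (a b : ℝ) : IntervalIntegrable (dcos θ m) volume a b := by
  refine IntervalIntegrable.mono_fun (g := dcos θ m) (f := fun _ => (m:ℝ)^2) intervalIntegrable_const
    (dcos_meas θ m).aestronglyMeasurable (Eventually.of_forall (fun φ => ?_))
  simpa using dcos_bound θ m φ

lemma dcos_rec {θ φ : ℝ} (h : Real.cos φ ≠ Real.cos θ) (m : ℕ) :
    dcos θ (m+2) φ = 2 * Real.cos ((m+1:ℕ) * φ) + 2 * Real.cos θ * dcos θ (m+1) φ - dcos θ m φ := by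
  unfold dcos
  have h0 : Real.cos φ - Real.cos θ ≠ 0 := sub_ne_zero.2 h
  have e : ∀ x : ℝ, Real.cos ((m+2:ℕ) * x) = 2 * Real.cos x * Real.cos ((m+1:ℕ) * x) - Real.cos (m * x) := by
    intro x
    have h1 : ((m+2:ℕ):ℝ) * x = (m+1:ℕ) * x + x := by push_cast; ring
    have h2 : (m:ℝ) * x = (m+1:ℕ) * x - x := by push_cast; ring
    rw [h1, h2, Real.cos_add, Real.cos_sub]; ring
  rw [e φ, e θ]
  field_simp
  ring

lemma dcos_integral {θ : ℝ} (h0 : 0 < θ) (h1 : θ < Real.pi) (m : ℕ) :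
    ∫ φ in (0:ℝ)..Real.pi, dcos θ m φ = Real.pi * Real.sin (m * θ) / Real.sin θ := by
  have hs : Real.sin θ ≠ 0 := (Real.sin_pos_of_pos_of_lt_pi h0 h1).ne'
  have hae : ∀ᵐ φ : ℝ ∂volume, φ ∈ Set.uIoc 0 Real.pi → Real.cos φ ≠ Real.cos θ := by
    have : ∀ᵐ φ : ℝ ∂volume, φ ≠ θ := by simp [ae_iff, measure_singleton]
    filter_upwards [this] with φ hφ hm hc
    rw [Set.uIoc_of_le Real.pi_pos.le] at hm
    exact hφ (Real.injOn_cos ⟨hm.1.le, hm.2⟩ ⟨h0.le, h1.le⟩ hc)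
  have key : ∀ m : ℕ, (∫ φ in (0:ℝ)..Real.pi, dcos θ m φ = Real.pi * Real.sin (m * θ) / Real.sin θ) ∧
      (∫ φ in (0:ℝ)..Real.pi, dcos θ (m+1) φ = Real.pi * Real.sin ((m+1:ℕ) * θ) / Real.sin θ) := by
    intro m
    induction m with
    | zero =>
      constructor
      · simp [dcos]
      · have : ∫ φ in (0:ℝ)..Real.pi, dcos θ (0+1) φ = ∫ φ in (0:ℝ)..Real.pi, (1:ℝ) := by
          apply intervalIntegral.integral_congr_ae
          filter_upwards [hae] with φ hφ hm
          have := sub_ne_zero.2 (hφ hm)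
          simp [dcos, this]
        rw [this]
        simp
        field_simp
    | succ k ih =>
      refine ⟨ih.2, ?_⟩
      have e1 : ∫ φ in (0:ℝ)..Real.pi, dcos θ (k+1+1) φ = ∫ φ in (0:ℝ)..Real.pi,
          (2 * Real.cos ((k+1:ℕ) * φ) + 2 * Real.cos θ * dcos θ (k+1) φ - dcos θ k φ) := by
        apply intervalIntegral.integral_congr_ae
        filter_upwards [hae] with φ hφ hm
        exact dcos_rec (hφ hm) k
      have e2 : ∫ φ in (0:ℝ)..Real.pi, Real.cos ((k+1:ℕ) * φ) = 0 := by
        have hk : ((k+1:ℕ):ℝ) ≠ 0 := by positivity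
        rw [intervalIntegral.integral_comp_mul_left (fun x => Real.cos x) hk, integral_cos]
        have := Real.sin_nat_mul_pi (k+1)
        simp only [mul_zero, Real.sin_zero, this]; simp
      have i1 : IntervalIntegrable (fun φ : ℝ => 2 * Real.cos ((k+1:ℕ) * φ)) volume 0 Real.pi :=
        Continuous.intervalIntegrable (by fun_prop) _ _
      have i2 := (dcos_int θ (k+1) 0 Real.pi).const_mul (2 * Real.cos θ)
      rw [e1, intervalIntegral.integral_sub (i1.add i2) (dcos_int θ k 0 Real.pi), intervalIntegral.integral_add i1 i2,
        intervalIntegral.integral_const_mul, intervalIntegral.integral_const_mul, e2, ih.1, ih.2]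
      have h3 : Real.sin ((k+1+1:ℕ) * θ) = 2 * Real.cos θ * Real.sin ((k+1:ℕ) * θ) - Real.sin (k * θ) := by
        have h1 : ((k+1+1:ℕ):ℝ) * θ = (k+1:ℕ) * θ + θ := by push_cast; ring
        have h2 : (k:ℝ) * θ = (k+1:ℕ) * θ - θ := by push_cast; ring
        rw [h1, h2, Real.sin_add, Real.sin_sub]; ring
      rw [h3]
      field_simp
      ring
  exact (key m).1

section
variable {L : ℝ → ℝ} {l : ℤ → ℝ} {ρ C : ℝ}

lemma cos_series (hls : ∀ m, l (-m) = l m)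
    (hsum : ∀ θ : ℝ, HasSum (fun m : ℤ => (l m : ℂ) * cexp (m * θ * I)) ((L (Real.cos θ) : ℝ) : ℂ)) (φ : ℝ) :
    HasSum (fun m : ℕ => 2 * l m * Real.cos (m * φ)) (L (Real.cos φ) + l 0) := by
  have h1 := Complex.hasSum_re (hsum φ).nat_add_neg
  have e : (fun m : ℕ => 2 * l m * Real.cos (m * φ)) = fun m : ℕ =>
      ((l (m:ℤ) : ℂ) * cexp (((m:ℤ):ℂ) * φ * I) + (l (-(m:ℤ)) : ℂ) * cexp (((-(m:ℤ):ℤ):ℂ) * φ * I)).re := by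
    funext m
    rw [hls, Complex.add_re, Complex.re_ofReal_mul, Complex.re_ofReal_mul,
      show (((m:ℤ):ℂ)) * φ * I = ((m * φ : ℝ) : ℂ) * I by push_cast; ring,
      show (((-(m:ℤ):ℤ):ℂ)) * φ * I = ((-(m * φ) : ℝ) : ℂ) * I by push_cast; ring,
      Complex.exp_ofReal_mul_I_re, Complex.exp_ofReal_mul_I_re, Real.cos_neg]
    ring
  rw [e]
  simpa using h1

lemma F_series (hls : ∀ m, l (-m) = l m)
    (hsum : ∀ θ : ℝ, HasSum (fun m : ℤ => (l m : ℂ) * cexp (m * θ * I)) ((L (Real.cos θ) : ℝ) : ℂ)) (θ φ : ℝ) :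
    HasSum (fun m : ℕ => 2 * l m * dcos θ m φ) ((L (Real.cos φ) - L (Real.cos θ)) / (Real.cos φ - Real.cos θ)) := by
  have h := ((cos_series hls hsum φ).sub (cos_series hls hsum θ)).div_const (Real.cos φ - Real.cos θ)
  rw [add_sub_add_right_eq_sub] at h
  have e : (fun m : ℕ => 2 * l m * dcos θ m φ) = fun m : ℕ => (2 * l m * Real.cos (m * φ) - 2 * l m * Real.cos (m * θ)) / (Real.cos φ - Real.cos θ) := by
    funext m
    unfold dcos
    ring
  rw [e]; exact h

lemma F_integral (h0 : 0 < ρ) (h1 : ρ < 1) (hlb : ∀ m, |l m| ≤ C * ρ^m.natAbs) (hls : ∀ m, l (-m) = l m)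
    (hsum : ∀ θ : ℝ, HasSum (fun m : ℤ => (l m : ℂ) * cexp (m * θ * I)) ((L (Real.cos θ) : ℝ) : ℂ))
    {S : ℝ → ℝ} (hS : ∀ θ : ℝ, HasSum (fun m : ℕ => l m * Real.sin (m * θ)) (S θ))
    {θ : ℝ} (hθ0 : 0 < θ) (hθ1 : θ < Real.pi) :
    (∃ B : ℝ, ∀ φ : ℝ, |(L (Real.cos φ) - L (Real.cos θ)) / (Real.cos φ - Real.cos θ)| ≤ B) ∧
    ∫ φ in (0:ℝ)..Real.pi, (L (Real.cos φ) - L (Real.cos θ)) / (Real.cos φ - Real.cos θ) = 2 * Real.pi * S θ / Real.sin θ := by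
  have hC : 0 ≤ C := by
    have := hlb 0
    simp at this
    exact (abs_nonneg _).trans this
  have hbd : ∀ (m : ℕ) (φ : ℝ), ‖2 * l m * dcos θ m φ‖ ≤ 2 * C * ((1 + (m:ℝ))^2 * ρ^m) := by
    intro m φ
    rw [Real.norm_eq_abs, abs_mul, abs_mul, abs_of_pos (by norm_num : (0:ℝ) < 2)]
    have a1 := hlb m
    rw [Int.natAbs_natCast] at a1
    have a2 := dcos_bound θ m φ
    have a3 : (m:ℝ)^2 ≤ (1 + (m:ℝ))^2 := by gcongr; linarith
    calc _ ≤ 2 * (C * ρ^m) * (1 + (m:ℝ))^2 := by gcongr; exact a2.trans a3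
      _ = _ := by ring
  have hsm := (summable_nat_geom h0 h1 2).mul_left (2 * C)
  constructor
  · refine ⟨∑' m : ℕ, 2 * C * ((1 + (m:ℝ))^2 * ρ^m), fun φ => ?_⟩
    have := tsum_of_norm_bounded hsm.hasSum (fun m => hbd m φ)
    rw [(F_series hls hsum θ φ).tsum_eq] at this
    exact this
  · have hs := intervalIntegral.hasSum_integral_of_dominated_convergence (μ := volume) (a := 0) (b := Real.pi)
      (F := fun (m:ℕ) (φ:ℝ) => 2 * l m * dcos θ m φ)
      (f := fun φ : ℝ => (L (Real.cos φ) - L (Real.cos θ)) / (Real.cos φ - Real.cos θ))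
      (fun m _ => 2 * C * ((1 + (m:ℝ))^2 * ρ^m))
      (fun m => ((dcos_meas θ m).const_mul _).aestronglyMeasurable)
      (fun m => Eventually.of_forall (fun φ _ => hbd m φ))
      (Eventually.of_forall (fun φ _ => hsm))
      (by simp)
      (Eventually.of_forall (fun φ _ => F_series hls hsum θ φ))
    have hs2 := (hS θ).mul_left (2 * Real.pi / Real.sin θ)
    have e : (fun m : ℕ => ∫ φ in (0:ℝ)..Real.pi, 2 * l m * dcos θ m φ) = fun m : ℕ => 2 * Real.pi / Real.sin θ * (l m * Real.sin (m * θ)) := by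
      funext m
      rw [intervalIntegral.integral_const_mul, dcos_integral hθ0 hθ1]
      ring
    rw [e] at hs
    rw [hs.unique hs2]
    ring

end

def pvA (x t : ℝ) : ℝ := 1 - x * t + Real.sqrt (1 - x^2) * Real.sqrt (1 - t^2)

def pvH (x t : ℝ) : ℝ := (Real.log (t - x) - Real.log (pvA x t)) / Real.sqrt (1 - x^2)

lemma pvA_pos {x t : ℝ} (hx : x ∈ Ioo (-1:ℝ) 1) (ht : t ∈ Icc (-1:ℝ) 1) : 0 < pvA x t := by
  unfold pvA
  have h1 : x * t < 1 := by
    have : |x * t| < 1 := by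
      rw [abs_mul]
      have a := abs_lt.2 hx
      have b := abs_le.2 ht
      calc |x| * |t| ≤ |x| * 1 := by gcongr
        _ < 1 := by rw [mul_one]; exact a
    exact (abs_lt.1 this).2
  have := mul_nonneg (Real.sqrt_nonneg (1 - x^2)) (Real.sqrt_nonneg (1 - t^2))
  linarith

lemma pvA_cont (x : ℝ) : Continuous (pvA x) := by unfold pvA; fun_prop

lemma one_sub_sq_pos {x : ℝ} (hx : x ∈ Ioo (-1:ℝ) 1) : 0 < 1 - x^2 := by
  nlinarith [hx.1, hx.2]

lemma pvH_deriv {x t : ℝ} (hx : x ∈ Ioo (-1:ℝ) 1) (ht : t ∈ Ioo (-1:ℝ) 1) (hne : t ≠ x) :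
    HasDerivAt (pvH x) (1 / (Real.sqrt (1 - t^2) * (t - x))) t := by
  have hs := Real.sqrt_pos.2 (one_sub_sq_pos hx)
  have hr := Real.sqrt_pos.2 (one_sub_sq_pos ht)
  have hs2 := Real.sq_sqrt (one_sub_sq_pos hx).le
  have hr2 := Real.sq_sqrt (one_sub_sq_pos ht).le
  have hA := pvA_pos hx (Ioo_subset_Icc_self ht)
  have htx : t - x ≠ 0 := sub_ne_zero.2 hne
  have d1 : HasDerivAt (fun t : ℝ => Real.sqrt (1 - t^2)) (-(2*t) / (2 * Real.sqrt (1 - t^2))) t := by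
    have : HasDerivAt (fun t : ℝ => 1 - t^2) (-(2*t)) t := by
      simpa using (hasDerivAt_pow 2 t).const_sub 1
    exact this.sqrt (one_sub_sq_pos ht).ne'
  have d2 : HasDerivAt (pvA x) (-x + Real.sqrt (1 - x^2) * (-(2*t) / (2 * Real.sqrt (1 - t^2)))) t := by
    have a1 : HasDerivAt (fun t : ℝ => 1 - x * t) (-x) t := by
      simpa using ((hasDerivAt_id t).const_mul x).const_sub 1
    exact a1.add (d1.const_mul _)
  have d3 : HasDerivAt (fun t : ℝ => t - x) 1 t := (hasDerivAt_id t).sub_const x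
  have d4 := ((d3.log htx).sub (d2.log hA.ne')).div_const (Real.sqrt (1 - x^2))
  refine HasDerivAt.congr_deriv d4 ?_
  have hA' : pvA x t = 1 - x * t + Real.sqrt (1 - x^2) * Real.sqrt (1 - t^2) := rfl
  set s := Real.sqrt (1 - x^2)
  set r := Real.sqrt (1 - t^2)
  set A := pvA x t
  rw [div_eq_div_iff hs.ne' (by positivity)]
  field_simp
  rw [hA']
  have : r * x ^ 2 = r * (1 - s^2) := by rw [hs2]; ring
  have h3 : t^2 = 1 - r^2 := by rw [hr2]; ring
  ring_nf
  ring_nf at this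
  rw [h3]
  linear_combination (-1) * this

lemma pv_integrable {x a b : ℝ} (ha : -1 ≤ a) (hab : a ≤ b) (hb : b ≤ 1) (hn : x ∉ Icc a b) {f : ℝ → ℝ}
    (hf : ContinuousOn f (Icc a b)) :
    IntervalIntegrable (fun t => f t / (Real.sqrt (1 - t^2) * (t - x))) volume a b := by
  have h1 : IntervalIntegrable (fun t : ℝ => Real.sqrt (1 - t^2)⁻¹) volume a b :=
    Polynomial.Chebyshev.intervalIntegrable_sqrt_one_sub_sq_inv.mono_set (by
      rw [uIcc_of_le hab, uIcc_of_le (by norm_num)]; exact Icc_subset_Icc ha hb)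
  have h2 : ContinuousOn (fun t => f t / (t - x)) (uIcc a b) := by
    rw [uIcc_of_le hab]
    refine hf.div (by fun_prop) ?_
    intro t ht h
    exact hn (by rw [← sub_eq_zero.1 h]; exact ht)
  have h3 := h1.continuousOn_mul h2
  refine h3.congr ?_
  intro t _
  simp only [Real.sqrt_inv]
  rw [div_mul_eq_div_div, div_right_comm, div_eq_mul_inv (f t / (t - x))]

lemma pv_log {x a b : ℝ} (hx : x ∈ Ioo (-1:ℝ) 1) (ha : -1 ≤ a) (hab : a ≤ b) (hb : b ≤ 1) (hn : x ∉ Icc a b) :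
    ∫ t in a..b, 1 / (Real.sqrt (1 - t^2) * (t - x)) = pvH x b - pvH x a := by
  apply intervalIntegral.integral_eq_sub_of_hasDerivAt_of_le hab
  · unfold pvH
    apply ContinuousOn.div_const
    apply ContinuousOn.sub
    · apply ContinuousOn.log (by fun_prop)
      intro t ht h
      exact hn (by rw [← sub_eq_zero.1 h]; exact ht)
    · apply ContinuousOn.log (pvA_cont x).continuousOn
      intro t ht
      exact (pvA_pos hx ⟨ha.trans ht.1, ht.2.trans hb⟩).ne'
  · intro t ht
    apply pvH_deriv hx ⟨by linarith [ht.1], by linarith [ht.2]⟩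
    rintro rfl
    exact hn (Ioo_subset_Icc_self ht)
  · exact pv_integrable (f := fun _ => 1) ha hab hb hn continuousOn_const

lemma pvH_one {x : ℝ} : pvH x 1 = 0 := by
  simp [pvH, pvA]

lemma pvH_neg_one {x : ℝ} : pvH x (-1) = 0 := by
  have : Real.log (-1 - x) = Real.log (1 + x) := by
    rw [← Real.log_neg_eq_log]; congr 1; ring
  simp [pvH, pvA, this]

lemma pv_ident {L : ℝ → ℝ} {l : ℤ → ℝ} {ρ C : ℝ} (h0 : 0 < ρ) (h1 : ρ < 1)
    (hlb : ∀ m, |l m| ≤ C * ρ^m.natAbs) (hls : ∀ m, l (-m) = l m)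
    (hsum : ∀ θ : ℝ, HasSum (fun m : ℤ => (l m : ℂ) * cexp (m * θ * I)) ((L (Real.cos θ) : ℝ) : ℂ))
    (hLc : ContinuousOn L (Icc (-1) 1))
    {S : ℝ → ℝ} (hS : ∀ θ : ℝ, HasSum (fun m : ℕ => l m * Real.sin (m * θ)) (S θ))
    {x : ℝ} (hx : x ∈ Ioo (-1:ℝ) 1) :
    Tendsto (fun ε : ℝ => (∫ t in (-1:ℝ)..(x - ε), L t / (Real.sqrt (1 - t^2) * (t - x)))
      + ∫ t in (x + ε)..(1:ℝ), L t / (Real.sqrt (1 - t^2) * (t - x))) (nhdsWithin 0 (Ioi 0))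
      (nhds (2 * Real.pi * S (Real.arccos x) / Real.sqrt (1 - x^2))) := by
  set θ := Real.arccos x with hθ
  have hcos : Real.cos θ = x := Real.cos_arccos hx.1.le hx.2.le
  have hθ0 : 0 < θ := Real.arccos_pos.2 hx.2
  have hθ1 : θ < Real.pi := by
    refine lt_of_le_of_ne (Real.arccos_le_pi x) ?_
    intro h
    rw [hθ, Real.arccos_eq_pi] at h
    linarith [hx.1]
  obtain ⟨⟨B, hB⟩, hI⟩ := F_integral h0 h1 hlb hls hsum hS hθ0 hθ1
  rw [hcos] at hB hI
  have hsin : Real.sin θ = Real.sqrt (1 - x^2) := Real.sin_arccos x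
  rw [hsin] at hI
  set G : ℝ → ℝ := fun t => ((L t - L x) / (t - x)) * Real.sqrt (1 - t^2)⁻¹ with hG
  have hGI : ∫ t in (-1:ℝ)..1, G t = 2 * Real.pi * S θ / Real.sqrt (1 - x^2) := by
    rw [← hI, ← Polynomial.Chebyshev.integral_measureT_eq_integral_cos (f := fun t => (L t - L x) / (t - x)),
      Polynomial.Chebyshev.integral_measureT]
  have hGint : IntervalIntegrable G volume (-1) 1 := by
    have hm : AEStronglyMeasurable G (volume.restrict (uIoc (-1) 1)) := by
      rw [uIoc_of_le (by norm_num)]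
      have hLm : AEStronglyMeasurable L (volume.restrict (Ioc (-1:ℝ) 1)) :=
        (hLc.mono Ioc_subset_Icc_self).aestronglyMeasurable measurableSet_Ioc
      have a1 : AEStronglyMeasurable (fun t : ℝ => (t - x)⁻¹) (volume.restrict (Ioc (-1:ℝ) 1)) :=
        (by fun_prop : Measurable (fun t : ℝ => (t - x)⁻¹)).aestronglyMeasurable
      have a2 : AEStronglyMeasurable (fun t : ℝ => Real.sqrt (1 - t^2)⁻¹) (volume.restrict (Ioc (-1:ℝ) 1)) :=
        (by fun_prop : Measurable (fun t : ℝ => Real.sqrt (1 - t^2)⁻¹)).aestronglyMeasurable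
      exact ((hLm.sub aestronglyMeasurable_const).mul a1).mul a2
    refine IntervalIntegrable.mono_fun (Polynomial.Chebyshev.intervalIntegrable_sqrt_one_sub_sq_inv.const_mul B) hm ?_
    filter_upwards [ae_restrict_mem measurableSet_uIoc] with t ht
    rw [uIoc_of_le (by norm_num)] at ht
    have hb := hB (Real.arccos t)
    rw [Real.cos_arccos ht.1.le ht.2] at hb
    simp only [hG]
    rw [norm_mul, norm_mul]
    gcongr
    exact hb.trans (le_abs_self B)
  -- the regular part
  have hlim1 : Tendsto (fun ε : ℝ => (∫ t in (-1:ℝ)..(x - ε), G t) + ∫ t in (x + ε)..(1:ℝ), G t)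
      (nhdsWithin 0 (Ioi 0)) (nhds (2 * Real.pi * S θ / Real.sqrt (1 - x^2))) := by
    have hxm : x ∈ uIcc (-1:ℝ) 1 := by rw [uIcc_of_le (by norm_num)]; exact Ioo_subset_Icc_self hx
    have hnh : uIcc (-1:ℝ) 1 ∈ nhds x := by
      rw [uIcc_of_le (by norm_num)]; exact Icc_mem_nhds hx.1 hx.2
    have c1 := ((intervalIntegral.continuousOn_primitive_interval' hGint left_mem_uIcc) x hxm).continuousAt hnh
    have c2 := ((intervalIntegral.continuousOn_primitive_interval' hGint right_mem_uIcc) x hxm).continuousAt hnh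
    have t1 : Tendsto (fun ε : ℝ => x - ε) (nhdsWithin 0 (Ioi 0)) (nhds x) := by
      have : Tendsto (fun ε : ℝ => x - ε) (nhds 0) (nhds (x - 0)) := (by fun_prop : Continuous fun ε : ℝ => x - ε).tendsto 0
      rw [sub_zero] at this
      exact this.mono_left nhdsWithin_le_nhds
    have t2 : Tendsto (fun ε : ℝ => x + ε) (nhdsWithin 0 (Ioi 0)) (nhds x) := by
      have : Tendsto (fun ε : ℝ => x + ε) (nhds 0) (nhds (x + 0)) := (by fun_prop : Continuous fun ε : ℝ => x + ε).tendsto 0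
      rw [add_zero] at this
      exact this.mono_left nhdsWithin_le_nhds
    have l1 := c1.tendsto.comp t1
    have l2 := (c2.tendsto.comp t2).neg
    have l3 := l1.add l2
    have e : (∫ t in (-1:ℝ)..x, G t) + -(∫ t in (1:ℝ)..x, G t) = 2 * Real.pi * S θ / Real.sqrt (1 - x^2) := by
      rw [← hGI, ← intervalIntegral.integral_symm]
      apply intervalIntegral.integral_add_adjacent_intervals
      · exact hGint.mono_set (by
          rw [uIcc_of_le hx.1.le, uIcc_of_le (by norm_num)]; exact Icc_subset_Icc le_rfl hx.2.le)
      · exact hGint.mono_set (by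
          rw [uIcc_of_le hx.2.le, uIcc_of_le (by norm_num)]; exact Icc_subset_Icc hx.1.le le_rfl)
    rw [e] at l3
    refine l3.congr (fun ε => ?_)
    simp only [Function.comp]
    rw [intervalIntegral.integral_symm (x + ε) 1]
    ring
  -- the logarithmic part
  have hlim2 : Tendsto (fun ε : ℝ => L x * ((Real.log (pvA x (x + ε)) - Real.log (pvA x (x - ε))) / Real.sqrt (1 - x^2)))
      (nhdsWithin 0 (Ioi 0)) (nhds 0) := by
    have hp := (pvA_pos hx (Ioo_subset_Icc_self hx)).ne'
    have c : ContinuousAt (fun ε : ℝ => L x * ((Real.log (pvA x (x + ε)) - Real.log (pvA x (x - ε))) / Real.sqrt (1 - x^2))) 0 := by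
      have a1 : ContinuousAt (fun ε : ℝ => Real.log (pvA x (x + ε))) 0 :=
        ContinuousAt.log ((pvA_cont x).comp (by fun_prop : Continuous fun ε : ℝ => x + ε)).continuousAt (by simpa using hp)
      have a2 : ContinuousAt (fun ε : ℝ => Real.log (pvA x (x - ε))) 0 :=
        ContinuousAt.log ((pvA_cont x).comp (by fun_prop : Continuous fun ε : ℝ => x - ε)).continuousAt (by simpa using hp)
      exact ((a1.sub a2).div_const _).const_mul _
    have := c.tendsto
    simp at this
    exact this.mono_left nhdsWithin_le_nhds
  have hlim := hlim1.add hlim2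
  rw [add_zero] at hlim
  refine hlim.congr' ?_
  have hev : Ioo (0:ℝ) (min (1 - x) (1 + x)) ∈ nhdsWithin (0:ℝ) (Ioi 0) :=
    Ioo_mem_nhdsGT (lt_min (by linarith [hx.2]) (by linarith [hx.1]))
  filter_upwards [hev] with ε hε
  have e1 : ε < 1 - x := lt_of_lt_of_le hε.2 (min_le_left _ _)
  have e2 : ε < 1 + x := lt_of_lt_of_le hε.2 (min_le_right _ _)
  have e3 := hε.1
  have piece : ∀ a b : ℝ, -1 ≤ a → a ≤ b → b ≤ 1 → x ∉ Icc a b →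
      ∫ t in a..b, L t / (Real.sqrt (1 - t^2) * (t - x)) = (∫ t in a..b, G t) + L x * (pvH x b - pvH x a) := by
    intro a b ha hab hb hn
    rw [← pv_log hx ha hab hb hn, ← intervalIntegral.integral_const_mul, ← intervalIntegral.integral_add]
    · apply intervalIntegral.integral_congr
      intro t ht
      rw [uIcc_of_le hab] at ht
      have : t - x ≠ 0 := fun h => hn (by rw [← sub_eq_zero.1 h]; exact ht)
      simp only [hG, Real.sqrt_inv]
      rw [div_mul_eq_div_div, mul_one_div, div_mul_eq_div_div, div_right_comm, div_right_comm (L x), sub_div, div_eq_mul_inv (L t / (t - x)),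
        div_eq_mul_inv (L x / (t - x))]
      ring
    · exact hGint.mono_set (by
        rw [uIcc_of_le hab, uIcc_of_le (by norm_num)]; exact Icc_subset_Icc ha hb)
    · exact (pv_integrable (f := fun _ => 1) ha hab hb hn continuousOn_const).const_mul _
  rw [piece (-1) (x - ε) le_rfl (by linarith) (by linarith [hx.2]) (fun h => by linarith [h.2]),
    piece (x + ε) 1 (by linarith [hx.1]) (by linarith) le_rfl (fun h => by linarith [h.1]), pvH_one, pvH_neg_one]
  have e4 : Real.log (x - ε - x) = Real.log (x + ε - x) := by
    rw [← Real.log_neg_eq_log]; congr 1; ring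
  unfold pvH
  rw [e4]
  ring

lemma log_one_sub_cos {θ : ℝ} (h0 : 0 < θ) (h1 : θ < Real.pi) :
    Real.log (1 - Real.cos θ) = Real.log 2 + 2 * Real.log (Real.sin (θ/2)) := by
  have hs : 0 < Real.sin (θ/2) := Real.sin_pos_of_pos_of_lt_pi (by linarith) (by linarith)
  have e : 1 - Real.cos θ = 2 * Real.sin (θ/2)^2 := by
    have := Real.cos_sq (θ/2)
    have h2 := Real.sin_sq_add_cos_sq (θ/2)
    rw [show 2 * (θ/2) = θ by ring] at this
    linarith
  rw [e, Real.log_mul (by norm_num) (by positivity), Real.log_pow]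
  norm_num

lemma log_one_add_cos {θ : ℝ} (h0 : 0 < θ) (h1 : θ < Real.pi) :
    Real.log (1 + Real.cos θ) = Real.log 2 + 2 * Real.log (Real.cos (θ/2)) := by
  have hs : 0 < Real.cos (θ/2) := Real.cos_pos_of_mem_Ioo ⟨by linarith, by linarith⟩
  have e : 1 + Real.cos θ = 2 * Real.cos (θ/2)^2 := by
    have := Real.cos_sq (θ/2)
    rw [show 2 * (θ/2) = θ by ring] at this
    linarith
  rw [e, Real.log_mul (by norm_num) (by positivity), Real.log_pow]
  norm_num

lemma clog_one_sub {θ : ℝ} (h0 : 0 < θ) (h1 : θ < Real.pi) :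
    Complex.log (1 - cexp (θ * I)) = (((Real.log 2 + Real.log (1 - Real.cos θ))/2 : ℝ) : ℂ) + (((θ - Real.pi)/2 : ℝ) : ℂ) * I := by
  have hs : 0 < Real.sin (θ/2) := Real.sin_pos_of_pos_of_lt_pi (by linarith) (by linarith)
  rw [log_one_sub_cos h0 h1, show (Real.log 2 + (Real.log 2 + 2 * Real.log (Real.sin (θ/2))))/2 = Real.log (2 * Real.sin (θ/2)) by
    rw [Real.log_mul (by norm_num) hs.ne']; ring]
  have e : 1 - cexp (θ * I) = cexp (((Real.log (2 * Real.sin (θ/2)) : ℝ) : ℂ) + (((θ - Real.pi)/2 : ℝ) : ℂ) * I) := by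
    rw [Complex.exp_add, ← Complex.ofReal_exp, Real.exp_log (by positivity)]
    have hc : Real.cos θ = 1 - 2 * Real.sin (θ/2)^2 := by
      have := Real.cos_sq (θ/2)
      have h2 := Real.sin_sq_add_cos_sq (θ/2)
      rw [show 2 * (θ/2) = θ by ring] at this
      linarith
    have hsn : Real.sin θ = 2 * Real.sin (θ/2) * Real.cos (θ/2) := by
      rw [← Real.sin_two_mul]; congr 1; ring
    have q1 : Real.cos ((θ - Real.pi)/2) = Real.sin (θ/2) := by
      rw [show (θ - Real.pi)/2 = θ/2 - Real.pi/2 by ring, Real.cos_sub_pi_div_two]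
    have q2 : Real.sin ((θ - Real.pi)/2) = - Real.cos (θ/2) := by
      rw [show (θ - Real.pi)/2 = θ/2 - Real.pi/2 by ring, Real.sin_sub_pi_div_two]
    apply Complex.ext
    · rw [Complex.re_ofReal_mul, Complex.exp_ofReal_mul_I_re, Complex.sub_re, Complex.exp_ofReal_mul_I_re, q1, hc, Complex.one_re]
      ring
    · rw [Complex.im_ofReal_mul, Complex.exp_ofReal_mul_I_im, Complex.sub_im, Complex.exp_ofReal_mul_I_im, q2, hsn, Complex.one_im]
      ring
  rw [e, Complex.log_exp]
  · simp
    have := Real.pi_pos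
    linarith
  · simp
    have := Real.pi_pos
    linarith

lemma clog_one_add {θ : ℝ} (h0 : 0 < θ) (h1 : θ < Real.pi) :
    Complex.log (1 + cexp (θ * I)) = (((Real.log 2 + Real.log (1 + Real.cos θ))/2 : ℝ) : ℂ) + ((θ/2 : ℝ) : ℂ) * I := by
  have hs : 0 < Real.cos (θ/2) := Real.cos_pos_of_mem_Ioo ⟨by linarith, by linarith⟩
  rw [log_one_add_cos h0 h1, show (Real.log 2 + (Real.log 2 + 2 * Real.log (Real.cos (θ/2))))/2 = Real.log (2 * Real.cos (θ/2)) by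
    rw [Real.log_mul (by norm_num) hs.ne']; ring]
  have e : 1 + cexp (θ * I) = cexp (((Real.log (2 * Real.cos (θ/2)) : ℝ) : ℂ) + ((θ/2 : ℝ) : ℂ) * I) := by
    rw [Complex.exp_add, ← Complex.ofReal_exp, Real.exp_log (by positivity)]
    have hc : Real.cos θ = 2 * Real.cos (θ/2)^2 - 1 := by
      have := Real.cos_sq (θ/2)
      rw [show 2 * (θ/2) = θ by ring] at this
      linarith
    have hsn : Real.sin θ = 2 * Real.sin (θ/2) * Real.cos (θ/2) := by
      rw [← Real.sin_two_mul]; congr 1; ring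
    apply Complex.ext
    · rw [Complex.re_ofReal_mul, Complex.exp_ofReal_mul_I_re, Complex.add_re, Complex.exp_ofReal_mul_I_re, hc, Complex.one_re]
      ring
    · rw [Complex.im_ofReal_mul, Complex.exp_ofReal_mul_I_im, Complex.add_im, Complex.exp_ofReal_mul_I_im, hsn, Complex.one_im]
      ring
  rw [e, Complex.log_exp]
  · simp
    have := Real.pi_pos
    linarith
  · simp
    have := Real.pi_pos
    linarith

/-- The leading term of the expansion in real form. -/
lemma main_term {α β θ : ℝ} (h0 : 0 < θ) (h1 : θ < Real.pi) (Lh S : ℝ) (n : ℕ) :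
    -(cexp (-((n+1:ℕ) * θ * I)) * (jGinf α β (cexp (θ * I)) * cexp (-(((1/2 * Lh : ℝ) : ℂ) + (S:ℝ) * I)))).im
    = Real.exp ((1/2 - α) * ((Real.log 2 + Real.log (1 - Real.cos θ))/2) + (1/2 - β) * ((Real.log 2 + Real.log (1 + Real.cos θ))/2)
        - 1/2 * Lh) * Real.cos ((n + 1/2) * θ + ((1/2) * (α * (θ - Real.pi) + β * θ) + S) - Real.pi/4) := by
  unfold jGinf
  rw [clog_one_sub h0 h1, clog_one_add h0 h1, ← Complex.exp_add, ← Complex.exp_add]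
  set A := (1/2 - α) * ((Real.log 2 + Real.log (1 - Real.cos θ))/2) + (1/2 - β) * ((Real.log 2 + Real.log (1 + Real.cos θ))/2)
        - 1/2 * Lh with hA
  set B := (n + 1/2) * θ + ((1/2) * (α * (θ - Real.pi) + β * θ) + S) + Real.pi/4 with hB
  have e : (-(((n+1:ℕ):ℂ) * θ * I) + (((1/2 - α) * ((((Real.log 2 + Real.log (1 - Real.cos θ))/2 : ℝ) : ℂ) + (((θ - Real.pi)/2 : ℝ) : ℂ) * I) +
      (1/2 - β) * ((((Real.log 2 + Real.log (1 + Real.cos θ))/2 : ℝ) : ℂ) + ((θ/2 : ℝ) : ℂ) * I)) + -(((1/2 * Lh : ℝ) : ℂ) + (S:ℝ) * I)))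
      = (A:ℂ) + ((-B : ℝ) : ℂ) * I := by
    rw [hA, hB]
    push_cast
    ring
  rw [e, Complex.exp_add, ← Complex.ofReal_exp, Complex.im_ofReal_mul, Complex.exp_ofReal_mul_I_im, Real.sin_neg,
    show (n + 1/2) * θ + ((1/2) * (α * (θ - Real.pi) + β * θ) + S) - Real.pi/4 = B - Real.pi/2 by rw [hB]; ring,
    Real.cos_sub_pi_div_two]
  ring

lemma integral_log_h {L : ℝ → ℝ} {l : ℤ → ℝ} {ρ C : ℝ} (h0 : 0 < ρ) (h1 : ρ < 1)
    (hlb : ∀ m, |l m| ≤ C * ρ^m.natAbs) (hls : ∀ m, l (-m) = l m)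
    (hsum : ∀ θ : ℝ, HasSum (fun m : ℤ => (l m : ℂ) * cexp (m * θ * I)) ((L (Real.cos θ) : ℝ) : ℂ))
    (hLc : ContinuousOn L (Icc (-1) 1)) :
    ∫ φ in (0:ℝ)..Real.pi, L (Real.cos φ) = Real.pi * l 0 := by
  have hbs : Summable (fun m : ℕ => 2 * C * ρ^m) := (summable_geometric_of_lt_one h0.le h1).mul_left _
  have key := intervalIntegral.hasSum_integral_of_dominated_convergence (μ := volume) (a := 0) (b := Real.pi)
    (F := fun (m : ℕ) φ => 2 * l m * Real.cos (m * φ)) (f := fun φ => L (Real.cos φ) + l 0)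
    (fun m _ => 2 * C * ρ^m)
    (fun m => (by fun_prop : Continuous (fun φ : ℝ => 2 * l m * Real.cos (m * φ))).aestronglyMeasurable)
    (fun m => Eventually.of_forall (fun φ _ => by
      rw [Real.norm_eq_abs, abs_mul, abs_mul, abs_of_pos (by norm_num : (0:ℝ) < 2)]
      have a1 := hlb m
      rw [Int.natAbs_natCast] at a1
      have a2 := Real.abs_cos_le_one (m * φ)
      have := abs_nonneg (l m)
      nlinarith [abs_nonneg (Real.cos (m * φ))]))
    (Eventually.of_forall (fun _ _ => hbs))
    (by simp)
    (Eventually.of_forall (fun φ _ => cos_series hls hsum φ))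
  have hz : ∀ m : ℕ, m ≠ 0 → ∫ φ in (0:ℝ)..Real.pi, 2 * l m * Real.cos (m * φ) = 0 := by
    intro m hm
    rw [intervalIntegral.integral_const_mul, intervalIntegral.integral_comp_mul_left _ (by exact_mod_cast hm)]
    simp
  have hu := key.unique (hasSum_single 0 (fun m hm => hz m hm))
  have hLi : IntervalIntegrable (fun φ => L (Real.cos φ)) volume 0 Real.pi := by
    apply ContinuousOn.intervalIntegrable
    exact hLc.comp Real.continuous_cos.continuousOn (fun φ _ => ⟨Real.neg_one_le_cos φ, Real.cos_le_one φ⟩)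
  rw [intervalIntegral.integral_add hLi (by simp)] at hu
  simp at hu
  linarith

lemma integral_log_sin_half : IntervalIntegrable (fun φ : ℝ => Real.log (Real.sin (φ/2))) volume 0 Real.pi ∧
    ∫ φ in (0:ℝ)..Real.pi, Real.log (Real.sin (φ/2)) = - Real.log 2 * Real.pi := by
  constructor
  · have := (intervalIntegrable_log_sin (a := 0) (b := Real.pi/2)).comp_mul_left (c := (1/2:ℝ))
    have e : (fun φ : ℝ => Real.log (Real.sin (φ/2))) = fun x => (Real.log ∘ Real.sin) (1/2 * x) := by
      funext φ; simp only [Function.comp]; congr 2; ring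
    rw [e]
    convert this using 1 <;> ring
  · rw [intervalIntegral.integral_comp_div (fun x => Real.log (Real.sin x)) (by norm_num : (2:ℝ) ≠ 0)]
    rw [zero_div, integral_log_sin_zero_pi_div_two]
    simp; ring

lemma integral_log_cos_half : IntervalIntegrable (fun φ : ℝ => Real.log (Real.cos (φ/2))) volume 0 Real.pi ∧
    ∫ φ in (0:ℝ)..Real.pi, Real.log (Real.cos (φ/2)) = - Real.log 2 * Real.pi := by
  have e : (fun φ : ℝ => Real.log (Real.cos (φ/2))) = fun φ => (fun y => Real.log (Real.sin (y/2))) (Real.pi - φ) := by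
    funext φ
    simp only
    rw [show (Real.pi - φ)/2 = Real.pi/2 - φ/2 by ring, Real.sin_pi_div_two_sub]
  obtain ⟨i1, i2⟩ := integral_log_sin_half
  constructor
  · rw [e]
    have := i1.comp_sub_left Real.pi
    simp only [sub_zero, sub_self] at this
    exact this.symm
  · rw [e, intervalIntegral.integral_comp_sub_left (fun y => Real.log (Real.sin (y/2))) Real.pi]
    simpa using i2

lemma dinf_eq {α β : ℝ} {w L : ℝ → ℝ} {l0 : ℝ} (hLc : ContinuousOn L (Icc (-1) 1))
    (hLi : ∫ φ in (0:ℝ)..Real.pi, L (Real.cos φ) = Real.pi * l0)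
    (hw : ∀ x ∈ Ioo (-1:ℝ) 1, Real.log (w x) = α * Real.log (1 - x) + β * Real.log (1 + x) + L x) :
    (1 / (2 * Real.pi)) * ∫ x in (-1:ℝ)..1, Real.log (w x) / Real.sqrt (1 - x ^ 2)
      = -(α + β)/2 * Real.log 2 + l0 / 2 := by
  have hLI : IntervalIntegrable (fun φ => L (Real.cos φ)) volume 0 Real.pi := by
    apply ContinuousOn.intervalIntegrable
    exact hLc.comp Real.continuous_cos.continuousOn (fun φ _ => ⟨Real.neg_one_le_cos φ, Real.cos_le_one φ⟩)
  have e1 : ∫ x in (-1:ℝ)..1, Real.log (w x) / Real.sqrt (1 - x ^ 2) = ∫ φ in (0:ℝ)..Real.pi, Real.log (w (Real.cos φ)) := by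
    rw [← Polynomial.Chebyshev.integral_measureT_eq_integral_cos (f := fun x => Real.log (w x)), Polynomial.Chebyshev.integral_measureT]
    simp only [Real.sqrt_inv, div_eq_mul_inv]
  obtain ⟨s1, s2⟩ := integral_log_sin_half
  obtain ⟨c1, c2⟩ := integral_log_cos_half
  have e2 : ∫ φ in (0:ℝ)..Real.pi, Real.log (w (Real.cos φ)) = ∫ φ in (0:ℝ)..Real.pi,
      ((((α + β) * Real.log 2 + 2 * α * Real.log (Real.sin (φ/2))) + 2 * β * Real.log (Real.cos (φ/2))) + L (Real.cos φ)) := by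
    rw [intervalIntegral.integral_of_le Real.pi_pos.le, intervalIntegral.integral_of_le Real.pi_pos.le,
      integral_Ioc_eq_integral_Ioo, integral_Ioc_eq_integral_Ioo]
    refine setIntegral_congr_fun measurableSet_Ioo ?_
    intro φ hφ
    simp only
    have hm : Real.cos φ ∈ Ioo (-1:ℝ) 1 := by
      constructor
      · rw [← Real.cos_pi]
        exact Real.cos_lt_cos_of_nonneg_of_le_pi hφ.1.le le_rfl hφ.2
      · rw [← Real.cos_zero]
        exact Real.cos_lt_cos_of_nonneg_of_le_pi le_rfl hφ.2.le hφ.1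
    rw [hw _ hm, log_one_sub_cos hφ.1 hφ.2, log_one_add_cos hφ.1 hφ.2]
    ring
  have i0 : IntervalIntegrable (fun _ : ℝ => (α + β) * Real.log 2) volume 0 Real.pi := by simp
  have is := s1.const_mul (2 * α)
  have ic := c1.const_mul (2 * β)
  rw [e1, e2, intervalIntegral.integral_add ((i0.add is).add ic) hLI, intervalIntegral.integral_add (i0.add is) ic,
    intervalIntegral.integral_add i0 is, intervalIntegral.integral_const_mul (2 * α), intervalIntegral.integral_const_mul (2 * β), s2, c2, hLi,
    intervalIntegral.integral_const]
  have := Real.pi_pos.ne'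
  simp only [sub_zero, smul_eq_mul]
  field_simp
  ring

lemma prefactor {α β x W Lh l0 D c0 : ℝ} (hx : x ∈ Ioo (-1:ℝ) 1)
    (hW : W = (1 - x) ^ α * (1 + x) ^ β * Real.exp Lh)
    (hD : D = Real.exp (-(α + β)/2 * Real.log 2 + l0 / 2)) (hc0 : c0 = Real.exp (-(l0/2))) :
    Real.sqrt W * (1 - x^2)^((1:ℝ)/4) / (Real.sqrt 2 * D) *
      Real.exp ((1/2 - α) * ((Real.log 2 + Real.log (1 - x))/2) + (1/2 - β) * ((Real.log 2 + Real.log (1 + x))/2)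
        - 1/2 * Lh) = c0 * Real.sqrt (1 - x^2) := by
  have p1 : 0 < 1 - x := by linarith [hx.2]
  have p2 : 0 < 1 + x := by linarith [hx.1]
  have p3 := one_sub_sq_pos hx
  have l3 : Real.log (1 - x^2) = Real.log (1 - x) + Real.log (1 + x) := by
    rw [← Real.log_mul p1.ne' p2.ne']; congr 1; ring
  have eW : Real.sqrt W = Real.exp ((Real.log (1 - x) * α + Real.log (1 + x) * β + Lh)/2) := by
    rw [hW, Real.rpow_def_of_pos p1, Real.rpow_def_of_pos p2, ← Real.exp_add, ← Real.exp_add, Real.exp_half]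
  have e4 : (1 - x^2)^((1:ℝ)/4) = Real.exp ((Real.log (1 - x) + Real.log (1 + x)) * (1/4)) := by
    rw [Real.rpow_def_of_pos p3, l3]
  have es : Real.sqrt (1 - x^2) = Real.exp ((Real.log (1 - x) + Real.log (1 + x)) / 2) := by
    rw [← l3, Real.exp_half, Real.exp_log p3]
  have e2 : Real.sqrt 2 = Real.exp (Real.log 2 / 2) := by
    rw [Real.exp_half, Real.exp_log (by norm_num)]
  rw [eW, e4, es, e2, hD, hc0, ← Real.exp_add, ← Real.exp_add, ← Real.exp_sub, ← Real.exp_add, ← Real.exp_add]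
  congr 1
  ring

lemma final_combine {κ T s c0 E cs sn C1 C2 M : ℝ} {n : ℕ} (hn : 1 ≤ n) (hc0 : 0 < c0) (hsn : 0 < sn) (hE : 0 < E)
    (hκ : κ * E = c0 * sn) (hκM : κ ≤ M) (h1 : |T - s / c0| ≤ C1 / n) (h2 : |s - E * cs / sn| ≤ C2 / n) :
    |κ * T - cs| ≤ M * (C1 + C2 / c0) / n := by
  have hκ0 : 0 < κ := by
    by_contra hc
    push Not at hc
    have : 0 < κ * E := by rw [hκ]; positivity
    nlinarith
  have e : κ * T - cs = κ * ((T - s / c0) + (s - E * cs / sn) / c0) := by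
    have : cs = κ * (E * cs / sn / c0) := by
      rw [show κ * (E * cs / sn / c0) = (κ * E) * cs / sn / c0 by ring, hκ]
      field_simp
    rw [mul_add, sub_div, mul_sub, mul_sub, ← this]
    ring
  have hn' : (0:ℝ) < n := by exact_mod_cast hn
  rw [e, abs_mul, abs_of_pos hκ0]
  have h3 : |(T - s / c0) + (s - E * cs / sn) / c0| ≤ (C1 + C2 / c0) / n := by
    refine (abs_add_le _ _).trans ?_
    rw [abs_div, abs_of_pos hc0]
    have : |s - E * cs / sn| / c0 ≤ C2 / n / c0 := by gcongr
    calc _ ≤ C1 / n + C2 / n / c0 := add_le_add h1 this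
      _ = _ := by ring
  calc κ * _ ≤ M * ((C1 + C2 / c0) / n) := by
        apply mul_le_mul hκM h3 (abs_nonneg _) (hκ0.le.trans hκM)
    _ = _ := by ring

theorem stmt9
    (α β : ℝ) (hα : -1 < α) (hβ : -1 < β)
    (U : Set ℂ) (hUopen : IsOpen U) (hUseg : seg ⊆ U)
    (h : ℂ → ℂ) (hh : AnalyticOn ℂ h U)
    (hhre : ∀ z ∈ U, 0 < (h z).re)
    (hhreal : ∀ x ∈ Set.Icc (-1:ℝ) 1, (h (x:ℂ)).im = 0)
    (w : ℝ → ℝ)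
    (hw : ∀ x ∈ Set.Ioo (-1:ℝ) 1, w x = (1 - x) ^ α * (1 + x) ^ β * (h (x:ℂ)).re)
    (P : ℕ → Polynomial ℝ)
    (hPmonic : ∀ n, (P n).Monic)
    (hPdeg : ∀ n, (P n).natDegree = n)
    (hPorth : ∀ n, ∀ k < n, ∫ x in (-1:ℝ)..1, (P n).eval x * x ^ k * w x = 0)
    (Dinf : ℝ)
    (hDinf : Dinf = Real.exp ((1 / (2 * Real.pi)) *
      ∫ x in (-1:ℝ)..1, Real.log (w x) / Real.sqrt (1 - x ^ 2)))
    (ψ : ℝ → ℝ)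
    (hψ : ∀ x ∈ Set.Ioo (-1:ℝ) 1,
      Filter.Tendsto (fun ε : ℝ =>
          (∫ t in (-1:ℝ)..(x - ε), Real.log ((h (t:ℂ)).re) / (Real.sqrt (1 - t ^ 2) * (t - x)))
          + ∫ t in (x + ε)..(1:ℝ), Real.log ((h (t:ℂ)).re) / (Real.sqrt (1 - t ^ 2) * (t - x)))
        (nhdsWithin 0 (Set.Ioi 0))
        (nhds ((ψ x - (1/2) * (α * (Real.arccos x - Real.pi) + β * Real.arccos x))
          * (2 * Real.pi) / Real.sqrt (1 - x ^ 2)))) :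
    ∀ K : Set ℝ, IsCompact K → K ⊆ Set.Ioo (-1:ℝ) 1 →
      ∃ C > (0:ℝ), ∀ n : ℕ, 1 ≤ n → ∀ x ∈ K,
        |2 ^ n * Real.sqrt (w x) * (1 - x ^ 2) ^ ((1:ℝ)/4) * (P n).eval x
            / (Real.sqrt 2 * Dinf)
          - Real.cos ((n + 1/2) * Real.arccos x + ψ x - Real.pi / 4)|
        ≤ C / n := by
  have hd : DifferentiableOn ℂ h U := hh.differentiableOn
  have hseg : Complex.ofReal '' Set.Icc (-1) 1 ⊆ U := hUseg
  obtain ⟨a, c, l, S, ρ, C0, hρ0, hρ1, hC0, has, ha, hc, hls, hl, hc0, hsa, hsl, hS, hsc, hconv⟩ :=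
    szego_pkg hUopen hseg h hd hhre hhreal
  have hcpos : 0 < c 0 := by rw [hc0]; exact Real.exp_pos _
  have hmemU : ∀ x ∈ Icc (-1:ℝ) 1, (x:ℂ) ∈ U := fun x hx => hseg ⟨x, hx, rfl⟩
  have hcont : ContinuousOn (fun x : ℝ => (h (x:ℂ)).re) (Icc (-1) 1) :=
    Complex.continuous_re.comp_continuousOn (hd.continuousOn.comp Complex.continuous_ofReal.continuousOn hmemU)
  have hpos : ∀ x ∈ Icc (-1:ℝ) 1, 0 < (h (x:ℂ)).re := fun x hx => hhre _ (hmemU x hx)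
  set L : ℝ → ℝ := fun x => Real.log (h (x:ℂ)).re with hL
  have hLc : ContinuousOn L (Icc (-1) 1) := hcont.log (fun x hx => (hpos x hx).ne')
  have hPo : ∀ n : ℕ, ∀ q : Polynomial ℝ, q.degree < n →
      ∫ x, (h (x:ℂ)).re * (P n * q).eval x ∂(jmu α β) = 0 := by
    intro n q hq
    have hk : ∀ k < n, ∫ x, (h (x:ℂ)).re * ((P n).eval x * x^k) ∂(jmu α β) = 0 := by
      intro k hk
      rw [jmu_integral, ← hPorth n k hk, intervalIntegral.integral_of_le (by norm_num), intervalIntegral.integral_of_le (by norm_num),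
        integral_Ioc_eq_integral_Ioo, integral_Ioc_eq_integral_Ioo]
      refine setIntegral_congr_fun measurableSet_Ioo ?_
      intro x hx
      simp only [hw x hx, jw]
      ring
    have e : ∀ x : ℝ, (h (x:ℂ)).re * (P n * q).eval x = ∑ k ∈ Finset.range n, q.coeff k * ((h (x:ℂ)).re * ((P n).eval x * x^k)) := by
      intro x
      by_cases hq0 : q = 0
      · simp [hq0]
      rw [Polynomial.eval_mul, Polynomial.eval_eq_sum_range' ((Polynomial.natDegree_lt_iff_degree_lt hq0).2 hq) x]
      rw [Finset.mul_sum, Finset.mul_sum]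
      refine Finset.sum_congr rfl (fun k _ => ?_)
      ring
    simp_rw [e]
    rw [integral_finsetSum]
    · refine Finset.sum_eq_zero (fun k hk' => ?_)
      rw [integral_const_mul, hk k (Finset.mem_range.1 hk'), mul_zero]
    · intro k _
      refine Integrable.const_mul ?_ _
      refine jmu_integrable hα hβ ?_
      exact hcont.mul (by fun_prop)
  have hlogI := integral_log_h (L := L) hρ0 hρ1 hl hls hsl hLc
  have hwexp : ∀ x ∈ Ioo (-1:ℝ) 1, w x = (1 - x) ^ α * (1 + x) ^ β * Real.exp (L x) := by
    intro x hx
    rw [hw x hx, hL]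
    simp only
    rw [Real.exp_log (hpos x ⟨hx.1.le, hx.2.le⟩)]
  have hDe : Dinf = Real.exp (-(α + β)/2 * Real.log 2 + l 0 / 2) := by
    rw [hDinf, dinf_eq (α := α) (β := β) hLc hlogI]
    intro x hx
    have p1 : 0 < 1 - x := by linarith [hx.2]
    have p2 : 0 < 1 + x := by linarith [hx.1]
    rw [hwexp x hx, Real.log_mul (by positivity) (by positivity), Real.log_mul (by positivity) (by positivity), Real.log_exp,
      Real.log_rpow p1, Real.log_rpow p2]
  have hψe : ∀ x ∈ Ioo (-1:ℝ) 1, ψ x = (1/2) * (α * (Real.arccos x - Real.pi) + β * Real.arccos x) + S (Real.arccos x) := by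
    intro x hx
    have hu := tendsto_nhds_unique (hψ x hx) (pv_ident (L := L) hρ0 hρ1 hl hls hsl hLc hS hx)
    have p3 : 0 < Real.sqrt (1 - x^2) := Real.sqrt_pos.2 (one_sub_sq_pos hx)
    have := Real.pi_pos
    rw [div_left_inj' p3.ne'] at hu
    have h2 : (2 * Real.pi) * (ψ x - ((1/2) * (α * (Real.arccos x - Real.pi) + β * Real.arccos x) + S (Real.arccos x))) = 0 := by
      linarith
    rcases mul_eq_zero.1 h2 with h3 | h3
    · linarith
    · linarith
  intro K hK hKs
  -- lower bound for the sine
  obtain ⟨M1, hM1⟩ := hK.exists_bound_of_continuousOn (f := fun x : ℝ => (Real.sqrt (1 - x^2))⁻¹)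
    (ContinuousOn.inv₀ (by fun_prop) (fun x hx => (Real.sqrt_pos.2 (one_sub_sq_pos (hKs hx))).ne'))
  set Ex : ℝ → ℝ := fun x => (1/2 - α) * ((Real.log 2 + Real.log (1 - x))/2) + (1/2 - β) * ((Real.log 2 + Real.log (1 + x))/2)
        - 1/2 * L x with hEx
  have hExc : ContinuousOn (fun x => Real.exp (-Ex x)) K := by
    apply Real.continuous_exp.comp_continuousOn
    apply ContinuousOn.neg
    have g1 : ContinuousOn (fun x : ℝ => Real.log (1 - x)) K :=
      ContinuousOn.log (by fun_prop) (fun x hx => by have := (hKs hx).2; linarith)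
    have g2 : ContinuousOn (fun x : ℝ => Real.log (1 + x)) K :=
      ContinuousOn.log (by fun_prop) (fun x hx => by have := (hKs hx).1; linarith)
    have g3 : ContinuousOn L K := hLc.mono (fun x hx => ⟨(hKs hx).1.le, (hKs hx).2.le⟩)
    fun_prop
  obtain ⟨M2, hM2⟩ := hK.exists_bound_of_continuousOn hExc
  have hδ : 0 < 1 / (|M1| + 1) := by positivity
  obtain ⟨C1, hC1, hP1⟩ := pert_main hα hβ hρ0 hρ1 has ha hc hcpos hsa hconv hcont hpos P hPmonic hPdeg hPo hδ
  obtain ⟨C2, hC2, hP2⟩ := asym_sum hα hβ hρ0 hρ1 hc hsc hδ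
  refine ⟨(c 0 * |M2| + 1) * (C1 + C2 / c 0), by positivity, ?_⟩
  intro n hn x hxK
  have hx := hKs hxK
  set θ := Real.arccos x with hθ
  have hcos : Real.cos θ = x := Real.cos_arccos hx.1.le hx.2.le
  have hsin : Real.sin θ = Real.sqrt (1 - x^2) := Real.sin_arccos x
  have p3 : 0 < Real.sqrt (1 - x^2) := Real.sqrt_pos.2 (one_sub_sq_pos hx)
  have hθ0 : 0 < θ := Real.arccos_pos.2 hx.2
  have hθ1 : θ < Real.pi := by
    refine lt_of_le_of_ne (Real.arccos_le_pi x) ?_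
    intro h'
    rw [h', Real.sin_pi] at hsin
    linarith
  have hδx : 1 / (|M1| + 1) ≤ ‖1 - cexp (θ * I)^2‖ := by
    rw [norm_one_sub_sq, hsin, abs_of_pos p3]
    have hb := hM1 x hxK
    rw [Real.norm_eq_abs, abs_of_pos (inv_pos.2 p3)] at hb
    have : (Real.sqrt (1 - x^2))⁻¹ ≤ |M1| + 1 := by linarith [le_abs_self M1]
    have h2 : 1 / (|M1| + 1) ≤ Real.sqrt (1 - x^2) := by
      rw [one_div]; exact inv_le_of_inv_le₀ p3 this
    linarith
  have q1 := hP1 θ hδx n hn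
  have q2 := hP2 θ hδx n hn
  rw [main_term (α := α) (β := β) hθ0 hθ1, hcos, hsin] at q2
  rw [hcos] at q1
  have hpf := prefactor (α := α) (β := β) hx (hwexp x hx) hDe hc0
  set κ := Real.sqrt (w x) * (1 - x^2)^((1:ℝ)/4) / (Real.sqrt 2 * Dinf) with hκ
  have hκM : κ ≤ c 0 * |M2| + 1 := by
    have e : κ = c 0 * Real.sqrt (1 - x^2) * Real.exp (-Ex x) := by
      rw [← hpf, mul_assoc, ← Real.exp_add]
      simp [hEx]
    have hb := hM2 x hxK
    rw [Real.norm_eq_abs, abs_of_pos (Real.exp_pos _)] at hb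
    have hs1 : Real.sqrt (1 - x^2) ≤ 1 := Real.sqrt_le_one.2 (by nlinarith [sq_nonneg x])
    calc κ = c 0 * (Real.sqrt (1 - x^2) * Real.exp (-Ex x)) := by rw [e]; ring
      _ ≤ c 0 * (1 * |M2|) := by
          gcongr
          exact hb.trans (le_abs_self _)
      _ ≤ _ := by linarith
  have fin := final_combine (n := n) hn hcpos p3 (Real.exp_pos _) hpf hκM q1 q2
  rw [hψe x hx]
  have e : 2 ^ n * Real.sqrt (w x) * (1 - x ^ 2) ^ ((1:ℝ)/4) * (P n).eval x / (Real.sqrt 2 * Dinf) = κ * (2^n * (P n).eval x) := by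
    rw [hκ]; ring
  rw [e]
  exact fin
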